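/- arXiv:1711.11060 — 5 statements merged into one kernel-verified Lean document; each statement's English description precedes it below -/
import Mathlib

section
/- Let ℓ be a positive integer and let A, B ⊆ {0, 1, …, ℓ} be sets with |A| = |B| = n ≥ 3. Assume 0, ℓ ∈ A, 0 ∈ B, and gcd(A ∪ B) = 1. Let Γ ⊆ A × B be such that A +_Γ B is (K, s)-regular for some K ≥ 2 and s ≥ 0. Then |A +_Γ B| ≥ ℓ + n − 2s if ℓ < 2n − 2K − 2, and |A +_Γ B| ≥ (θ + 1)n − 4s − 2K − θ if ℓ ≥ 2n − 2K − 2, where θ = (1+√5)/2. -/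
open Finset

/-- number of representations of `t` as `a + b` -/
def rrep {G : Type*} [AddCommGroup G] [DecidableEq G] (A B : Finset G) (t : G) : ℕ :=
  (B.filter fun b => t - b ∈ A).card

lemma rrep_comm {G : Type*} [AddCommGroup G] [DecidableEq G] (A B : Finset G) (t : G) :
    rrep A B t = rrep B A t := by
  unfold rrep
  refine Finset.card_bij' (fun b _ => t - b) (fun b _ => t - b) ?_ ?_ ?_ ?_
  · intro b hb; simp at hb ⊢; tauto
  · intro b hb; simp at hb ⊢; tauto
  · intro b hb; simp
  · intro b hb; simp

lemma rrep_shift {G : Type*} [AddCommGroup G] [DecidableEq G] (A B : Finset G) (t d : G) :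
    rrep A B t + (B.filter fun b => b + d ∈ B).card ≤ rrep A B (t + d) + B.card := by
  unfold rrep
  rw [← Finset.card_union_add_card_inter, add_comm]
  refine add_le_add ?_ (Finset.card_le_card ?_)
  · refine Finset.card_le_card_of_injOn (fun b => b + d) ?_ ?_
    · intro b hb
      simp only [coe_inter, coe_filter, Set.mem_inter_iff, Set.mem_ofPred_eq] at hb ⊢
      refine ⟨hb.2.2, ?_⟩
      have : t + d - (b + d) = t - b := by abel
      rw [this]; exact hb.1.2
    · intro x _ y _ h; simpa using h
  · exact Finset.union_subset (filter_subset _ _) (filter_subset _ _)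

lemma auto_large {G : Type*} [AddCommGroup G] [DecidableEq G] (B S : Finset G) (a₁ a₂ : G) :
    2 * B.card ≤ (B.filter fun b => b + (a₁ - a₂) ∈ B).card + S.card
      + (B.filter fun b => a₁ + b ∉ S).card + (B.filter fun b => a₂ + b ∉ S).card := by
  have h1 := Finset.card_filter_add_card_filter_not (s := B) (fun b => a₁ + b ∈ S)
  have h2 := Finset.card_filter_add_card_filter_not (s := B) (fun b => a₂ + b ∈ S)
  set P := B.filter fun b => a₁ + b ∈ S
  set Q := B.filter fun b => a₂ + b ∈ S
  have hP : (P.image fun b => a₁ + b).card = P.card :=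
    Finset.card_image_of_injective _ (add_right_injective a₁)
  have hQ : (Q.image fun b => a₂ + b).card = Q.card :=
    Finset.card_image_of_injective _ (add_right_injective a₂)
  have h3 := Finset.card_union_add_card_inter (P.image fun b => a₁ + b) (Q.image fun b => a₂ + b)
  have h4 : ((P.image fun b => a₁ + b) ∪ (Q.image fun b => a₂ + b)).card ≤ S.card := by
    apply Finset.card_le_card
    intro x hx
    simp only [P, Q, mem_union, mem_image, mem_filter] at hx
    rcases hx with ⟨b, hb, rfl⟩ | ⟨b, hb, rfl⟩
    · exact hb.2
    · exact hb.2
  have h5 : ((P.image fun b => a₁ + b) ∩ (Q.image fun b => a₂ + b)).card ≤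
      (B.filter fun b => b + (a₁ - a₂) ∈ B).card := by
    refine Finset.card_le_card_of_injOn (fun x => x - a₁) ?_ ?_
    · intro x hx
      simp only [P, Q, coe_inter, coe_image, Set.mem_inter_iff, Set.mem_image, mem_coe,
        mem_filter, coe_filter, Set.mem_ofPred_eq] at hx ⊢
      obtain ⟨⟨b, hb, rfl⟩, ⟨b', hb', h⟩⟩ := hx
      refine ⟨by simpa using hb.1, ?_⟩
      have : a₁ + b - a₁ + (a₁ - a₂) = b' := by
        have : a₁ + b - a₁ + (a₁ - a₂) = (a₁ + b) - a₂ := by abel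
        rw [this, ← h]; abel
      rw [this]; exact hb'.1
    · intro x _ y _ h; simpa using h
  omega

/-- One-sided step. -/
lemma one_side {G : Type*} [AddCommGroup G] [DecidableEq G] (A B S : Finset G) (K s : ℝ)
    (hK : 0 < K)
    (hrow : ∀ a ∈ A, ((B.filter fun b => a + b ∉ S).card : ℝ) ≤ s)
    (hcol : ∀ b ∈ B, ((A.filter fun a => a + b ∉ S).card : ℝ) ≤ s)
    (hpop : ∀ c, K ≤ (rrep A B c : ℝ) → c ∈ S)
    (hS : (S.card : ℝ) < 2 * A.card - s)
    (t : G) (ht : K + 2 * s + S.card - B.card ≤ (rrep A B t : ℝ)) :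
    (∀ x, (∃ a ∈ A, ∃ b ∈ B, x = a + b) ↔ (∃ a₁ ∈ A, ∃ a₂ ∈ A, x = t + (a₁ - a₂))) ∧
    (∀ a ∈ A, ∀ b ∈ B, a + b ∈ S) := by
  have key : ∀ a₁ ∈ A, ∀ a₂ ∈ A, K ≤ (rrep A B (t + (a₁ - a₂)) : ℝ) := by
    intro a₁ h₁ a₂ h₂
    have e1 := auto_large B S a₁ a₂
    have e2 := rrep_shift A B t (a₁ - a₂)
    have e3 := hrow a₁ h₁
    have e4 := hrow a₂ h₂
    have e1' : (2 * B.card : ℝ) ≤ (B.filter fun b => b + (a₁ - a₂) ∈ B).card + S.card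
      + (B.filter fun b => a₁ + b ∉ S).card + (B.filter fun b => a₂ + b ∉ S).card := by
      exact_mod_cast e1
    have e2' : (rrep A B t : ℝ) + (B.filter fun b => b + (a₁ - a₂) ∈ B).card ≤
      rrep A B (t + (a₁ - a₂)) + B.card := by exact_mod_cast e2
    linarith
  have key2 : ∀ a ∈ A, ∀ b ∈ B, ∃ a₁ ∈ A, ∃ a₂ ∈ A, a + b = t + (a₁ - a₂) := by
    intro a₀ h₀ b₀ hb₀
    by_contra hcon
    push Not at hcon
    have h1 := Finset.card_filter_add_card_filter_not (s := A) (fun a => a + b₀ ∈ S)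
    set P := A.filter fun a => a + b₀ ∈ S
    have hP : (P.image fun a => a + b₀).card = P.card :=
      Finset.card_image_of_injective _ (add_left_injective b₀)
    have hQ : (A.image fun a => t + (a - a₀)).card = A.card := by
      apply Finset.card_image_of_injective
      intro x y h; simpa using h
    have hd : Disjoint (P.image fun a => a + b₀) (A.image fun a => t + (a - a₀)) := by
      rw [Finset.disjoint_left]
      intro x hx hy
      simp only [P, mem_image, mem_filter] at hx hy
      obtain ⟨a, ⟨ha, -⟩, rfl⟩ := hx
      obtain ⟨a', ha', h⟩ := hy
      refine hcon a' ha' a ha ?_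
      have : a₀ + b₀ = (a + b₀) + (a₀ - a) := by abel
      rw [this, ← h]; abel
    have hsub : (P.image fun a => a + b₀) ∪ (A.image fun a => t + (a - a₀)) ⊆ S := by
      intro x hx
      simp only [P, mem_union, mem_image, mem_filter] at hx
      rcases hx with ⟨a, ha, rfl⟩ | ⟨a, ha, rfl⟩
      · exact ha.2
      · exact hpop _ (key a ha a₀ h₀)
    have h2 := Finset.card_le_card hsub
    rw [Finset.card_union_of_disjoint hd, hP, hQ] at h2
    have h3 := hcol b₀ hb₀
    have h1' : (P.card : ℝ) + (A.filter fun a => a + b₀ ∉ S).card = A.card := by exact_mod_cast h1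
    have h2' : (P.card : ℝ) + A.card ≤ S.card := by exact_mod_cast h2
    linarith
  refine ⟨fun x => ⟨?_, ?_⟩, ?_⟩
  · rintro ⟨a, ha, b, hb, rfl⟩
    exact key2 a ha b hb
  · rintro ⟨a₁, h₁, a₂, h₂, rfl⟩
    have h := key a₁ h₁ a₂ h₂
    have h' : 0 < rrep A B (t + (a₁ - a₂)) := by
      have : (0:ℝ) < rrep A B (t + (a₁ - a₂)) := by linarith
      exact_mod_cast this
    obtain ⟨b, hb⟩ := Finset.card_pos.1 h'
    simp only [mem_filter] at hb
    exact ⟨_, hb.2, b, hb.1, by abel⟩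
  · intro a ha b hb
    obtain ⟨a₁, h₁, a₂, h₂, h⟩ := key2 a ha b hb
    rw [h]
    exact hpop _ (key a₁ h₁ a₂ h₂)

/-- the golden ratio step -/
lemma golden {G : Type*} [AddCommGroup G] [DecidableEq G] (A B S : Finset G) (K s N θ : ℝ)
    (hK : 0 < K) (hs : 0 ≤ s) (hN : 0 < N) (hθ : θ ^ 2 = θ + 1) (hθ1 : 1.618 < θ)
    (hθ2 : θ < 1.6181)
    (hA : N ≤ A.card) (hB : N ≤ B.card)
    (hrow : ∀ a ∈ A, ((B.filter fun b => a + b ∉ S).card : ℝ) ≤ s)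
    (hcol : ∀ b ∈ B, ((A.filter fun a => a + b ∉ S).card : ℝ) ≤ s)
    (hpop : ∀ c, K ≤ (rrep A B c : ℝ) → c ∈ S)
    (hS : (S.card : ℝ) < θ * N - 2 * s - K) :
    ∃ t, (∀ x, (∃ a ∈ A, ∃ b ∈ B, x = a + b) ↔ (∃ a₁ ∈ A, ∃ a₂ ∈ A, x = t + (a₁ - a₂))) ∧
      (∀ x, (∃ a ∈ A, ∃ b ∈ B, x = a + b) ↔ (∃ b₁ ∈ B, ∃ b₂ ∈ B, x = t + (b₁ - b₂))) ∧
      (∀ a ∈ A, ∀ b ∈ B, a + b ∈ S) := by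
  have hmax : ∃ t, K + 2 * s + S.card - N ≤ (rrep A B t : ℝ) := by
    by_contra hcon
    push Not at hcon
    have h1 : ∑ c ∈ S, rrep A B c = ∑ b ∈ B, (A.filter fun a => a + b ∈ S).card := by
      unfold rrep
      simp only [Finset.card_filter]
      rw [Finset.sum_comm]
      refine Finset.sum_congr rfl fun b hb => ?_
      rw [← Finset.card_filter, ← Finset.card_filter]
      refine Finset.card_bij' (fun c _ => c - b) (fun a _ => a + b) ?_ ?_ ?_ ?_
      · intro c hc; simp at hc ⊢; tauto
      · intro c hc; simp at hc ⊢; tauto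
      · intro c hc; simp
      · intro c hc; simp
    have h2 : (B.card : ℝ) * (A.card - s) ≤ ∑ b ∈ B, ((A.filter fun a => a + b ∈ S).card : ℝ) := by
      rw [← nsmul_eq_mul]
      apply Finset.card_nsmul_le_sum
      intro b hb
      have h1 := Finset.card_filter_add_card_filter_not (s := A) (fun a => a + b ∈ S)
      have h1' : ((A.filter fun a => a + b ∈ S).card : ℝ) + (A.filter fun a => a + b ∉ S).card
        = A.card := by exact_mod_cast h1
      have := hcol b hb
      linarith
    have h3 : ∑ c ∈ S, (rrep A B c : ℝ) ≤ S.card * (K + 2 * s + S.card - N) := by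
      rw [← nsmul_eq_mul]
      apply Finset.sum_le_card_nsmul
      intro c _; exact (hcon c).le
    have h4 : ∑ c ∈ S, (rrep A B c : ℝ) = ∑ b ∈ B, ((A.filter fun a => a + b ∈ S).card : ℝ) := by
      exact_mod_cast h1
    have hy : (0:ℝ) ≤ S.card := by positivity
    have h5 : (S.card : ℝ) * (K + 2 * s + S.card - N) ≤ S.card * ((θ - 1) * N) :=
      mul_le_mul_of_nonneg_left (by linarith) hy
    have h6 : (S.card : ℝ) * ((θ - 1) * N) < (θ * N - 2 * s - K) * ((θ - 1) * N) :=
      mul_lt_mul_of_pos_right hS (mul_pos (by linarith) hN)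
    have h7 : N * (N - s) ≤ B.card * (A.card - s) := by
      apply mul_le_mul hB (by linarith) (by nlinarith) (by linarith)
    have h8 : (θ * N - 2 * s - K) * ((θ - 1) * N) = N * (N - (θ - 1) * (2 * s + K)) := by
      linear_combination (N^2) * hθ
    have h9 : N * (N - (θ - 1) * (2 * s + K)) ≤ N * (N - s) := by
      apply mul_le_mul_of_nonneg_left _ hN.le
      nlinarith
    linarith
  obtain ⟨t, ht⟩ := hmax
  have e1 := one_side A B S K s hK hrow hcol hpop (by nlinarith) t (by linarith)
  have e2 := one_side B A S K s hK (by simpa [add_comm] using hcol) (by simpa [add_comm] using hrow)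
    (by intro c hc; rw [rrep_comm] at hc; exact hpop c hc) (by nlinarith) t
    (by rw [rrep_comm]; linarith)
  refine ⟨t, e1.1, fun x => ?_, e1.2⟩
  rw [← e2.1 x]
  constructor
  · rintro ⟨a, ha, b, hb, rfl⟩; exact ⟨b, hb, a, ha, add_comm _ _⟩
  · rintro ⟨a, ha, b, hb, rfl⟩; exact ⟨b, hb, a, ha, add_comm _ _⟩

/-- stabilizer of a finite set -/
def stabD {G : Type*} [AddCommGroup G] (D : Finset G) : AddSubgroup G where
  carrier := {h | ∀ x, x ∈ D ↔ x + h ∈ D}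
  zero_mem' := by intro x; simp
  add_mem' := by
    intro a b ha hb x
    rw [ha x, hb (x + a), add_assoc]
  neg_mem' := by
    intro a ha x
    rw [ha (x + -a)]; simp

lemma mem_stabD {G : Type*} [AddCommGroup G] (D : Finset G) (h : G) :
    h ∈ stabD D ↔ ∀ x, x ∈ D ↔ x + h ∈ D := Iff.rfl

lemma gap_stab {G : Type*} [AddCommGroup G] [DecidableEq G] (A D : Finset G)
    (hD : ∀ x, x ∈ D ↔ ∃ a ∈ A, ∃ b ∈ A, x = a - b) (w : G)
    (hw : (D.filter fun x => x + w ∉ D).card + D.card < 2 * A.card) (z : G) (hz : z ∈ D) :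
    z + w ∈ D := by
  obtain ⟨a, ha, a', ha', rfl⟩ := (hD z).1 hz
  by_contra hcon
  have h1 := Finset.card_filter_add_card_filter_not (s := A) (fun b => a - b + w ∈ D)
  have h2 : (A.filter fun b => a - b + w ∉ D).card ≤ (D.filter fun x => x + w ∉ D).card := by
    refine Finset.card_le_card_of_injOn (fun b => a - b) ?_ ?_
    · intro b hb
      simp only [mem_coe, mem_filter] at hb ⊢
      exact ⟨(hD _).2 ⟨a, ha, b, hb.1, rfl⟩, hb.2⟩
    · intro x _ y _ h; simpa using h
  set P := A.filter fun b => a - b + w ∈ D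
  have hP : (P.image fun b => a - b + w).card = P.card := by
    apply Finset.card_image_of_injective
    intro x y h; simpa using h
  have hQ : (A.image fun b => a' - b).card = A.card := by
    apply Finset.card_image_of_injective
    intro x y h; simpa using h
  have hd : Disjoint (P.image fun b => a - b + w) (A.image fun b => a' - b) := by
    rw [Finset.disjoint_left]
    intro x hx hy
    simp only [P, mem_image, mem_filter] at hx hy
    obtain ⟨b, ⟨hb, -⟩, rfl⟩ := hx
    obtain ⟨b', hb', h⟩ := hy
    apply hcon
    refine (hD _).2 ⟨b, hb, b', hb', ?_⟩
    have : a - a' + w = (a - b + w) + (b - a') := by abel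
    rw [this, ← h]; abel
  have hsub : (P.image fun b => a - b + w) ∪ (A.image fun b => a' - b) ⊆ D := by
    intro x hx
    simp only [P, mem_union, mem_image, mem_filter] at hx
    rcases hx with ⟨b, hb, rfl⟩ | ⟨b, hb, rfl⟩
    · exact hb.2
    · exact (hD _).2 ⟨a', ha', b, hb, rfl⟩
  have h3 := Finset.card_le_card hsub
  rw [Finset.card_union_of_disjoint hd, hP, hQ] at h3
  omega

lemma freiman_diff {G : Type*} [AddCommGroup G] [DecidableEq G] [Fintype G] (A D : Finset G)
    (hD : ∀ x, x ∈ D ↔ ∃ a ∈ A, ∃ b ∈ A, x = a - b) (hc : 3 * D.card < 5 * A.card) :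
    (∀ x ∈ D, ∀ y ∈ D, x + y ∈ D) ∨ 2 * A.card ≤ Nat.card (stabD D) + D.card := by
  have hneg : ∀ x ∈ D, -x ∈ D := by
    intro x hx
    obtain ⟨a, ha, b, hb, rfl⟩ := (hD x).1 hx
    exact (hD _).2 ⟨b, hb, a, ha, by abel⟩
  have f1 : ∀ d ∈ D, 2 * A.card ≤ (A.filter fun a => a + d ∈ A).card + D.card := by
    intro d hd
    obtain ⟨a, ha, b, hb, rfl⟩ := (hD d).1 hd
    have h := auto_large A D (-b) (-a)
    have e1 : (A.filter fun x => -b + x ∉ D) = ∅ := by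
      apply Finset.filter_eq_empty_iff.2
      intro x hx; rw [not_not]; exact (hD _).2 ⟨x, hx, b, hb, by abel⟩
    have e2 : (A.filter fun x => -a + x ∉ D) = ∅ := by
      apply Finset.filter_eq_empty_iff.2
      intro x hx; rw [not_not]; exact (hD _).2 ⟨x, hx, a, ha, by abel⟩
    rw [e1, e2] at h
    have e3 : -b - -a = a - b := by abel
    rw [e3] at h
    simpa using h
  by_cases hall : ∀ d ∈ D, A.card < 2 * (A.filter fun a => a + d ∈ A).card
  · left
    intro x hx y hy
    have h1 := hall x hx
    have h2 := hall (-y) (hneg y hy)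
    have h3 := Finset.card_union_add_card_inter (A.filter fun a => a + x ∈ A)
      (A.filter fun a => a + -y ∈ A)
    have h4 : ((A.filter fun a => a + x ∈ A) ∪ (A.filter fun a => a + -y ∈ A)).card ≤ A.card :=
      Finset.card_le_card (Finset.union_subset (filter_subset _ _) (filter_subset _ _))
    have h5 : 0 < ((A.filter fun a => a + x ∈ A) ∩ (A.filter fun a => a + -y ∈ A)).card := by
      omega
    obtain ⟨a, ha⟩ := Finset.card_pos.1 h5
    simp only [mem_inter, mem_filter] at ha
    exact (hD _).2 ⟨a + x, ha.1.2, a + -y, ha.2.2, by abel⟩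
  · right
    push Not at hall
    obtain ⟨d, hd, hρ⟩ := hall
    have hρ2 := f1 d hd
    set A1 := A.filter fun a => a + d ∈ A with hA1
    set A2 := A ∪ A.image (fun a => a + d) with hA2
    have cA2 : A2.card + A1.card = 2 * A.card := by
      have h := Finset.card_union_add_card_inter A (A.image (fun a => a + d))
      have h2 : (A.image (fun a => a + d)).card = A.card :=
        Finset.card_image_of_injective _ (add_left_injective d)
      have h3 : (A ∩ A.image (fun a => a + d)) = A1.image (fun a => a + d) := by
        ext x
        simp only [hA1, mem_inter, mem_image, mem_filter]
        constructor
        · rintro ⟨hx, a, ha, rfl⟩; exact ⟨a, ⟨ha, hx⟩, rfl⟩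
        · rintro ⟨a, ⟨ha, hx⟩, rfl⟩; exact ⟨hx, a, ha, rfl⟩
      have h4 : (A1.image (fun a => a + d)).card = A1.card :=
        Finset.card_image_of_injective _ (add_left_injective d)
      rw [← hA2, h3, h4, h2] at h
      omega
    have hsub : ∀ a ∈ A1, ∀ x ∈ A2, x - (a + d) ∈ D := by
      intro a ha x hx
      simp only [hA1, hA2, mem_union, mem_image, mem_filter] at ha hx
      rcases hx with hx | ⟨b, hb, rfl⟩
      · exact (hD _).2 ⟨x, hx, a + d, ha.2, rfl⟩
      · exact (hD _).2 ⟨b, hb, a, ha.1, by abel⟩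
    have hshift : ∀ a ∈ A1, ∀ b ∈ A1, ∀ z ∈ D, z + (a - b) ∈ D := by
      intro a ha b hb z hz
      refine gap_stab A D hD _ ?_ z hz
      have h1 := Finset.card_filter_add_card_filter_not (s := D) (fun x => x + (a - b) ∈ D)
      have h2 := Finset.card_union_add_card_inter (A2.image fun x => x - (a + d))
        (A2.image fun x => x - (b + d))
      rw [Finset.card_image_of_injective _ (sub_left_injective),
        Finset.card_image_of_injective _ (sub_left_injective)] at h2
      have h3 : ((A2.image fun x => x - (a + d)) ∪ (A2.image fun x => x - (b + d))).card
          ≤ D.card := by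
        apply Finset.card_le_card
        intro y hy
        simp only [mem_union, mem_image] at hy
        rcases hy with ⟨x, hx, rfl⟩ | ⟨x, hx, rfl⟩
        · exact hsub a ha x hx
        · exact hsub b hb x hx
      have h4 : ((A2.image fun x => x - (a + d)) ∩ (A2.image fun x => x - (b + d))).card
          ≤ (D.filter fun x => x + (a - b) ∈ D).card := by
        apply Finset.card_le_card
        intro y hy
        simp only [mem_inter, mem_image, mem_filter] at hy ⊢
        obtain ⟨⟨x, hx, rfl⟩, -⟩ := hy
        refine ⟨hsub a ha x hx, ?_⟩
        have : x - (a + d) + (a - b) = x - (b + d) := by abel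
        rw [this]; exact hsub b hb x hx
      omega
    have hmem : ∀ a ∈ A1, ∀ b ∈ A1, a - b ∈ stabD D := by
      intro a ha b hb
      rw [mem_stabD]
      intro x
      refine ⟨hshift a ha b hb x, fun h => ?_⟩
      have := hshift b hb a ha _ h
      have e : x + (a - b) + (b - a) = x := by abel
      rwa [e] at this
    have hpos : 0 < A1.card := by omega
    obtain ⟨a0, ha0⟩ := Finset.card_pos.1 hpos
    have hle : A1.card ≤ Nat.card (stabD D) := by
      have := Nat.card_le_card_of_injective (fun a : A1 => (⟨a - a0, hmem a a.2 a0 ha0⟩ : stabD D))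
        (fun x y h => Subtype.ext (sub_left_injective (congrArg Subtype.val h)))
      simpa using this
    omega

/-- `S` a finite set inside a union of cosets -/
lemma card_coset_le {G : Type*} [AddCommGroup G] [Fintype G] (H : AddSubgroup G)
    (g : G) (T : Finset G) (hT : ∀ x ∈ T, x - g ∈ H) : T.card ≤ Nat.card H := by
  have := Nat.card_le_card_of_injective (fun a : T => (⟨a - g, hT a a.2⟩ : H))
        (fun x y h => Subtype.ext (sub_left_injective (congrArg Subtype.val h)))
  simpa using this

lemma card_coset {G : Type*} [AddCommGroup G] [DecidableEq G] [Fintype G] (H : AddSubgroup G)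
    (g : G)
    [DecidablePred fun x => x - g ∈ H] : (univ.filter fun x => x - g ∈ H).card = Nat.card H := by
  apply le_antisymm
  · exact card_coset_le H g _ (by simp)
  · have := Nat.card_le_card_of_injective
      (fun a : H => (⟨a + g, by simp⟩ : (univ.filter fun x => x - g ∈ H : Finset G)))
      (fun x y h => Subtype.ext (add_left_injective g (congrArg Subtype.val h)))
    simpa only [Nat.card_eq_fintype_card (α := (univ.filter fun x => x - g ∈ H : Finset G)),
      Fintype.card_coe] using this

lemma structure_lem {G : Type*} [AddCommGroup G] [DecidableEq G] [Fintype G] (A D : Finset G)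
    (hD : ∀ x, x ∈ D ↔ ∃ a ∈ A, ∃ b ∈ A, x = a - b) (h0 : (0 : G) ∈ A)
    (hc : (D.card : ℝ) < 1.62 * A.card) :
    (∀ x ∈ D, ∀ y ∈ D, x + y ∈ D) ∨
    ∃ g ∈ D, g ∉ stabD D ∧ g + g ∉ stabD D ∧ (∀ a ∈ A, a ∈ stabD D ∨ a - g ∈ stabD D) ∧
      (∀ x ∈ D, x ∈ stabD D ∨ x - g ∈ stabD D ∨ x + g ∈ stabD D) ∧
      3 * Nat.card (stabD D) ≤ D.card := by
  classical
  by_cases hcl : ∀ x ∈ D, ∀ y ∈ D, x + y ∈ D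
  · exact Or.inl hcl
  right
  set H := stabD D with hH
  have h0D : (0 : G) ∈ D := (hD 0).2 ⟨0, h0, 0, h0, by simp⟩
  have hHD : ∀ h ∈ H, h ∈ D := by
    intro h hh
    have := ((mem_stabD D h).1 hh 0).1 h0D
    simpa using this
  have hHpos : 0 < Nat.card H := Nat.card_pos
  set A' : Finset G := univ.filter fun x => ∃ a ∈ A, x - a ∈ H with hA'
  have hAA' : A ⊆ A' := by
    intro a ha; simp only [hA', mem_filter, mem_univ, true_and]
    exact ⟨a, ha, by simp⟩
  have hD' : ∀ x, x ∈ D ↔ ∃ a ∈ A', ∃ b ∈ A', x = a - b := by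
    intro x
    constructor
    · intro hx
      obtain ⟨a, ha, b, hb, rfl⟩ := (hD x).1 hx
      exact ⟨a, hAA' ha, b, hAA' hb, rfl⟩
    · rintro ⟨a, ha, b, hb, rfl⟩
      simp only [hA', mem_filter, mem_univ, true_and] at ha hb
      obtain ⟨a1, ha1, ha2⟩ := ha
      obtain ⟨b1, hb1, hb2⟩ := hb
      have h1 : a1 - b1 ∈ D := (hD _).2 ⟨a1, ha1, b1, hb1, rfl⟩
      have h2 := ((mem_stabD D _).1 (H.sub_mem ha2 hb2) (a1 - b1)).1 h1
      have e : a1 - b1 + (a - a1 - (b - b1)) = a - b := by abel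
      rwa [e] at h2
  have hcA : (A.card : ℝ) ≤ A'.card := by exact_mod_cast Finset.card_le_card hAA'
  have hc' : 3 * D.card < 5 * A'.card := by
    have : (3 * D.card : ℝ) < 5 * A'.card := by
      linarith [(Nat.cast_nonneg A'.card : (0:ℝ) ≤ A'.card)]
    exact_mod_cast this
  have hF := (freiman_diff A' D hD' hc').resolve_left hcl
  rw [← hH] at hF
  obtain ⟨g, hgA, hgH⟩ : ∃ g ∈ A, g ∉ H := by
    by_contra hcon
    push Not at hcon
    apply hcl
    intro x hx y hy
    obtain ⟨a, ha, b, hb, rfl⟩ := (hD x).1 hx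
    obtain ⟨a', ha', b', hb', rfl⟩ := (hD y).1 hy
    exact hHD _ (H.add_mem (H.sub_mem (hcon a ha) (hcon b hb)) (H.sub_mem (hcon a' ha') (hcon b' hb')))
  have hgD : g ∈ D := (hD g).2 ⟨g, hgA, 0, h0, by simp⟩
  have hcover : ∀ a ∈ A, (univ.filter fun x => x - a ∈ H) ⊆ A' := by
    intro a ha x hx
    simp only [hA', mem_filter, mem_univ, true_and] at hx ⊢
    exact ⟨a, ha, hx⟩
  have hdisj : ∀ a b : G, a - b ∉ H → Disjoint (univ.filter fun x => x - a ∈ H)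
      (univ.filter fun x => x - b ∈ H) := by
    intro a b hab
    rw [Finset.disjoint_left]
    intro x hx hy
    simp only [mem_filter, mem_univ, true_and] at hx hy
    apply hab
    have := H.sub_mem hy hx
    have e : x - b - (x - a) = a - b := by abel
    rwa [e] at this
  have hA2 : 2 * Nat.card H ≤ A'.card := by
    have h := Finset.card_le_card (Finset.union_subset (hcover g hgA) (hcover 0 h0))
    rw [Finset.card_union_of_disjoint (hdisj g 0 (by simpa using hgH)), card_coset, card_coset] at h
    omega
  have hAcos : ∀ a ∈ A, a ∈ H ∨ a - g ∈ H := by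
    intro a ha
    by_contra hcon
    push Not at hcon
    have h := Finset.card_le_card (Finset.union_subset (hcover a ha) (Finset.union_subset
      (hcover g hgA) (hcover 0 h0)))
    rw [Finset.card_union_of_disjoint, Finset.card_union_of_disjoint (hdisj g 0 (by simpa using hgH)),
      card_coset, card_coset, card_coset] at h
    · have h' : (3 * Nat.card H : ℝ) ≤ A'.card := by
        have : 3 * Nat.card H ≤ A'.card := by omega
        exact_mod_cast this
      have hF' : (2 * A'.card : ℝ) ≤ Nat.card H + D.card := by exact_mod_cast hF
      have hp : (0 : ℝ) < Nat.card H := by exact_mod_cast hHpos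
      linarith
    · rw [Finset.disjoint_union_right]
      exact ⟨hdisj _ _ hcon.2, hdisj _ _ (by simpa using hcon.1)⟩
  have hDcos : ∀ x ∈ D, x ∈ H ∨ x - g ∈ H ∨ x + g ∈ H := by
    intro x hx
    obtain ⟨a, ha, b, hb, rfl⟩ := (hD x).1 hx
    rcases hAcos a ha with h1 | h1 <;> rcases hAcos b hb with h2 | h2
    · exact Or.inl (H.sub_mem h1 h2)
    · right; right
      have := H.sub_mem h1 h2
      have e : a - (b - g) = a - b + g := by abel
      rwa [e] at this
    · right; left
      have := H.sub_mem h1 h2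
      have e : (a - g) - b = a - b - g := by abel
      rwa [e] at this
    · left
      have := H.sub_mem h1 h2
      have e : (a - g) - (b - g) = a - b := by abel
      rwa [e] at this
  refine ⟨g, hgD, hgH, ?_, hAcos, hDcos, by omega⟩
  intro hgg
  have hsub : D ⊆ (univ.filter fun x => x - g ∈ H) ∪ (univ.filter fun x => x - 0 ∈ H) := by
    intro x hx
    simp only [mem_union, mem_filter, mem_univ, true_and, sub_zero]
    rcases hDcos x hx with h | h | h
    · exact Or.inr h
    · exact Or.inl h
    · left
      have := H.sub_mem h hgg
      have e : x + g - (g + g) = x - g := by abel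
      rwa [e] at this
  have h := (Finset.card_le_card hsub).trans (Finset.card_union_le _ _)
  rw [card_coset, card_coset] at h
  omega

lemma zsum (A B P Q : Finset ℤ) (Γ : Finset (ℤ × ℤ)) (s : ℝ)
    (hreg1 : ∀ a ∈ A, ((B.filter fun b => (a, b) ∉ Γ).card : ℝ) ≤ s)
    (hreg1' : ∀ b ∈ B, ((A.filter fun a => (a, b) ∉ Γ).card : ℝ) ≤ s)
    (hPA : P ⊆ A) (hQB : Q ⊆ B) (hP : P.Nonempty) (hQ : Q.Nonempty) (W : Finset ℤ)
    (hW : ∀ p ∈ P, ∀ q ∈ Q, (p, q) ∈ Γ → p + q ∈ W) :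
    (P.card : ℝ) + Q.card - 1 - 2 * s ≤ W.card := by
  set m := P.min' hP
  set M := Q.max' hQ
  have hm : m ∈ P := P.min'_mem hP
  have hM : M ∈ Q := Q.max'_mem hQ
  set X := Q.image (fun q => m + q)
  set Y := P.image (fun p => p + M)
  have cX : X.card = Q.card := Finset.card_image_of_injective _ (add_right_injective m)
  have cY : Y.card = P.card := Finset.card_image_of_injective _ (add_left_injective M)
  have hXY : (X ∩ Y).card ≤ 1 := by
    have : X ∩ Y ⊆ {m + M} := by
      intro x hx
      simp only [X, Y, mem_inter, mem_image, mem_singleton] at hx ⊢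
      obtain ⟨⟨q, hq, rfl⟩, p, hp, h⟩ := hx
      have h1 : m ≤ p := P.min'_le p hp
      have h2 : q ≤ M := Q.le_max' q hq
      omega
    simpa using Finset.card_le_card this
  have hun := Finset.card_union_add_card_inter X Y
  have hsub : X ∪ Y ⊆ W ∪ ((B.filter fun b => (m, b) ∉ Γ).image (fun q => m + q) ∪
      (A.filter fun a => (a, M) ∉ Γ).image (fun p => p + M)) := by
    intro x hx
    simp only [X, Y, mem_union, mem_image, mem_filter] at hx ⊢
    rcases hx with ⟨q, hq, rfl⟩ | ⟨p, hp, rfl⟩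
    · by_cases h : (m, q) ∈ Γ
      · exact Or.inl (hW m hm q hq h)
      · exact Or.inr (Or.inl ⟨q, ⟨hQB hq, h⟩, rfl⟩)
    · by_cases h : (p, M) ∈ Γ
      · exact Or.inl (hW p hp M hM h)
      · exact Or.inr (Or.inr ⟨p, ⟨hPA hp, h⟩, rfl⟩)
  have h1 := (Finset.card_le_card hsub).trans ((Finset.card_union_le _ _).trans
    (add_le_add_right (Finset.card_union_le _ _) _))
  rw [Finset.card_image_of_injective _ (add_right_injective m),
    Finset.card_image_of_injective _ (add_left_injective M)] at h1
  have h2 := hreg1 m (hPA hm)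
  have h3 := hreg1' M (hQB hM)
  have h4 : P.card + Q.card ≤ W.card + ((B.filter fun b => (m, b) ∉ Γ).card +
    (A.filter fun a => (a, M) ∉ Γ).card) + 1 := by omega
  have h4' : (P.card : ℝ) + Q.card ≤ W.card + ((B.filter fun b => (m, b) ∉ Γ).card +
    (A.filter fun a => (a, M) ∉ Γ).card) + 1 := by exact_mod_cast h4
  linarith

/-- splitting along the two cosets -/
lemma split_card {L : ℕ} [NeZero L] (H : AddSubgroup (ZMod L)) (A : Finset ℤ) (g : ZMod L) (N : ℝ)
    [DecidablePred (· ∈ H)]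
    (hN : N ≤ (A.image (fun x : ℤ => (x : ZMod L))).card)
    (hA : ∀ a ∈ A, (a : ZMod L) ∈ H ∨ (a : ZMod L) - g ∈ H) :
    N ≤ (A.filter fun a : ℤ => (a : ZMod L) ∈ H).card + (Nat.card H : ℝ) ∧
    N ≤ (A.filter fun a : ℤ => ¬ (a : ZMod L) ∈ H).card + (Nat.card H : ℝ) := by
  set φ : ℤ → ZMod L := fun x : ℤ => (x : ZMod L) with hφ
  have h1 : A.image φ ⊆ (A.filter fun a : ℤ => (a : ZMod L) ∈ H).image φ ∪
      (A.filter fun a : ℤ => ¬ (a : ZMod L) ∈ H).image φ := by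
    rw [← Finset.image_union, Finset.filter_union_filter_not_eq]
  have h2 := (Finset.card_le_card h1).trans (Finset.card_union_le _ _)
  have c0 : ((A.filter fun a : ℤ => (a : ZMod L) ∈ H).image φ).card ≤ Nat.card H := by
    apply card_coset_le H 0
    intro x hx
    simp only [mem_image, mem_filter] at hx
    obtain ⟨a, ha, rfl⟩ := hx
    simpa [hφ] using ha.2
  have c1 : ((A.filter fun a : ℤ => ¬ (a : ZMod L) ∈ H).image φ).card ≤ Nat.card H := by
    apply card_coset_le H g
    intro x hx
    simp only [mem_image, mem_filter] at hx
    obtain ⟨a, ha, rfl⟩ := hx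
    exact (hA a ha.1).resolve_left ha.2
  have d0 : ((A.filter fun a : ℤ => (a : ZMod L) ∈ H).image φ).card ≤ _ := Finset.card_image_le
  have d1 : ((A.filter fun a : ℤ => ¬ (a : ZMod L) ∈ H).image φ).card ≤ _ := Finset.card_image_le
  constructor
  · have : (A.image φ).card ≤ (A.filter fun a : ℤ => (a : ZMod L) ∈ H).card + Nat.card H := by omega
    exact hN.trans (by exact_mod_cast this)
  · have : (A.image φ).card ≤ (A.filter fun a : ℤ => ¬ (a : ZMod L) ∈ H).card + Nat.card H := by omega
    exact hN.trans (by exact_mod_cast this)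

/-- the case of two cosets -/
lemma two_cosets {L : ℕ} [NeZero L] (H : AddSubgroup (ZMod L)) (A B : Finset ℤ) (g g' : ZMod L)
    (N : ℝ) (hNA : N ≤ (A.image (fun x : ℤ => (x : ZMod L))).card)
    (hNB : N ≤ (B.image (fun x : ℤ => (x : ZMod L))).card)
    (hA : ∀ a ∈ A, (a : ZMod L) ∈ H ∨ (a : ZMod L) - g ∈ H)
    (hB : ∀ a ∈ B, (a : ZMod L) ∈ H ∨ (a : ZMod L) - g' ∈ H)
    (hg : g ∉ H) (hgg : g + g ∉ H) (hg' : g' - g ∈ H ∨ g' + g ∈ H)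
    (hN : (Nat.card H : ℝ) < N)
    (Γ : Finset (ℤ × ℤ)) (hΓ : Γ ⊆ A ×ˢ B) (s : ℝ)
    (hreg1 : ∀ a ∈ A, ((B.filter fun b => (a, b) ∉ Γ).card : ℝ) ≤ s)
    (hreg1' : ∀ b ∈ B, ((A.filter fun a => (a, b) ∉ Γ).card : ℝ) ≤ s) :
    (A.card : ℝ) + B.card + 2 * (N - Nat.card H) - 3 - 6 * s ≤
      ((Γ.image fun p => p.1 + p.2).card : ℝ) := by
  classical
  obtain ⟨a0, a1⟩ := split_card H A g N hNA hA
  obtain ⟨b0, b1⟩ := split_card H B g' N hNB hB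
  have sA := Finset.card_filter_add_card_filter_not (s := A) (fun a : ℤ => (a : ZMod L) ∈ H)
  have sB := Finset.card_filter_add_card_filter_not (s := B) (fun a : ℤ => (a : ZMod L) ∈ H)
  set A0 := A.filter fun a : ℤ => (a : ZMod L) ∈ H with hA0
  set A1 := A.filter fun a : ℤ => ¬ (a : ZMod L) ∈ H with hA1
  set B0 := B.filter fun a : ℤ => (a : ZMod L) ∈ H with hB0
  set B1 := B.filter fun a : ℤ => ¬ (a : ZMod L) ∈ H with hB1
  have ne : ∀ T : Finset ℤ, N ≤ T.card + (Nat.card H : ℝ) → T.Nonempty := by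
    intro T hT
    rw [← Finset.card_pos]
    have : (0:ℝ) < T.card := by linarith
    exact_mod_cast this
  set S := Γ.image fun p => p.1 + p.2 with hS
  have inS : ∀ p q, (p, q) ∈ Γ → p + q ∈ S := fun p q h => Finset.mem_image.2 ⟨(p, q), h, rfl⟩
  have sA' : (A0.card : ℝ) + A1.card = A.card := by exact_mod_cast sA
  have sB' : (B0.card : ℝ) + B1.card = B.card := by exact_mod_cast sB
  have mA0 : ∀ a ∈ A0, (a : ZMod L) ∈ H := fun a ha => (mem_filter.1 ha).2
  have mB0 : ∀ a ∈ B0, (a : ZMod L) ∈ H := fun a ha => (mem_filter.1 ha).2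
  have mA1 : ∀ a ∈ A1, (a : ZMod L) - g ∈ H := fun a ha =>
    (hA a (mem_filter.1 ha).1).resolve_left (mem_filter.1 ha).2
  have mB1 : ∀ a ∈ B1, (a : ZMod L) - g' ∈ H := fun a ha =>
    (hB a (mem_filter.1 ha).1).resolve_left (mem_filter.1 ha).2
  have main : ∀ u v : ZMod L, u ∉ H → v ∉ H → u - v ∉ H →
      (S.filter fun x : ℤ => (x : ZMod L) ∈ H).card + (S.filter fun x : ℤ => (x : ZMod L) - u ∈ H).card +
      (S.filter fun x : ℤ => (x : ZMod L) - v ∈ H).card ≤ (S.card : ℝ) := by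
    intro u v hu hv huv
    have d1 : Disjoint (S.filter fun x : ℤ => (x : ZMod L) ∈ H)
        (S.filter fun x : ℤ => (x : ZMod L) - u ∈ H) := by
      rw [Finset.disjoint_filter]
      intro x _ h1 h2
      apply hu
      have := H.sub_mem h1 h2
      simpa using this
    have d2 : Disjoint ((S.filter fun x : ℤ => (x : ZMod L) ∈ H) ∪
        (S.filter fun x : ℤ => (x : ZMod L) - u ∈ H)) (S.filter fun x : ℤ => (x : ZMod L) - v ∈ H) := by
      rw [Finset.disjoint_union_left]
      constructor
      · rw [Finset.disjoint_filter]
        intro x _ h1 h2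
        apply hv
        have := H.sub_mem h1 h2
        simpa using this
      · rw [Finset.disjoint_filter]
        intro x _ h1 h2
        apply huv
        have := H.sub_mem h2 h1
        simpa using this
    have h := Finset.card_le_card (Finset.union_subset (Finset.union_subset
      (filter_subset (fun x : ℤ => (x : ZMod L) ∈ H) S)
      (filter_subset (fun x : ℤ => (x : ZMod L) - u ∈ H) S))
      (filter_subset (fun x : ℤ => (x : ZMod L) - v ∈ H) S))
    rw [Finset.card_union_of_disjoint d2, Finset.card_union_of_disjoint d1] at h
    exact_mod_cast h
  have z00 := zsum A B A0 B0 Γ s hreg1 hreg1' (filter_subset _ _) (filter_subset _ _) (ne _ a0)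
    (ne _ b0) (S.filter fun x : ℤ => (x : ZMod L) ∈ H) (by
      intro p hp q hq h
      refine mem_filter.2 ⟨inS p q h, ?_⟩
      push_cast
      exact H.add_mem (mA0 p hp) (mB0 q hq))
  rcases hg' with hg' | hg'
  · have z01 := zsum A B A0 B1 Γ s hreg1 hreg1' (filter_subset _ _) (filter_subset _ _) (ne _ a0)
      (ne _ b1) (S.filter fun x : ℤ => (x : ZMod L) - g ∈ H) (by
        intro p hp q hq h
        refine mem_filter.2 ⟨inS p q h, ?_⟩
        have := H.add_mem (H.add_mem (mA0 p hp) (mB1 q hq)) hg'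
        push_cast
        convert this using 1; abel)
    have z11 := zsum A B A1 B1 Γ s hreg1 hreg1' (filter_subset _ _) (filter_subset _ _) (ne _ a1)
      (ne _ b1) (S.filter fun x : ℤ => (x : ZMod L) - (g + g) ∈ H) (by
        intro p hp q hq h
        refine mem_filter.2 ⟨inS p q h, ?_⟩
        have := H.add_mem (H.add_mem (mA1 p hp) (mB1 q hq)) hg'
        push_cast
        convert this using 1; abel)
    have := main g (g + g) hg hgg (by simpa using hg)
    linarith
  · have z01 := zsum A B A0 B1 Γ s hreg1 hreg1' (filter_subset _ _) (filter_subset _ _) (ne _ a0)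
      (ne _ b1) (S.filter fun x : ℤ => (x : ZMod L) - (-g) ∈ H) (by
        intro p hp q hq h
        refine mem_filter.2 ⟨inS p q h, ?_⟩
        have := H.add_mem (H.add_mem (mA0 p hp) (mB1 q hq)) hg'
        push_cast
        convert this using 1; abel)
    have z10 := zsum A B A1 B0 Γ s hreg1 hreg1' (filter_subset _ _) (filter_subset _ _) (ne _ a1)
      (ne _ b0) (S.filter fun x : ℤ => (x : ZMod L) - g ∈ H) (by
        intro p hp q hq h
        refine mem_filter.2 ⟨inS p q h, ?_⟩
        have := H.add_mem (mA1 p hp) (mB0 q hq)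
        push_cast
        convert this using 1; abel)
    have := main g (-g) hg (by simpa using hg) (by simpa using hgg)
    linarith

lemma gcd_gen (T : Finset ℤ) (h : T.gcd id = 1) (P : AddSubgroup ℤ) (hT : ∀ x ∈ T, x ∈ P) :
    (1 : ℤ) ∈ P := by
  obtain ⟨m, rfl⟩ := Int.subgroup_cyclic P
  have h1 : m ∣ T.gcd id := by
    apply Finset.dvd_gcd
    intro x hx
    have := hT x hx
    rw [AddSubgroup.mem_closure_singleton] at this
    obtain ⟨k, hk⟩ := this
    exact ⟨k, by simp at hk ⊢; rw [← hk]; ring⟩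
  rw [h] at h1
  rw [AddSubgroup.mem_closure_singleton]
  obtain ⟨k, hk⟩ := h1
  exact ⟨k, by simp; rw [hk]; ring⟩

/-- Technical version of the robust Freiman theorem (restricted sumset, two sets). -/
theorem main_prop_A_plus_B (ℓ : ℤ) (hℓ : 0 < ℓ) (A B : Finset ℤ) (n : ℕ)
    (hAsub : A ⊆ Finset.Icc 0 ℓ) (hBsub : B ⊆ Finset.Icc 0 ℓ)
    (hA : A.card = n) (hB : B.card = n) (hn : 3 ≤ n)
    (h0A : (0 : ℤ) ∈ A) (hℓA : ℓ ∈ A) (h0B : (0 : ℤ) ∈ B)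
    (hgcd : (A ∪ B).gcd id = 1)
    (Γ : Finset (ℤ × ℤ)) (hΓsub : Γ ⊆ A ×ˢ B)
    (K s : ℝ) (hK : 2 ≤ K) (hs : 0 ≤ s)
    (hreg1 : ∀ a ∈ A, ((B.filter fun b => (a, b) ∉ Γ).card : ℝ) ≤ s)
    (hreg1' : ∀ b ∈ B, ((A.filter fun a => (a, b) ∉ Γ).card : ℝ) ≤ s)
    (hreg2 : ∀ x : ℤ, K ≤ (((A ×ˢ B).filter fun p => p.1 + p.2 = x).card : ℝ) →
      x ∈ Γ.image fun p => p.1 + p.2) :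
    ((ℓ : ℝ) < 2 * n - 2 * K - 2 →
      (ℓ : ℝ) + n - 2 * s ≤ ((Γ.image fun p => p.1 + p.2).card : ℝ)) ∧
    ((ℓ : ℝ) ≥ 2 * n - 2 * K - 2 →
      ((Real.sqrt 5 + 1) / 2 + 1) * n - 4 * s - 2 * K - (Real.sqrt 5 + 1) / 2
        ≤ ((Γ.image fun p => p.1 + p.2).card : ℝ)) := by
  classical
  lift ℓ to ℕ using hℓ.le with L
  have hL : 0 < L := by exact_mod_cast hℓ
  haveI : NeZero L := ⟨hL.ne'⟩
  set φ : ℤ → ZMod L := fun x : ℤ => (x : ZMod L) with hφ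
  have φL : φ (L : ℤ) = 0 := by simp [hφ]
  have φ0 : φ 0 = 0 := by simp [hφ]
  have φadd : ∀ x y, φ (x + y) = φ x + φ y := by intro x y; simp [hφ]
  -- lower bound on the images
  have himg : ∀ T : Finset ℤ, T ⊆ Finset.Icc 0 (L : ℤ) → T.card = n →
      (n : ℝ) - 1 ≤ (T.image φ).card := by
    intro T hT hc
    have h1 : ((T.erase (L : ℤ)).image φ).card = (T.erase (L : ℤ)).card := by
      apply Finset.card_image_of_injOn
      intro x hx y hy hxy
      simp only [coe_erase, Set.mem_diff, mem_coe, Set.mem_singleton_iff] at hx hy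
      have hx' := Finset.mem_Icc.1 (hT hx.1)
      have hy' := Finset.mem_Icc.1 (hT hy.1)
      have hxL := hx.2
      have hyL := hy.2
      have h := (ZMod.intCast_eq_intCast_iff_dvd_sub x y L).1 hxy
      obtain ⟨k, hk⟩ := h
      have hk0 : k = 0 := by
        have h1 : (L : ℤ) * k < L * 1 := by omega
        have h2 : (L : ℤ) * (-1) < L * k := by omega
        have h3 := lt_of_mul_lt_mul_left h1 hℓ.le
        have h4 := lt_of_mul_lt_mul_left h2 hℓ.le
        omega
      rw [hk0] at hk
      omega
    have h2 : ((T.erase (L : ℤ)).image φ).card ≤ (T.image φ).card :=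
      Finset.card_le_card (Finset.image_subset_image (Finset.erase_subset _ _))
    have h3 := Finset.pred_card_le_card_erase (s := T) (a := (L : ℤ))
    have h4 : n ≤ (T.image φ).card + 1 := by omega
    have h4' : (n : ℝ) ≤ (T.image φ).card + 1 := by exact_mod_cast h4
    linarith
  set A' := A.image φ with hA'
  set B' := B.image φ with hB'
  have cA' := himg A hAsub hA
  have cB' := himg B hBsub hB
  rw [← hA'] at cA'
  rw [← hB'] at cB'
  have h0A' : (0 : ZMod L) ∈ A' := Finset.mem_image.2 ⟨0, h0A, φ0⟩
  have h0B' : (0 : ZMod L) ∈ B' := Finset.mem_image.2 ⟨0, h0B, φ0⟩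
  set S := Γ.image fun p => p.1 + p.2 with hS
  have inS : ∀ p q, (p, q) ∈ Γ → p + q ∈ S := fun p q h => Finset.mem_image.2 ⟨(p, q), h, rfl⟩
  set S' := S.image φ ∪ B' with hS'
  -- main counting inequality
  have hI : (n : ℝ) - 2 * s + S'.card ≤ S.card := by
    set T := (B.image fun b => (L : ℤ) + b) ∪ B.erase (L : ℤ) with hT
    have hTc : n + B'.card ≤ T.card := by
      rw [hT, Finset.card_union_of_disjoint, Finset.card_image_of_injective _
        (add_right_injective (L : ℤ)), hB]
      · have : B' ⊆ (B.erase (L : ℤ)).image φ := by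
          intro x hx
          obtain ⟨b, hb, rfl⟩ := Finset.mem_image.1 hx
          by_cases hbL : b = L
          · refine Finset.mem_image.2 ⟨0, Finset.mem_erase.2 ⟨by omega, h0B⟩, ?_⟩
            rw [hbL, φL, φ0]
          · exact Finset.mem_image.2 ⟨b, Finset.mem_erase.2 ⟨hbL, hb⟩, rfl⟩
        have := (Finset.card_le_card this).trans Finset.card_image_le
        omega
      · rw [Finset.disjoint_left]
        intro x hx hy
        obtain ⟨b, hb, rfl⟩ := Finset.mem_image.1 hx
        obtain ⟨h1, h2⟩ := Finset.mem_erase.1 hy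
        have h3 := Finset.mem_Icc.1 (hBsub hb)
        have h4 := Finset.mem_Icc.1 (hBsub h2)
        omega
    have hTφ : ∀ x ∈ T, φ x ∈ B' := by
      intro x hx
      rcases Finset.mem_union.1 hx with hx | hx
      · obtain ⟨b, hb, rfl⟩ := Finset.mem_image.1 hx
        rw [φadd, φL, zero_add]
        exact Finset.mem_image_of_mem _ hb
      · exact Finset.mem_image_of_mem _ (Finset.mem_of_mem_erase hx)
    have hTS : T ⊆ (S.filter fun x => φ x ∈ B') ∪ ((B.filter fun b => ((0 : ℤ), b) ∉ Γ) ∪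
        (B.filter fun b => ((L : ℤ), b) ∉ Γ).image fun b => (L : ℤ) + b) := by
      intro x hx
      have hxB := hTφ x hx
      simp only [mem_union, mem_filter, mem_image]
      rcases Finset.mem_union.1 hx with hx | hx
      · obtain ⟨b, hb, rfl⟩ := Finset.mem_image.1 hx
        by_cases h : ((L : ℤ), b) ∈ Γ
        · exact Or.inl ⟨inS _ _ h, hxB⟩
        · exact Or.inr (Or.inr ⟨b, ⟨hb, h⟩, rfl⟩)
      · by_cases h : ((0 : ℤ), x) ∈ Γ
        · left; have := inS _ _ h
          rw [zero_add] at this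
          exact ⟨this, hxB⟩
        · exact Or.inr (Or.inl ⟨Finset.mem_of_mem_erase hx, h⟩)
    have h1 := (Finset.card_le_card hTS).trans ((Finset.card_union_le _ _).trans
      (add_le_add_right (Finset.card_union_le _ _) _))
    rw [Finset.card_image_of_injective _ (add_right_injective (L : ℤ))] at h1
    have h2 := Finset.card_filter_add_card_filter_not (s := S) (fun x => φ x ∈ B')
    have h3 : S' ⊆ B' ∪ (S.filter fun x => ¬ φ x ∈ B').image φ := by
      intro x hx
      rcases Finset.mem_union.1 hx with hx | hx
      · obtain ⟨y, hy, rfl⟩ := Finset.mem_image.1 hx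
        by_cases h : φ y ∈ B'
        · exact Finset.mem_union_left _ h
        · exact Finset.mem_union_right _ (Finset.mem_image_of_mem _ (Finset.mem_filter.2 ⟨hy, h⟩))
      · exact Finset.mem_union_left _ hx
    have h4 := (Finset.card_le_card h3).trans ((Finset.card_union_le _ _).trans
      (add_le_add_right Finset.card_image_le _))
    have h5 := hreg1 0 h0A
    have h6 := hreg1 L hℓA
    have h7 : n + S'.card ≤ S.card + ((B.filter fun b => ((0 : ℤ), b) ∉ Γ).card +
        (B.filter fun b => ((L : ℤ), b) ∉ Γ).card) := by omega
    have h7' : (n : ℝ) + S'.card ≤ S.card + ((B.filter fun b => ((0 : ℤ), b) ∉ Γ).card +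
        (B.filter fun b => ((L : ℤ), b) ∉ Γ).card) := by exact_mod_cast h7
    linarith
  -- popular residues
  have hpop : ∀ c, 2 * K ≤ (rrep A' B' c : ℝ) → c ∈ S' := by
    intro c hc
    by_contra hcS
    have hcB : c ∉ B' := fun h => hcS (Finset.mem_union_right _ h)
    have hcS2 : ∀ x : ℤ, φ x = c → x ∉ S := fun x hx h =>
      hcS (Finset.mem_union_left _ (Finset.mem_image.2 ⟨x, h, hx⟩))
    obtain ⟨c0, hc0, hc1, hc2⟩ : ∃ c0 : ℤ, φ c0 = c ∧ 0 ≤ c0 ∧ c0 < L :=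
      ⟨(c.val : ℤ), by simp [hφ], by positivity, by exact_mod_cast ZMod.val_lt c⟩
    have hc0' : c0 ≠ 0 := by
      rintro rfl
      rw [φ0] at hc0
      exact hcB (hc0 ▸ h0B')
    have hc3 : φ (c0 + L) = c := by rw [φadd, φL, add_zero, hc0]
    have k1 : (((A ×ˢ B).filter fun p => p.1 + p.2 = c0).card : ℝ) < K := by
      by_contra h; push Not at h
      exact hcS2 _ hc0 (hreg2 _ h)
    have k2 : (((A ×ˢ B).filter fun p => p.1 + p.2 = c0 + L).card : ℝ) < K := by
      by_contra h; push Not at h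
      exact hcS2 _ hc3 (hreg2 _ h)
    have hsub : (B'.filter fun b => c - b ∈ A') ⊆
        (((A ×ˢ B).filter fun p => p.1 + p.2 = c0) ∪
          ((A ×ˢ B).filter fun p => p.1 + p.2 = c0 + L)).image (fun p => φ p.2) := by
      intro x hx
      obtain ⟨hx1, hx2⟩ := Finset.mem_filter.1 hx
      obtain ⟨b, hb, rfl⟩ := Finset.mem_image.1 hx1
      obtain ⟨a, ha, hab⟩ := Finset.mem_image.1 hx2
      refine Finset.mem_image.2 ⟨(a, b), ?_, rfl⟩
      have h1 : φ c0 = φ (a + b) := by rw [φadd, hab, hc0]; abel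
      obtain ⟨k, hk⟩ := (ZMod.intCast_eq_intCast_iff_dvd_sub c0 (a + b) L).1 h1
      have ha' := Finset.mem_Icc.1 (hAsub ha)
      have hb' := Finset.mem_Icc.1 (hBsub hb)
      have hk1 : k < 2 := by
        have h1 : (L : ℤ) * k < L * 2 := by omega
        exact lt_of_mul_lt_mul_left h1 hℓ.le
      have hk2 : -1 < k := by
        have h2 : (L : ℤ) * (-1) < L * k := by omega
        exact lt_of_mul_lt_mul_left h2 hℓ.le
      have hk3 : k = 0 ∨ k = 1 := by omega
      simp only [mem_union, mem_filter, mem_product]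
      rcases hk3 with rfl | rfl
      · left; exact ⟨⟨ha, hb⟩, by omega⟩
      · right; exact ⟨⟨ha, hb⟩, by omega⟩
    have h1 := (Finset.card_le_card hsub).trans (Finset.card_image_le.trans
      (Finset.card_union_le _ _))
    have h1' : (rrep A' B' c : ℝ) ≤ (((A ×ˢ B).filter fun p => p.1 + p.2 = c0).card : ℝ) +
        (((A ×ˢ B).filter fun p => p.1 + p.2 = c0 + L).card : ℝ) := by
      unfold rrep; exact_mod_cast h1
    linarith
  have hrow : ∀ a ∈ A', ((B'.filter fun b => a + b ∉ S').card : ℝ) ≤ s := by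
    intro x hx
    obtain ⟨a, ha, rfl⟩ := Finset.mem_image.1 hx
    have hsub : (B'.filter fun b => φ a + b ∉ S') ⊆ (B.filter fun b => (a, b) ∉ Γ).image φ := by
      intro y hy
      obtain ⟨hy1, hy2⟩ := Finset.mem_filter.1 hy
      obtain ⟨b, hb, rfl⟩ := Finset.mem_image.1 hy1
      refine Finset.mem_image.2 ⟨b, Finset.mem_filter.2 ⟨hb, fun h => hy2 ?_⟩, rfl⟩
      rw [← φadd]
      exact Finset.mem_union_left _ (Finset.mem_image_of_mem _ (inS _ _ h))
    have h1 := (Finset.card_le_card hsub).trans Finset.card_image_le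
    exact le_trans (by exact_mod_cast h1) (hreg1 a ha)
  have hcol : ∀ b ∈ B', ((A'.filter fun a => a + b ∉ S').card : ℝ) ≤ s := by
    intro x hx
    obtain ⟨b, hb, rfl⟩ := Finset.mem_image.1 hx
    have hsub : (A'.filter fun a => a + φ b ∉ S') ⊆ (A.filter fun a => (a, b) ∉ Γ).image φ := by
      intro y hy
      obtain ⟨hy1, hy2⟩ := Finset.mem_filter.1 hy
      obtain ⟨a, ha, rfl⟩ := Finset.mem_image.1 hy1
      refine Finset.mem_image.2 ⟨a, Finset.mem_filter.2 ⟨ha, fun h => hy2 ?_⟩, rfl⟩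
      rw [← φadd]
      exact Finset.mem_union_left _ (Finset.mem_image_of_mem _ (inS _ _ h))
    have h1 := (Finset.card_le_card hsub).trans Finset.card_image_le
    exact le_trans (by exact_mod_cast h1) (hreg1' b hb)
  have hn' : (3 : ℝ) ≤ n := by exact_mod_cast hn
  constructor
  · intro hlt
    have huniv : S' = Finset.univ := by
      apply Finset.eq_univ_of_forall
      intro c
      apply hpop
      have h1 := Finset.card_union_add_card_inter B' (A'.image fun a => c - a)
      rw [Finset.card_image_of_injective _ (sub_right_injective)] at h1
      have h2 : (B' ∪ (A'.image fun a => c - a)).card ≤ L := by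
        have := Finset.card_le_univ (B' ∪ (A'.image fun a => c - a))
        rwa [ZMod.card] at this
      have h3 : (B' ∩ (A'.image fun a => c - a)).card ≤ rrep A' B' c := by
        apply Finset.card_le_card
        intro x hx
        simp only [mem_inter, mem_image, mem_filter] at hx ⊢
        obtain ⟨h, a, ha, rfl⟩ := hx
        exact ⟨h, by simpa using ha⟩
      have h4 : B'.card + A'.card ≤ L + rrep A' B' c := by omega
      have h4' : (B'.card : ℝ) + A'.card ≤ L + rrep A' B' c := by exact_mod_cast h4
      have : ((L : ℤ) : ℝ) = L := by simp
      linarith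
    rw [huniv, Finset.card_univ, ZMod.card] at hI
    have : ((L : ℤ) : ℝ) = L := by simp
    linarith
  · intro hge
    by_contra hcon
    push Not at hcon
    have h5 : (0 : ℝ) ≤ Real.sqrt 5 := Real.sqrt_nonneg 5
    have h55 : Real.sqrt 5 ^ 2 = 5 := Real.sq_sqrt (by norm_num)
    obtain ⟨θ, hθdef⟩ : ∃ θ, θ = (Real.sqrt 5 + 1) / 2 := ⟨_, rfl⟩
    rw [← hθdef] at hcon
    have hθ : θ ^ 2 = θ + 1 := by rw [hθdef]; linear_combination h55 / 4
    have hθpos : 0 < θ := by rw [hθdef]; linarith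
    have hθ1 : 1.618 < θ := by
      by_contra h; push Not at h; nlinarith
    have hθ2 : θ < 1.6181 := by
      by_contra h; push Not at h; nlinarith
    clear hθdef h5 h55
    have hS'c : (S'.card : ℝ) < θ * ((n : ℝ) - 1) - 2 * s - 2 * K := by nlinarith
    have hNpos : (0 : ℝ) < (n : ℝ) - 1 := by linarith
    obtain ⟨t, t1, t2, t3⟩ := golden A' B' S' (2 * K) s ((n : ℝ) - 1) θ (by linarith) hs hNpos
      hθ hθ1 hθ2 cA' cB' hrow hcol hpop hS'c
    set D := (A' ×ˢ A').image fun p => p.1 - p.2 with hDdef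
    have hD : ∀ x, x ∈ D ↔ ∃ a ∈ A', ∃ b ∈ A', x = a - b := by
      intro x
      simp only [hDdef, mem_image, mem_product, Prod.exists]
      constructor
      · rintro ⟨a, b, ⟨ha, hb⟩, rfl⟩; exact ⟨a, ha, b, hb, rfl⟩
      · rintro ⟨a, ha, b, hb, rfl⟩; exact ⟨a, b, ⟨ha, hb⟩, rfl⟩
    have hDB : ∀ x, x ∈ D ↔ ∃ a ∈ B', ∃ b ∈ B', x = a - b := by
      intro x
      rw [hD]
      have h := (t1 (t + x)).symm.trans (t2 (t + x))
      simpa using h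
    have hDS : D.card ≤ S'.card := by
      rw [← Finset.card_image_of_injective D (add_right_injective t)]
      apply Finset.card_le_card
      intro y hy
      obtain ⟨x, hx, rfl⟩ := Finset.mem_image.1 hy
      obtain ⟨a, ha, b, hb, rfl⟩ := (hD x).1 hx
      obtain ⟨a', ha', b', hb', h⟩ := (t1 (t + (a - b))).2 ⟨a, ha, b, hb, rfl⟩
      change t + (a - b) ∈ S'
      rw [h]
      exact t3 a' ha' b' hb'
    have hDS' : (D.card : ℝ) ≤ S'.card := by exact_mod_cast hDS
    have hDsmall : (D.card : ℝ) < 1.62 * ((n : ℝ) - 1) := by nlinarith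
    have notclosed : ¬ ∀ x ∈ D, ∀ y ∈ D, x + y ∈ D := by
      intro hcl
      let P : AddSubgroup ℤ :=
        { carrier := {z | φ z ∈ D}
          zero_mem' := by
            change φ 0 ∈ D
            rw [φ0]; exact (hD 0).2 ⟨0, h0A', 0, h0A', by simp⟩
          add_mem' := by
            intro a b ha hb
            change φ (a + b) ∈ D
            rw [φadd]; exact hcl _ ha _ hb
          neg_mem' := by
            intro a ha
            change φ (-a) ∈ D
            obtain ⟨x, hx, y, hy, h⟩ := (hD _).1 ha
            refine (hD _).2 ⟨y, hy, x, hx, ?_⟩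
            have : φ (-a) = - φ a := by simp [hφ]
            rw [this, h]; abel }
      have h1 : (1 : ℤ) ∈ P := by
        apply gcd_gen _ hgcd P
        intro x hx
        change φ x ∈ D
        rcases Finset.mem_union.1 hx with hx | hx
        · exact (hD _).2 ⟨φ x, Finset.mem_image_of_mem _ hx, 0, h0A', by simp⟩
        · exact (hDB _).2 ⟨φ x, Finset.mem_image_of_mem _ hx, 0, h0B', by simp⟩
      have huniv : D = Finset.univ := by
        apply Finset.eq_univ_of_forall
        intro c
        have h2 : ((c.val : ℤ)) ∈ P := by
          have := P.zsmul_mem h1 (c.val : ℤ)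
          simpa using this
        have h3 : φ (c.val : ℤ) ∈ D := h2
        simpa [hφ] using h3
      rw [huniv, Finset.card_univ, ZMod.card] at hDS'
      have : ((L : ℤ) : ℝ) = L := by simp
      nlinarith
    obtain ⟨g, hgD, hgH, hggH, hAc, hDc, h3h⟩ := (structure_lem A' D hD h0A'
      (by nlinarith)).resolve_left notclosed
    obtain ⟨g', hgD', hgH', -, hBc, -, -⟩ := (structure_lem B' D hDB h0B'
      (by nlinarith)).resolve_left notclosed
    have h3h' : (3 * Nat.card (stabD D) : ℝ) ≤ D.card := by exact_mod_cast h3h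
    have hAin : ∀ a ∈ A, (a : ZMod L) ∈ stabD D ∨ (a : ZMod L) - g ∈ stabD D :=
      fun a ha => hAc _ (Finset.mem_image_of_mem φ ha)
    have hBin : ∀ a ∈ B, (a : ZMod L) ∈ stabD D ∨ (a : ZMod L) - g' ∈ stabD D :=
      fun a ha => hBc _ (Finset.mem_image_of_mem φ ha)
    have hfin := two_cosets (stabD D) A B g g' ((n : ℝ) - 1) cA' cB' hAin hBin hgH hggH
      ((hDc g' hgD').resolve_left hgH') (by nlinarith) Γ hΓsub s hreg1 hreg1'
    have h2h : (n : ℝ) - 1 ≤ 2 * Nat.card (stabD D) := by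
      obtain ⟨e0, -⟩ := split_card (stabD D) A g ((n : ℝ) - 1) cA' hAin
      have hle : A'.card ≤ Nat.card (stabD D) + Nat.card (stabD D) := by
        have h1 := Finset.card_filter_add_card_filter_not (s := A') (fun x => x ∈ stabD D)
        have c0 : (A'.filter fun x => x ∈ stabD D).card ≤ Nat.card (stabD D) := by
          apply card_coset_le _ 0
          intro x hx
          simpa using (Finset.mem_filter.1 hx).2
        have c1 : (A'.filter fun x => ¬ x ∈ stabD D).card ≤ Nat.card (stabD D) := by
          apply card_coset_le _ g
          intro x hx
          exact (hAc x (Finset.mem_filter.1 hx).1).resolve_left (Finset.mem_filter.1 hx).2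
        omega
      have hle' : (A'.card : ℝ) ≤ Nat.card (stabD D) + Nat.card (stabD D) := by exact_mod_cast hle
      linarith
    rw [hA, hB] at hfin
    rw [← hS] at hfin
    nlinarith
end

section
/- Let ℓ be a positive integer and let A ⊆ {0, 1, …, ℓ} be a set with |A| = n. Assume 0, ℓ ∈ A and gcd(A) = 1. Let Γ ⊆ A × A be such that A −_Γ A is (K, s)-regular for some K ≥ 2 and s ≥ 0. Then |A −_Γ A| ≥ ℓ + n − 2s if ℓ < 2n − 2K − 2, and |A −_Γ A| ≥ 3n − 4s − 2K − 2 if ℓ ≥ 2n − 2K − 2. -/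
open Finset

open scoped Pointwise in
theorem exists_atom_subgroup {G : Type*} [AddCommGroup G] [Fintype G] [DecidableEq G]
    (B : Finset G) (hex : ∃ X : Finset G, X.Nonempty ∧ X + B ≠ univ) :
    ∃ (H : AddSubgroup G) (F : Finset G), (∀ x, x ∈ F ↔ x ∈ H) ∧ F + B ≠ univ ∧
      ∀ X : Finset G, X.Nonempty → X + B ≠ univ →
        X.card + (F + B).card ≤ (X + B).card + F.card := by
  classical
  let f : Finset G → ℤ := fun X => ((X + B).card : ℤ) - X.card
  let T : Finset (Finset G) := univ.filter fun X => X.Nonempty ∧ X + B ≠ univ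
  have hT : ∀ X, X ∈ T ↔ X.Nonempty ∧ X + B ≠ univ := by intro X; simp [T]
  have hTne : T.Nonempty := by
    obtain ⟨X, hX⟩ := hex
    exact ⟨X, (hT X).2 hX⟩
  obtain ⟨F₁, hF₁T, hF₁⟩ := exists_min_image T f hTne
  let T' := T.filter fun X => f X ≤ f F₁
  have hT'ne : T'.Nonempty := ⟨F₁, by simp [T', hF₁T]⟩
  obtain ⟨F₂, hF₂T, hF₂⟩ := exists_min_image T' card hT'ne
  have hF₂T' : F₂ ∈ T ∧ f F₂ ≤ f F₁ := by simpa [T'] using hF₂T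
  have htr : ∀ (g : G) (X : Finset G), X ∈ T → ({g} + X) ∈ T ∧ f ({g} + X) = f X ∧ ({g} + X).card = X.card := by
    intro g X hX
    rw [hT] at hX
    refine ⟨(hT _).2 ⟨(singleton_nonempty g).add hX.1, ?_⟩, ?_, by simp [card_singleton_add]⟩
    · intro h
      apply hX.2
      rw [← card_eq_iff_eq_univ] at h ⊢
      rw [← h, add_assoc, card_singleton_add]
    · simp only [f, add_assoc, card_singleton_add]
  obtain ⟨f0, hf0⟩ := ((hT _).1 hF₂T'.1).1
  obtain ⟨hFT, hfF, hcF⟩ := htr (-f0) F₂ hF₂T'.1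
  set F := {-f0} + F₂ with hFdef
  have h0F : (0 : G) ∈ F := by
    rw [hFdef, mem_add]
    exact ⟨-f0, by simp, f0, hf0, by simp⟩
  have hmin : ∀ X ∈ T, f F ≤ f X := fun X hX => by
    rw [hfF]; exact hF₂T'.2.trans (hF₁ X hX)
  have hat : ∀ X ∈ T, f X ≤ f F → F.card ≤ X.card := fun X hX h => by
    rw [hcF]
    apply hF₂
    simp only [T', mem_filter]
    exact ⟨hX, h.trans (by rw [hfF]; exact hF₂T'.2)⟩
  clear_value F
  have hFT' := (hT F).1 hFT
  have hA : F.card + (F + B).card ≤ Fintype.card G := by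
    let Y : Finset G := -(F + B)ᶜ
    have hYc : Y.card + (F + B).card = Fintype.card G := by
      simp only [Y, card_neg]
      exact card_compl_add_card _
    have hYne : Y.Nonempty := by
      rw [← card_pos]
      have : (F + B).card < Fintype.card G := by
        rw [← card_univ]
        exact card_lt_card (by rw [ssubset_univ_iff]; exact hFT'.2)
      omega
    have hYsub : Y + B ⊆ (-F)ᶜ := by
      intro z hz
      obtain ⟨y, hy, b, hb, rfl⟩ := mem_add.1 hz
      rw [mem_compl]
      intro hm
      simp only [Y, mem_neg', mem_compl] at hy
      rw [mem_neg'] at hm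
      apply hy
      rw [mem_add]
      exact ⟨_, hm, b, hb, by abel⟩
    have hYc2 : (Y + B).card + F.card ≤ Fintype.card G := by
      have := card_le_card hYsub
      have h2 := card_compl_add_card (-F)
      rw [card_neg] at h2
      omega
    have hYT : Y ∈ T := by
      rw [hT]
      refine ⟨hYne, fun h => ?_⟩
      rw [h, card_univ] at hYc2
      have := card_pos.2 hFT'.1
      omega
    have := hat Y hYT (by simp only [f]; omega)
    omega
  have hB : ∀ g : G, (F ∩ ({g} + F)).Nonempty → {g} + F = F := by
    intro g hne
    obtain ⟨h1, h2, h3⟩ := htr g F hFT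
    set F' := {g} + F
    by_contra hcon
    have hIF : (F ∩ F').card < F.card := by
      apply card_lt_card
      rw [ssubset_iff_subset_ne]
      refine ⟨inter_subset_left, fun h => hcon ?_⟩
      rw [inter_eq_left] at h
      exact (eq_of_subset_of_card_le h h3.le).symm
    have hIT : F ∩ F' ∈ T := by
      rw [hT]
      refine ⟨hne, fun h => hFT'.2 ?_⟩
      rw [← univ_subset_iff, ← h]
      exact add_subset_add_right inter_subset_left
    have hI : f F < f (F ∩ F') := by
      by_contra hc
      exact absurd (hat _ hIT (not_lt.1 hc)) (by omega)
    have hu : ((F ∪ F') + B).card + ((F ∩ F') + B).card ≤ (F + B).card + (F' + B).card := by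
      have h5 := card_le_card (inter_add_subset (s₁ := F) (s₂ := F') (t := B))
      have h6 := card_union_add_card_inter (F + B) (F' + B)
      rw [union_add]
      omega
    have hc := card_union_add_card_inter F F'
    have hUT : F ∪ F' ∈ T := by
      rw [hT]
      refine ⟨hFT'.1.mono subset_union_left, fun h => ?_⟩
      rw [h, card_univ] at hu
      simp only [f] at hI h2
      have := card_pos.2 hne
      omega
    have := hmin _ hUT
    simp only [f] at this hI h2
    omega
  have hst : ∀ x ∈ F, {-x} + F = F := by
    intro x hx
    apply hB
    refine ⟨0, mem_inter.2 ⟨h0F, mem_add.2 ⟨-x, by simp, x, hx, by simp⟩⟩⟩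
  have hneg : ∀ x ∈ F, -x ∈ F := by
    intro x hx
    rw [← hst x hx]
    exact mem_add.2 ⟨-x, by simp, 0, h0F, by simp⟩
  refine ⟨{ carrier := F, zero_mem' := h0F, neg_mem' := fun {x} hx => hneg x hx, add_mem' := ?_ }, F, ?_, hFT'.2, ?_⟩
  · intro x y hx hy
    have h := hst _ (hneg x hx)
    rw [neg_neg] at h
    show x + y ∈ F
    rw [← h]
    exact mem_add.2 ⟨x, by simp, y, hy, rfl⟩
  · intro x; rfl
  · intro X hX hXB
    have := hmin X ((hT X).2 ⟨hX, hXB⟩)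
    simp only [f] at this
    omega

open scoped Pointwise in
theorem kneser_part {G : Type*} [AddCommGroup G] [Fintype G] [DecidableEq G]
    (A : Finset G) (h0 : (0 : G) ∈ A)
    (hgen : ∀ H : AddSubgroup G, (∀ a ∈ A, a ∈ H) → H = ⊤) (hS : A + -A ≠ univ) :
    ∃ (H : AddSubgroup G) (F : Finset G), (∀ x, x ∈ F ↔ x ∈ H) ∧
      A.card + (A + F).card ≤ (A + -A).card + F.card ∧
      ((A + F).card < F.card + A.card →
        2 * (A + F).card ≤ (A + -A).card + F.card ∧
        (∃ u ∈ A, ∃ v ∈ A, u - v ∉ A + F) ∧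
        ∀ u ∈ A, ∀ v ∈ A, u - v ∉ H →
          (({u} + F) \ A).card + (({v} + F) \ A).card + A.card ≤ (A + F).card) := by
  classical
  have hAne : A.Nonempty := ⟨0, h0⟩
  obtain ⟨H, F, hF, hFB, hX⟩ := exists_atom_subgroup (-A) ⟨A, hAne, hS⟩
  have hFneg : -F = F := by
    ext x; rw [mem_neg', hF, hF, neg_mem_iff]
  have hW : (F + -A).card = (A + F).card := by
    rw [← card_neg (F + -A), neg_add, neg_neg, hFneg, add_comm]
  have h0F : (0 : G) ∈ F := (hF 0).2 H.zero_mem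
  have hAW : A ⊆ A + F := fun a ha => mem_add.2 ⟨a, ha, 0, h0F, by simp⟩
  have hFW : F ⊆ A + F := fun a ha => mem_add.2 ⟨0, h0, a, ha, by simp⟩
  have hp : ∃ p ∈ A, p ∉ H := by
    by_contra! hc
    have := hgen H hc
    apply hFB
    rw [eq_univ_iff_forall]
    intro x
    refine mem_add.2 ⟨x, (hF x).2 (by rw [this]; trivial), 0, by simpa using h0, by simp⟩
  obtain ⟨p, hpA, hpH⟩ := hp
  refine ⟨H, F, hF, ?_, ?_⟩
  · have := hX A hAne hS
    omega
  intro hlt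
  have hholes : ∀ u ∈ A, ∀ v ∈ A, u - v ∉ H →
      (({u} + F) \ A).card + (({v} + F) \ A).card + A.card ≤ (A + F).card := by
    intro u hu v hv huv
    have hdis : Disjoint (({u} + F) \ A) (({v} + F) \ A) := by
      rw [disjoint_left]
      intro z hz hz'
      obtain ⟨_, hu', k, hk, h1⟩ := mem_add.1 (mem_sdiff.1 hz).1
      obtain ⟨_, hv', k', hk', h2⟩ := mem_add.1 (mem_sdiff.1 hz').1
      rw [mem_singleton] at hu' hv'
      subst hu' hv'
      apply huv
      have h3 := H.sub_mem ((hF _).1 hk') ((hF _).1 hk)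
      convert h3 using 1
      rw [sub_eq_sub_iff_add_eq_add, h1, ← h2, add_comm]
    rw [← card_union_of_disjoint hdis, ← card_union_of_disjoint]
    · apply card_le_card
      apply union_subset _ hAW
      apply union_subset
      · exact sdiff_subset.trans (add_subset_add_right (by simpa using hu))
      · exact sdiff_subset.trans (add_subset_add_right (by simpa using hv))
    · rw [disjoint_union_left]
      exact ⟨sdiff_disjoint, sdiff_disjoint⟩
  have hmeet : ∀ u ∈ A, ∀ v ∈ A, ∀ k ∈ F,
      (({u} + F) \ A).card + (({v} + F) \ A).card < F.card → u + k - v ∈ A + -A := by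
    intro u hu v hv k hk hc
    have : ∃ z ∈ {u} + F, z ∉ (({u} + F) \ A) ∪ ({u + k - v} + (({v} + F) \ A)) := by
      by_contra! hcon
      have h1 := card_le_card (show {u} + F ⊆ _ from hcon)
      have h2 := card_union_le (({u} + F) \ A) ({u + k - v} + (({v} + F) \ A))
      rw [card_singleton_add] at h1 h2
      omega
    obtain ⟨z, hz, hz'⟩ := this
    obtain ⟨u', hu', k', hk', rfl⟩ := mem_add.1 hz
    rw [mem_singleton] at hu'
    subst hu'
    rw [mem_union, not_or] at hz'
    have h1 : u' + k' ∈ A := by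
      by_contra hcon
      exact hz'.1 (mem_sdiff.2 ⟨hz, hcon⟩)
    have h2 : v + (k' - k) ∈ A := by
      by_contra hcon
      apply hz'.2
      refine mem_add.2 ⟨_, mem_singleton_self _, v + (k' - k), mem_sdiff.2 ⟨?_, hcon⟩, by abel⟩
      exact mem_add.2 ⟨v, by simp, k' - k, (hF _).2 (H.sub_mem ((hF _).1 hk') ((hF _).1 hk)), rfl⟩
    exact mem_add.2 ⟨_, h1, -(v + (k' - k)), by simpa using h2, by abel⟩
  have hper : (A + F) + -A = A + -A := by
    apply Subset.antisymm _ (add_subset_add_right hAW)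
    intro w hw
    obtain ⟨y, hy, v, hv, rfl⟩ := mem_add.1 hw
    obtain ⟨u, hu, k, hk, rfl⟩ := mem_add.1 hy
    rw [mem_neg'] at hv
    by_cases huv : u - -v ∈ H
    · have hwH : u + k + v ∈ H := by
        have := H.add_mem huv ((hF k).1 hk)
        convert this using 1; abel
      have h1 := hholes p hpA 0 h0 (by simpa using hpH)
      have h2 := hmeet p hpA p hpA _ ((hF _).2 hwH)
      have h3 := hmeet 0 h0 0 h0 _ ((hF _).2 hwH)
      rw [add_sub_cancel_left] at h2 h3
      by_cases h4 : (({p} + F) \ A).card + (({p} + F) \ A).card < F.card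
      · exact h2 h4
      · exact h3 (by omega)
    · have h1 := hholes u hu _ hv huv
      have h2 := hmeet u hu _ hv k hk (by omega)
      convert h2 using 1; abel
  have h2M : 2 * (A + F).card ≤ (A + -A).card + F.card := by
    have := hX (A + F) (hAne.mono hAW) (by rw [hper]; exact hS)
    rw [hper] at this
    omega
  refine ⟨h2M, ?_, hholes⟩
  by_contra! hcon
  have h1 : A + -A ⊆ A + F := by
    intro w hw
    obtain ⟨u, hu, v, hv, rfl⟩ := mem_add.1 hw
    have := hcon u hu (-v) (by simpa using hv)
    simpa using this
  have h2 := card_le_card h1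
  have h3 : F.card < (A + F).card := by
    apply card_lt_card
    rw [ssubset_iff_of_subset hFW]
    exact ⟨p, hAW hpA, fun h => hpH ((hF p).1 h)⟩
  omega

/-- number of representations as a difference -/
theorem rep_symm (A : Finset ℤ) (x : ℤ) :
    ((A ×ˢ A).filter fun p => p.1 - p.2 = x).card =
    ((A ×ˢ A).filter fun p => p.1 - p.2 = -x).card := by
  apply card_bij (fun p _ => (p.2, p.1))
  · rintro ⟨a, b⟩ h
    simp only [mem_filter, mem_product] at h ⊢
    exact ⟨⟨h.1.2, h.1.1⟩, by omega⟩
  · rintro ⟨a, b⟩ h ⟨a', b'⟩ h' heq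
    simp only [Prod.mk.injEq] at heq ⊢
    exact ⟨heq.2, heq.1⟩
  · rintro ⟨a, b⟩ h
    simp only [mem_filter, mem_product] at h
    refine ⟨(b, a), ?_, rfl⟩
    simp only [mem_filter, mem_product]
    exact ⟨⟨h.1.2, h.1.1⟩, by omega⟩

theorem rep_lower (A : Finset ℤ) (d : ℤ) (hd : 0 < d) (h g : ℕ) (α β : ℤ)
    (hg : ((range h).filter fun i : ℕ => α + i * d ∉ A).card +
      ((range h).filter fun i : ℕ => β + i * d ∉ A).card ≤ g) (j : ℕ) (hj : j ≤ h) :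
    h ≤ ((A ×ˢ A).filter fun p => p.1 - p.2 = α - β + j * d).card + g + j := by
  classical
  let good := (range (h - j)).filter fun i : ℕ => α + ((i + j : ℕ) : ℤ) * d ∈ A ∧ β + i * d ∈ A
  have h1 : good.card ≤ ((A ×ˢ A).filter fun p => p.1 - p.2 = α - β + j * d).card := by
    apply card_le_card_of_injOn (fun i : ℕ => (α + ((i + j : ℕ) : ℤ) * d, β + i * d))
    · intro i hi
      simp only [good, coe_filter, Set.mem_ofPred_eq] at hi
      simp only [coe_filter, Set.mem_ofPred_eq, mem_product]
      refine ⟨hi.2, ?_⟩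
      push_cast; ring
    · intro i _ i' _ heq
      simp only [Prod.mk.injEq] at heq
      have := heq.2
      have h2 : (i : ℤ) * d = i' * d := by linarith
      have h3 := mul_right_cancel₀ hd.ne' h2
      exact_mod_cast h3
  let b1 := (range (h - j)).filter fun i : ℕ => α + ((i + j : ℕ) : ℤ) * d ∉ A
  let b2 := (range (h - j)).filter fun i : ℕ => β + i * d ∉ A
  have hb1 : b1.card ≤ ((range h).filter fun i : ℕ => α + i * d ∉ A).card := by
    apply card_le_card_of_injOn (fun i : ℕ => i + j)
    · intro i hi
      simp only [b1, coe_filter, Set.mem_ofPred_eq, mem_range] at hi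
      simp only [coe_filter, Set.mem_ofPred_eq, mem_range]
      exact ⟨by omega, hi.2⟩
    · intro i _ i' _ heq
      simpa using heq
  have hb2 : b2.card ≤ ((range h).filter fun i : ℕ => β + i * d ∉ A).card := by
    apply card_le_card
    apply filter_subset_filter
    exact range_subset_range.2 (by omega)
  have hcov : range (h - j) ⊆ good ∪ (b1 ∪ b2) := by
    intro i hi
    simp only [good, b1, b2, mem_union, mem_filter]
    tauto
  have h2 := card_le_card hcov
  have h3 := card_union_le good (b1 ∪ b2)
  have h4 := card_union_le b1 b2
  rw [card_range] at h2
  omega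

theorem core_count (L : ℕ) (hL : 0 < L) (D E : Finset ℤ) (hD : D ⊆ Icc (-(L : ℤ)) L) (h0 : (0 : ℤ) ∈ D)
    (hE : ∀ x ∈ E, 0 ≤ x ∧ x ≤ L ∧ x ∈ D ∧ x - L ∈ D) :
    (D.image (Int.cast : ℤ → ZMod L)).card + E.card ≤ D.card := by
  classical
  let P := D.filter fun x => 0 ≤ x
  let N₀ := D.filter fun x => x < 0
  let N := insert (L : ℤ) (N₀.image fun x : ℤ => x + (L : ℤ))
  have hPN : P.card + N₀.card = D.card := by
    simp only [P, N₀]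
    rw [← card_filter_add_card_filter_not (s := D) (fun x => 0 ≤ x)]
    simp
  have hN : N.card ≤ N₀.card + 1 := (card_insert_le _ _).trans (Nat.add_le_add_right card_image_le 1)
  have hu := card_union_add_card_inter P N
  have hEsub : E ⊆ P ∩ N := by
    intro x hx
    obtain ⟨h1, h2, h3, h4⟩ := hE x hx
    simp only [P, N, N₀, mem_inter, mem_filter, mem_insert, mem_image]
    refine ⟨⟨h3, h1⟩, ?_⟩
    rcases eq_or_lt_of_le h2 with h | h
    · exact Or.inl h
    · exact Or.inr ⟨x - L, ⟨h4, by omega⟩, by ring⟩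
  have hEc := card_le_card hEsub
  have hLU : (L : ℤ) ∈ P ∪ N := by simp [N]
  have himg : D.image (Int.cast : ℤ → ZMod L) ⊆ ((P ∪ N).erase (L : ℤ)).image (Int.cast : ℤ → ZMod L) := by
    intro z hz
    obtain ⟨x, hx, rfl⟩ := mem_image.1 hz
    have hxD := mem_Icc.1 (hD hx)
    rw [mem_image]
    by_cases hxL : x = L
    · refine ⟨0, ?_, by simp [hxL]⟩
      rw [mem_erase]
      refine ⟨by omega, mem_union_left _ ?_⟩
      simp [P, h0]
    by_cases hx0 : 0 ≤ x
    · refine ⟨x, ?_, rfl⟩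
      rw [mem_erase]
      refine ⟨hxL, mem_union_left _ ?_⟩
      simp [P, hx, hx0]
    · refine ⟨x + L, ?_, by simp⟩
      rw [mem_erase]
      refine ⟨by omega, mem_union_right _ ?_⟩
      simp only [N, N₀, mem_insert, mem_image, mem_filter]
      exact Or.inr ⟨x, ⟨hx, by omega⟩, rfl⟩
  have hi := (card_le_card himg).trans card_image_le
  rw [card_erase_of_mem hLU] at hi
  have : 0 < (P ∪ N).card := card_pos.2 ⟨_, hLU⟩
  omega

theorem cast_eq_cast_iff (L : ℕ) (a b : ℤ) : (a : ZMod L) = (b : ZMod L) ↔ (L : ℤ) ∣ b - a := by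
  rw [ZMod.intCast_eq_intCast_iff, Int.modEq_iff_dvd]

theorem eq_of_dvd_sub (L a b : ℤ) (ha : 0 ≤ a) (ha' : a < L) (hb : 0 ≤ b) (hb' : b < L)
    (h : L ∣ b - a) : a = b := by
  have := Int.eq_zero_of_abs_lt_dvd h (by rw [abs_lt]; constructor <;> linarith)
  omega

/-- the lift of a residue to [0, L) lies in A -/
theorem mem_of_cast_mem (L : ℕ) (A : Finset ℤ) (hAsub : A ⊆ Icc 0 (L : ℤ)) (h0 : (0 : ℤ) ∈ A)
    (t : ℤ) (ht : 0 ≤ t) (ht' : t < L)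
    (h : (t : ZMod L) ∈ A.image (Int.cast : ℤ → ZMod L)) : t ∈ A := by
  obtain ⟨a, ha, hat⟩ := mem_image.1 h
  have haI := mem_Icc.1 (hAsub ha)
  rw [cast_eq_cast_iff] at hat
  rcases eq_or_lt_of_le haI.2 with h1 | h1
  · have h2 : (L : ℤ) ∣ t - 0 := by
      have := dvd_add hat (dvd_of_eq h1.symm)
      simpa using this
    have := eq_of_dvd_sub L 0 t le_rfl (by omega) ht ht' h2
    rwa [← this]
  · have := eq_of_dvd_sub L a t haI.1 h1 ht ht' hat
    rwa [← this]

theorem card_le_image (L : ℕ) (X : Finset ℤ) (hX : X ⊆ Icc 0 (L : ℤ)) :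
    X.card ≤ (X.image (Int.cast : ℤ → ZMod L)).card + 1 := by
  have h1 : (X.erase (L : ℤ)).card = ((X.erase (L : ℤ)).image (Int.cast : ℤ → ZMod L)).card := by
    symm
    apply card_image_of_injOn
    intro a ha b hb hab
    have ha := mem_erase.1 ha
    have hb := mem_erase.1 hb
    have haI := mem_Icc.1 (hX ha.2)
    have hbI := mem_Icc.1 (hX hb.2)
    have hab : (a : ZMod L) = (b : ZMod L) := hab
    rw [cast_eq_cast_iff] at hab
    exact eq_of_dvd_sub L a b haI.1 (lt_of_le_of_ne haI.2 ha.1) hbI.1 (lt_of_le_of_ne hbI.2 hb.1) hab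
  have h2 := card_le_card (image_subset_image (f := (Int.cast : ℤ → ZMod L)) (erase_subset (L : ℤ) X))
  have h3 := pred_card_le_card_erase (s := X) (a := (L : ℤ))
  omega

theorem card_image_add_one (L : ℕ) (hL : 0 < L) (A : Finset ℤ) (hAsub : A ⊆ Icc 0 (L : ℤ))
    (h0 : (0 : ℤ) ∈ A) (hLA : (L : ℤ) ∈ A) :
    (A.image (Int.cast : ℤ → ZMod L)).card + 1 = A.card := by
  apply le_antisymm _ (card_le_image L A hAsub)
  have h1 : A.image (Int.cast : ℤ → ZMod L) ⊆ (A.erase (L : ℤ)).image (Int.cast : ℤ → ZMod L) := by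
    intro z hz
    obtain ⟨a, ha, rfl⟩ := mem_image.1 hz
    rw [mem_image]
    by_cases h : a = L
    · exact ⟨0, mem_erase.2 ⟨by omega, h0⟩, by simp [h]⟩
    · exact ⟨a, mem_erase.2 ⟨h, ha⟩, rfl⟩
  have h2 := (card_le_card h1).trans card_image_le
  rw [card_erase_of_mem hLA] at h2
  have : 0 < A.card := card_pos.2 ⟨_, h0⟩
  omega

/-- residues with many representations lift to one with many representations -/
theorem rep_mod_le (L : ℕ) [NeZero L] (A : Finset ℤ) (hAsub : A ⊆ Icc 0 (L : ℤ))
    (h0 : (0 : ℤ) ∈ A) (x : ZMod L) :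
    ((A.image (Int.cast : ℤ → ZMod L)).filter
      fun u => u - x ∈ A.image (Int.cast : ℤ → ZMod L)).card ≤
    ((A ×ˢ A).filter fun p => p.1 - p.2 = (x.val : ℤ)).card +
    ((A ×ˢ A).filter fun p => p.1 - p.2 = (x.val : ℤ) - L).card := by
  classical
  refine le_trans ?_ (card_union_le _ _)
  apply card_le_card_of_injOn (fun u : ZMod L => ((u.val : ℤ), ((u - x).val : ℤ)))
  · intro u hu
    have hu := mem_filter.1 hu
    have hval : ∀ w : ZMod L, ((w.val : ℤ) : ZMod L) = w := by intro w; simp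
    have h1 : (u.val : ℤ) ∈ A := mem_of_cast_mem L A hAsub h0 _ (by positivity)
      (by exact_mod_cast ZMod.val_lt u) (by rw [hval]; exact hu.1)
    have h2 : ((u - x).val : ℤ) ∈ A := mem_of_cast_mem L A hAsub h0 _ (by positivity)
      (by exact_mod_cast ZMod.val_lt (u - x)) (by rw [hval]; exact hu.2)
    have h3 : (L : ℤ) ∣ (x.val : ℤ) - ((u.val : ℤ) - ((u - x).val : ℤ)) := by
      rw [← cast_eq_cast_iff]
      push_cast
      simp
    have hu1 := ZMod.val_lt u
    have hu2 := ZMod.val_lt (u - x)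
    have hu3 := ZMod.val_lt x
    have hgoal : (u.val : ℤ) - ((u - x).val : ℤ) = (x.val : ℤ) ∨
        (u.val : ℤ) - ((u - x).val : ℤ) = (x.val : ℤ) - L := by
      by_cases hle : 0 ≤ (u.val : ℤ) - ((u - x).val : ℤ)
      · left
        exact eq_of_dvd_sub L _ _ hle (by omega) (by omega) (by omega) h3
      · right
        have := eq_of_dvd_sub L ((u.val : ℤ) - ((u - x).val : ℤ) + L) (x.val : ℤ) (by omega) (by omega)
          (by omega) (by omega) (by
            obtain ⟨k, hk⟩ := h3
            exact ⟨k - 1, by linarith⟩)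
        omega
    rw [mem_coe, mem_union, mem_filter, mem_filter, mem_product]
    rcases hgoal with h | h
    · exact Or.inl ⟨⟨h1, h2⟩, h⟩
    · exact Or.inr ⟨⟨h1, h2⟩, h⟩
  · intro u _ v _ huv
    simp only [Prod.mk.injEq, Nat.cast_inj] at huv
    exact ZMod.val_injective L huv.1

theorem subgroup_structure (L : ℕ) [NeZero L] (H : AddSubgroup (ZMod L)) :
    ∃ (d h : ℕ), 0 < d ∧ L = d * h ∧ ∀ t : ℤ, (t : ZMod L) ∈ H ↔ (d : ℤ) ∣ t := by
  obtain ⟨a, ha⟩ := Int.subgroup_cyclic (H.comap (Int.castAddHom (ZMod L)))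
  have hmem : ∀ t : ℤ, (t : ZMod L) ∈ H ↔ (a.natAbs : ℤ) ∣ t := by
    intro t
    have h1 : t ∈ H.comap (Int.castAddHom (ZMod L)) ↔ (t : ZMod L) ∈ H := by
      simp [AddSubgroup.mem_comap]
    rw [← h1, ha, AddSubgroup.mem_closure_singleton, Int.natAbs_dvd]
    constructor
    · rintro ⟨k, rfl⟩; exact ⟨k, by simp [mul_comm]⟩
    · rintro ⟨k, rfl⟩; exact ⟨k, by simp [mul_comm]⟩
  have hdL : (a.natAbs : ℤ) ∣ (L : ℤ) := by
    rw [← hmem]; simp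
  have hdL' : a.natAbs ∣ L := by exact_mod_cast hdL
  obtain ⟨h, hh⟩ := hdL'
  refine ⟨a.natAbs, h, ?_, hh, hmem⟩
  rcases Nat.eq_zero_or_pos a.natAbs with h0 | h0
  · rw [h0, zero_mul] at hh
    exact absurd hh (NeZero.ne L)
  · exact h0

open scoped Pointwise in
theorem hole_transfer (L : ℕ) [NeZero L] (A : Finset ℤ) (H : AddSubgroup (ZMod L)) (F : Finset (ZMod L))
    (hF : ∀ x, x ∈ F ↔ x ∈ H) (d h : ℕ) (hd : 0 < d) (hL : L = d * h)
    (hH : ∀ t : ℤ, (t : ZMod L) ∈ H ↔ (d : ℤ) ∣ t)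
    (hA : ∀ t : ℤ, 0 ≤ t → t < L → (t : ZMod L) ∈ A.image (Int.cast : ℤ → ZMod L) → t ∈ A)
    (u : ZMod L) :
    ∃ α : ℤ, 0 ≤ α ∧ α < d ∧ (α : ZMod L) - u ∈ H ∧
      ((range h).filter fun i : ℕ => α + i * d ∉ A).card ≤
        (({u} + F) \ A.image (Int.cast : ℤ → ZMod L)).card := by
  classical
  have hd' : (0 : ℤ) < d := by exact_mod_cast hd
  have hu : ((u.val : ℤ) : ZMod L) = u := by simp
  set a : ℤ := (u.val : ℤ) with ha
  have hα0 := Int.emod_nonneg a hd'.ne'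
  have hα1 := Int.emod_lt_of_pos a hd'
  have hαH : ∀ k : ℤ, ((a % d + k * d : ℤ) : ZMod L) - u ∈ H := by
    intro k
    rw [← hu, ← Int.cast_sub, hH]
    have := Int.mul_ediv_add_emod a d
    refine ⟨k - a / d, by linarith⟩
  refine ⟨a % d, hα0, hα1, by simpa using hαH 0, ?_⟩
  have hLZ : (L : ℤ) = d * h := by exact_mod_cast hL
  have hrange : ∀ i : ℕ, i < h → 0 ≤ a % d + i * d ∧ a % d + i * d < L := by
    intro i hi
    have hi' : (i : ℤ) + 1 ≤ h := by exact_mod_cast hi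
    constructor
    · positivity
    · rw [hLZ]; nlinarith
  apply card_le_card_of_injOn (fun i : ℕ => ((a % d + i * d : ℤ) : ZMod L))
  · intro i hi
    have hi := mem_filter.1 hi
    have hr := hrange i (mem_range.1 hi.1)
    rw [mem_coe, mem_sdiff]
    refine ⟨?_, fun hc => hi.2 (hA _ hr.1 hr.2 hc)⟩
    exact mem_add.2 ⟨u, by simp, _, (hF _).2 (hαH i), by abel⟩
  · intro i hi j hj hij
    have hi := mem_filter.1 hi
    have hj := mem_filter.1 hj
    have hri := hrange i (mem_range.1 hi.1)
    have hrj := hrange j (mem_range.1 hj.1)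
    have hij : ((a % d + i * d : ℤ) : ZMod L) = ((a % d + j * d : ℤ) : ZMod L) := hij
    rw [cast_eq_cast_iff] at hij
    have h1 := eq_of_dvd_sub L _ _ hri.1 hri.2 hrj.1 hrj.2 hij
    have h2 : (i : ℤ) * d = j * d := by linarith
    exact_mod_cast mul_right_cancel₀ hd'.ne' h2

open scoped Pointwise in
theorem extra_E (L : ℕ) [NeZero L] (A : Finset ℤ) (H : AddSubgroup (ZMod L)) (F : Finset (ZMod L))
    (hF : ∀ x, x ∈ F ↔ x ∈ H)
    (hA : ∀ t : ℤ, 0 ≤ t → t < L → (t : ZMod L) ∈ A.image (Int.cast : ℤ → ZMod L) → t ∈ A)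
    (u v : ZMod L) (g κ : ℕ) (hκ : 1 ≤ κ)
    (hg : (({u} + F) \ A.image (Int.cast : ℤ → ZMod L)).card +
      (({v} + F) \ A.image (Int.cast : ℤ → ZMod L)).card ≤ g) :
    ∃ E : Finset ℤ, F.card + 1 ≤ E.card + 2 * κ + 2 * g ∧ ∀ x ∈ E, 0 ≤ x ∧ x ≤ L ∧
      κ ≤ ((A ×ˢ A).filter fun p => p.1 - p.2 = x).card ∧
      κ ≤ ((A ×ˢ A).filter fun p => p.1 - p.2 = x - L).card ∧
      (x : ZMod L) - (u - v) ∈ H := by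
  classical
  obtain ⟨d, h, hd, hL, hH⟩ := subgroup_structure L H
  have hd' : (0 : ℤ) < d := by exact_mod_cast hd
  have hLZ : (L : ℤ) = d * h := by exact_mod_cast hL
  obtain ⟨α, hα0, hα1, hαH, hαc⟩ := hole_transfer L A H F hF d h hd hL hH hA u
  obtain ⟨β, hβ0, hβ1, hβH, hβc⟩ := hole_transfer L A H F hF d h hd hL hH hA v
  have hFc : F.card ≤ h := by
    rw [← card_range h]
    have hsub : F ⊆ (range h).image fun j : ℕ => ((j * d : ℕ) : ZMod L) := by
      intro x hx
      have h1 : (((x.val : ℤ)) : ZMod L) ∈ H := by simpa using (hF x).1 hx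
      rw [hH] at h1
      obtain ⟨j, hj⟩ : d ∣ x.val := by exact_mod_cast h1
      have h2 := ZMod.val_lt x
      rw [hj] at h2
      rw [mem_image]
      refine ⟨j, mem_range.2 ?_, ?_⟩
      · have h3 : d * j < d * h := by omega
        exact lt_of_mul_lt_mul_left h3 (Nat.zero_le _)
      · rw [mul_comm, ← hj]; simp
    exact (card_le_card hsub).trans card_image_le
  refine ⟨(Icc (κ + g) (h - (κ + g))).image fun j : ℕ => α - β + j * d, ?_, ?_⟩
  · rw [card_image_of_injective, Nat.card_Icc]
    · omega
    · intro i j hij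
      have h2 : (i : ℤ) * d = j * d := by
        have : α - β + i * d = α - β + j * d := hij
        linarith
      exact_mod_cast mul_right_cancel₀ hd'.ne' h2
  · intro x hx
    obtain ⟨j, hj, rfl⟩ := mem_image.1 hx
    rw [mem_Icc] at hj
    have hj1 : (1 : ℤ) ≤ j := by omega
    have hj2 : (j : ℤ) + 1 ≤ h := by omega
    refine ⟨by nlinarith, by rw [hLZ]; nlinarith, ?_, ?_, ?_⟩
    · have := rep_lower A d hd' h g α β (by omega) j (by omega)
      omega
    · have := rep_lower A d hd' h g β α (by omega) (h - j) (by omega)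
      rw [rep_symm]
      have e : -(α - β + (j : ℤ) * d - L) = β - α + ((h - j : ℕ) : ℤ) * d := by
        rw [Nat.cast_sub (by omega), hLZ]; ring
      rw [e]
      omega
    · have h1 := H.sub_mem hαH hβH
      have h2 : (((j : ℤ) * d : ℤ) : ZMod L) ∈ H := by
        rw [hH]; exact ⟨j, by ring⟩
      have h3 := H.add_mem h1 h2
      convert h3 using 1
      push_cast
      abel

open scoped Pointwise in
theorem main_aux (L : ℕ) [NeZero L] (A : Finset ℤ) (hAsub : A ⊆ Icc 0 (L : ℤ))
    (h0 : (0 : ℤ) ∈ A) (hLA : (L : ℤ) ∈ A) (hgcd : A.gcd id = 1)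
    (D : Finset ℤ) (hD : D ⊆ Icc (-(L : ℤ)) L) (K s : ℝ) (hK : 2 ≤ K) (hs : 0 ≤ s)
    (hKn : K ≤ A.card)
    (hrow : ∀ b ∈ A, ∃ X ⊆ A, (A.card : ℝ) - s ≤ X.card ∧ ∀ a ∈ X, a - b ∈ D)
    (hpop : ∀ x : ℤ, K ≤ (((A ×ˢ A).filter fun p => p.1 - p.2 = x).card : ℝ) → x ∈ D) :
    ((L : ℝ) < 2 * A.card - 2 * K - 2 → (L : ℝ) + A.card - 2 * s ≤ (D.card : ℝ)) ∧
    ((L : ℝ) ≥ 2 * A.card - 2 * K - 2 → 3 * A.card - 4 * s - 2 * K - 2 ≤ (D.card : ℝ)) := by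
  classical
  have hL : 0 < L := Nat.pos_of_ne_zero (NeZero.ne L)
  set A' := A.image (Int.cast : ℤ → ZMod L) with hA'
  set D' := D.image (Int.cast : ℤ → ZMod L) with hD'
  have hA'c : A'.card + 1 = A.card := card_image_add_one L hL A hAsub h0 hLA
  have hA'r : (A'.card : ℝ) + 1 = A.card := by exact_mod_cast hA'c
  have h0' : (0 : ZMod L) ∈ A' := mem_image.2 ⟨0, h0, by simp⟩
  have h0D : (0 : ℤ) ∈ D := by
    apply hpop
    refine hKn.trans ?_
    have : A.card ≤ ((A ×ˢ A).filter fun p => p.1 - p.2 = 0).card := by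
      apply card_le_card_of_injOn (fun a => (a, a))
      · intro a ha
        rw [mem_coe, mem_filter, mem_product]
        exact ⟨⟨ha, ha⟩, by simp⟩
      · intro a _ b _ hab
        exact (Prod.mk.inj hab).1
    exact_mod_cast this
  -- the doubled part
  obtain ⟨X0, hX0A, hX0c, hX0D⟩ := hrow 0 h0
  obtain ⟨XL, hXLA, hXLc, hXLD⟩ := hrow L hLA
  let E1 := X0 ∩ XL
  have hE1A : E1 ⊆ A := inter_subset_left.trans hX0A
  have hE1 : ∀ x ∈ E1, 0 ≤ x ∧ x ≤ L ∧ x ∈ D ∧ x - L ∈ D := by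
    intro x hx
    have h1 := mem_Icc.1 (hAsub (hE1A hx))
    have hx := mem_inter.1 hx
    exact ⟨h1.1, h1.2, by simpa using hX0D x hx.1, hXLD x hx.2⟩
  have hE1c : (A.card : ℝ) - 2 * s ≤ E1.card := by
    have h1 := card_union_add_card_inter X0 XL
    have h2 := card_le_card (union_subset hX0A hXLA)
    have h3 : X0.card + XL.card ≤ A.card + E1.card := by simp only [E1]; omega
    have h4 : (X0.card : ℝ) + XL.card ≤ A.card + E1.card := by exact_mod_cast h3
    linarith
  have hcore : (D'.card : ℝ) + A.card - 2 * s ≤ D.card := by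
    have h1 := core_count L hL D E1 hD h0D hE1
    have h2 : (D'.card : ℝ) + E1.card ≤ D.card := by exact_mod_cast h1
    linarith
  -- popular residues
  have hpop' : ∀ x : ZMod L, x ∉ D' → ((A'.filter fun u => u - x ∈ A').card : ℝ) < 2 * K := by
    intro x hx
    by_contra! hcon
    have h1 := rep_mod_le L A hAsub h0 x
    rw [← hA'] at h1
    have h2 : ((A'.filter fun u => u - x ∈ A').card : ℝ) ≤
      (((A ×ˢ A).filter fun p => p.1 - p.2 = (x.val : ℤ)).card : ℝ) +
      (((A ×ˢ A).filter fun p => p.1 - p.2 = (x.val : ℤ) - L).card : ℝ) := by exact_mod_cast h1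
    apply hx
    by_cases h3 : K ≤ (((A ×ˢ A).filter fun p => p.1 - p.2 = (x.val : ℤ)).card : ℝ)
    · exact mem_image.2 ⟨_, hpop _ h3, by simp⟩
    · exact mem_image.2 ⟨(x.val : ℤ) - L, hpop _ (by linarith), by simp⟩
  refine ⟨fun hℓ => ?_, fun hℓ => ?_⟩
  · -- every residue is popular
    have : D' = univ := by
      rw [eq_univ_iff_forall]
      intro x
      by_contra hx
      have h1 := hpop' x hx
      have h2 : 2 * A'.card ≤ L + (A'.filter fun u => u - x ∈ A').card := by
        have e : (A'.filter fun u => u - x ∈ A') = A' ∩ ({x} + A') := by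
          ext u
          rw [mem_filter, mem_inter, mem_add]
          refine and_congr_right fun _ => ⟨fun h => ⟨x, by simp, _, h, by abel⟩, ?_⟩
          rintro ⟨w, hw, y, hy, rfl⟩
          rw [mem_singleton] at hw
          subst hw
          simpa using hy
        have h3 := card_union_add_card_inter A' ({x} + A')
        rw [card_singleton_add] at h3
        have h4 := card_le_univ (A' ∪ ({x} + A'))
        rw [ZMod.card] at h4
        rw [e]
        omega
      have h3 : 2 * (A'.card : ℝ) ≤ L + (A'.filter fun u => u - x ∈ A').card := by exact_mod_cast h2
      linarith
    rw [this, card_univ, ZMod.card] at hcore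
    exact hcore
  -- second case
  by_cases hSD : A' + -A' ⊆ D'
  swap
  · obtain ⟨x, hxS, hxD⟩ := not_subset.1 hSD
    obtain ⟨u, hu, v', hv', rfl⟩ := mem_add.1 hxS
    have h1 := hpop' _ hxD
    obtain ⟨a, ha, rfl⟩ := mem_image.1 hu
    obtain ⟨b, hb, hbv⟩ := mem_image.1 (mem_neg'.1 hv')
    obtain ⟨Xa, hXaA, hXac, hXaD⟩ := hrow a ha
    obtain ⟨Xb, hXbA, hXbc, hXbD⟩ := hrow b hb
    let Ya := {-(a : ZMod L)} + Xa.image (Int.cast : ℤ → ZMod L)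
    let Yb := {-(b : ZMod L)} + Xb.image (Int.cast : ℤ → ZMod L)
    have hYD : Ya ∪ Yb ⊆ D' := by
      apply union_subset
      · intro z hz
        obtain ⟨w, hw, y, hy, rfl⟩ := mem_add.1 hz
        obtain ⟨c, hc, rfl⟩ := mem_image.1 hy
        rw [mem_singleton] at hw
        subst hw
        exact mem_image.2 ⟨c - a, hXaD c hc, by push_cast; abel⟩
      · intro z hz
        obtain ⟨w, hw, y, hy, rfl⟩ := mem_add.1 hz
        obtain ⟨c, hc, rfl⟩ := mem_image.1 hy
        rw [mem_singleton] at hw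
        subst hw
        exact mem_image.2 ⟨c - b, hXbD c hc, by push_cast; abel⟩
    have hYac : Xa.card ≤ Ya.card + 1 := by
      simp only [Ya, card_singleton_add]
      exact card_le_image L Xa (hXaA.trans hAsub)
    have hYbc : Xb.card ≤ Yb.card + 1 := by
      simp only [Yb, card_singleton_add]
      exact card_le_image L Xb (hXbA.trans hAsub)
    have hI : (Ya ∩ Yb).card ≤ (A'.filter fun u => u - ((a : ZMod L) + v') ∈ A').card := by
      apply card_le_card_of_injOn (fun z : ZMod L => z + (a : ZMod L))
      · intro z hz
        have hz := mem_inter.1 (mem_coe.1 hz)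
        obtain ⟨w, hw, y, hy, hwy⟩ := mem_add.1 hz.1
        obtain ⟨w', hw', y', hy', hwy'⟩ := mem_add.1 hz.2
        rw [mem_singleton] at hw hw'
        subst hw hw'
        rw [mem_coe, mem_filter]
        have e1 : z + a = y := by rw [← hwy]; abel
        have e2 : z + a - (a + v') = y' := by
          rw [← hwy', hbv]; abel
        show z + (a : ZMod L) ∈ A' ∧ z + (a : ZMod L) - ((a : ZMod L) + v') ∈ A'
        rw [e2, e1]
        exact ⟨image_subset_image hXaA hy, image_subset_image hXbA hy'⟩
      · intro z _ z' _ h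
        simpa using h
    have hU := card_union_add_card_inter Ya Yb
    have hUD := card_le_card hYD
    have hfin : Xa.card + Xb.card ≤ D'.card + (A'.filter fun u => u - ((a : ZMod L) + v') ∈ A').card + 2 := by
      omega
    have hfin' : (Xa.card : ℝ) + Xb.card ≤
        D'.card + (A'.filter fun u => u - ((a : ZMod L) + v') ∈ A').card + 2 := by exact_mod_cast hfin
    linarith
  have hSc : ((A' + -A').card : ℝ) ≤ D'.card := by exact_mod_cast card_le_card hSD
  by_cases hS : A' + -A' = univ
  · rw [hS, card_univ, ZMod.card] at hSc
    linarith
  have hgen : ∀ H : AddSubgroup (ZMod L), (∀ a ∈ A', a ∈ H) → H = ⊤ := by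
    intro H hH
    obtain ⟨d, h, hd, hLd, hmem⟩ := subgroup_structure L H
    have h1 : (d : ℤ) ∣ A.gcd id := by
      apply Finset.dvd_gcd
      intro a ha
      exact (hmem a).1 (hH _ (mem_image.2 ⟨a, ha, rfl⟩))
    rw [hgcd] at h1
    rw [AddSubgroup.eq_top_iff']
    intro x
    have := (hmem (x.val : ℤ)).2 (h1.trans (one_dvd _))
    simpa using this
  obtain ⟨H, F, hF, hk1, hk2⟩ := kneser_part A' h0' hgen hS
  have hk1' : (A'.card : ℝ) + (A' + F).card ≤ (A' + -A').card + F.card := by exact_mod_cast hk1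
  by_cases hlt : (A' + F).card < F.card + A'.card
  swap
  · have : (F.card : ℝ) + A'.card ≤ (A' + F).card := by exact_mod_cast not_lt.1 hlt
    linarith
  obtain ⟨h2M, ⟨u, hu, v, hv, huv⟩, hholes⟩ := hk2 hlt
  have h2M' : 2 * ((A' + F).card : ℝ) ≤ (A' + -A').card + F.card := by exact_mod_cast h2M
  have huvH : u - v ∉ H := fun h => huv (mem_add.2 ⟨0, h0', u - v, (hF _).2 h, by simp⟩)
  have hg := hholes u hu v hv huvH
  obtain ⟨g, hgdef⟩ : ∃ g, (A' + F).card = A'.card + g := ⟨(A' + F).card - A'.card, by omega⟩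
  -- threshold
  obtain ⟨κ, hκ1, hκ2, hκ3⟩ : ∃ κ : ℕ, 1 ≤ κ ∧ 2 * (κ : ℝ) - 1 ≤ 2 * K + 2 * s ∧
      ∀ x : ℤ, κ ≤ ((A ×ˢ A).filter fun p => p.1 - p.2 = x).card → x ∈ D := by
    by_cases hs1 : s < 1
    · refine ⟨1, le_rfl, by push_cast; linarith, ?_⟩
      intro x hx
      obtain ⟨⟨a, b⟩, hab⟩ := card_pos.1 hx
      rw [mem_filter, mem_product] at hab
      obtain ⟨X, hXA, hXc, hXD⟩ := hrow b hab.1.2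
      have h1 : (A.card : ℝ) < X.card + 1 := by linarith
      have h2 : A.card < X.card + 1 := by exact_mod_cast h1
      have h3 : X = A := eq_of_subset_of_card_le hXA (by omega)
      have := hXD a (by rw [h3]; exact hab.1.1)
      rw [← hab.2]
      exact this
    · refine ⟨⌈K⌉₊, ?_, ?_, ?_⟩
      · rw [Nat.one_le_ceil_iff]; linarith
      · have := Nat.ceil_lt_add_one (show 0 ≤ K by linarith)
        linarith
      · intro x hx
        apply hpop
        exact (Nat.le_ceil K).trans (by exact_mod_cast hx)
  obtain ⟨E2, hE2c, hE2⟩ := extra_E L A H F hF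
    (fun t ht ht' h => mem_of_cast_mem L A hAsub h0 t ht ht' h) u v g κ hκ1 (by
      rw [← hA']; omega)
  have hdis : Disjoint E1 E2 := by
    rw [disjoint_left]
    intro x hx hx'
    obtain ⟨-, -, -, -, hxH⟩ := hE2 x hx'
    apply huv
    refine mem_add.2 ⟨(x : ZMod L), mem_image.2 ⟨x, hE1A hx, rfl⟩, -((x : ZMod L) - (u - v)),
      (hF _).2 (H.neg_mem hxH), by abel⟩
  have hcc := core_count L hL D (E1 ∪ E2) hD h0D (by
    intro x hx
    rcases mem_union.1 hx with h | h
    · exact hE1 x h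
    · obtain ⟨h1, h2, h3, h4, -⟩ := hE2 x h
      exact ⟨h1, h2, hκ3 _ h3, hκ3 _ h4⟩)
  rw [card_union_of_disjoint hdis, ← hD'] at hcc
  have hcc' : (D'.card : ℝ) + (E1.card + E2.card) ≤ D.card := by exact_mod_cast hcc
  have hE2c' : (F.card : ℝ) + 1 ≤ E2.card + 2 * κ + 2 * g := by exact_mod_cast hE2c
  have hg' : ((A' + F).card : ℝ) = A'.card + g := by exact_mod_cast hgdef
  linarith

/-- Technical version of the robust Freiman theorem (restricted difference set). -/
theorem main_prop_A_minus_A (ℓ : ℤ) (hℓ : 0 < ℓ) (A : Finset ℤ) (n : ℕ)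
    (hAsub : A ⊆ Finset.Icc 0 ℓ) (hA : A.card = n)
    (h0A : (0 : ℤ) ∈ A) (hℓA : ℓ ∈ A) (hgcd : A.gcd id = 1)
    (Γ : Finset (ℤ × ℤ)) (hΓsub : Γ ⊆ A ×ˢ A)
    (K s : ℝ) (hK : 2 ≤ K) (hs : 0 ≤ s)
    (hreg1 : ∀ a ∈ A, ((A.filter fun a' => (a, a') ∉ Γ).card : ℝ) ≤ s)
    (hreg1' : ∀ a' ∈ A, ((A.filter fun a => (a, a') ∉ Γ).card : ℝ) ≤ s)
    (hreg2 : ∀ x : ℤ, K ≤ (((A ×ˢ A).filter fun p => p.1 - p.2 = x).card : ℝ) →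
      x ∈ Γ.image fun p => p.1 - p.2) :
    ((ℓ : ℝ) < 2 * n - 2 * K - 2 →
      (ℓ : ℝ) + n - 2 * s ≤ ((Γ.image fun p => p.1 - p.2).card : ℝ)) ∧
    ((ℓ : ℝ) ≥ 2 * n - 2 * K - 2 →
      3 * n - 4 * s - 2 * K - 2 ≤ ((Γ.image fun p => p.1 - p.2).card : ℝ)) := by
  classical
  subst hA
  obtain ⟨L, rfl⟩ := Int.eq_ofNat_of_zero_le hℓ.le
  have hL : 0 < L := by exact_mod_cast hℓ
  have : NeZero L := ⟨hL.ne'⟩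
  have hrow : ∀ b ∈ A, ∃ X ⊆ A, (A.card : ℝ) - s ≤ X.card ∧
      ∀ a ∈ X, a - b ∈ Γ.image fun p => p.1 - p.2 := by
    intro b hb
    refine ⟨A.filter fun a => (a, b) ∈ Γ, filter_subset _ _, ?_, ?_⟩
    · have h1 := card_filter_add_card_filter_not (s := A) (fun a => (a, b) ∈ Γ)
      have h2 := hreg1' b hb
      have h3 : ((A.filter fun a => (a, b) ∈ Γ).card : ℝ) +
        (A.filter fun a => (a, b) ∉ Γ).card = A.card := by exact_mod_cast h1
      linarith
    · intro a ha
      exact mem_image.2 ⟨(a, b), (mem_filter.1 ha).2, rfl⟩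
  have hD : (Γ.image fun p => p.1 - p.2) ⊆ Icc (-(L : ℤ)) L := by
    intro x hx
    obtain ⟨⟨a, b⟩, hab, rfl⟩ := mem_image.1 hx
    have h1 := mem_product.1 (hΓsub hab)
    have h2 := mem_Icc.1 (hAsub h1.1)
    have h3 := mem_Icc.1 (hAsub h1.2)
    rw [mem_Icc]
    simp only at h2 h3 ⊢
    omega
  by_cases hKn : K ≤ A.card
  · have := main_aux L A hAsub h0A hℓA hgcd _ hD K s hK hs hKn hrow hreg2
    simpa using this
  · push Not at hKn
    have hL0 : (0 : ℝ) < ((L : ℤ) : ℝ) := by exact_mod_cast hL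
    refine ⟨fun h => by linarith, fun _ => ?_⟩
    obtain ⟨X, -, hXc, hXD⟩ := hrow 0 h0A
    have h1 : X.card ≤ (Γ.image fun p => p.1 - p.2).card :=
      card_le_card fun a ha => by simpa using hXD a ha
    have h2 : (X.card : ℝ) ≤ (Γ.image fun p => p.1 - p.2).card := by exact_mod_cast h1
    linarith
end

section
/- Let G be an abelian group and let A, B ⊆ G be finite sets with n = |A| ≤ |B|. Let Γ ⊆ A × B be such that A +_Γ B is (K, s)-regular for some K, s ≥ 0. If A +_Γ B ≠ A + B, then |A +_Γ B| > θn − K − 2s, where θ = (1+√5)/2. -/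
open Finset Pointwise

/-- Number of representations as the size of a subset of `B`. -/
lemma rep_card {G : Type*} [AddCommGroup G] [DecidableEq G] (A B : Finset G) (x : G) :
    ((A ×ˢ B).filter fun p => p.1 + p.2 = x).card = (B.filter fun b => x - b ∈ A).card := by
  apply Finset.card_bij (fun p _ => p.2)
  · rintro ⟨a, b⟩ h
    simp only [mem_filter, mem_product] at h ⊢
    refine ⟨h.1.2, ?_⟩
    rw [← h.2, add_sub_cancel_right]
    exact h.1.1
  · rintro ⟨a, b⟩ h ⟨a', b'⟩ h' hb
    simp only [mem_filter, mem_product] at h h' hb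
    subst hb
    have : a = a' := add_right_cancel (h.2.trans h'.2.symm)
    rw [this]
  · intro b hb
    simp only [mem_filter] at hb
    exact ⟨(x - b, b), by simp [hb.1, hb.2], rfl⟩

/-- Two translates of `B` by elements of `A` overlap a lot. -/
lemma overlap {G : Type*} [AddCommGroup G] [DecidableEq G] (A B : Finset G)
    (Γ : Finset (G × G)) (a a' : G) :
    2 * B.card ≤ (B.filter fun b => b + (a - a') ∈ B).card
      + (Γ.image fun p => p.1 + p.2).card
      + (B.filter fun b => (a, b) ∉ Γ).card + (B.filter fun b => (a', b) ∉ Γ).card := by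
  set C := Γ.image fun p => p.1 + p.2
  set X := B.image fun b => a + b
  set Y := B.image fun b => a' + b
  set P := (B.filter fun b => (a, b) ∉ Γ).image fun b => a + b
  set Q := (B.filter fun b => (a', b) ∉ Γ).image fun b => a' + b
  have hX : X.card = B.card := card_image_of_injective _ (add_right_injective a)
  have hY : Y.card = B.card := card_image_of_injective _ (add_right_injective a')
  have hP : P.card ≤ _ := card_image_le
  have hQ : Q.card ≤ _ := card_image_le
  have hU : X ∪ Y ⊆ C ∪ P ∪ Q := by
    intro x hx
    simp only [X, Y, P, Q, C, mem_union, mem_image, mem_filter, Prod.exists] at hx ⊢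
    rcases hx with ⟨b, hb, rfl⟩ | ⟨b, hb, rfl⟩
    · by_cases h : (a, b) ∈ Γ
      · exact Or.inl (Or.inl ⟨a, b, h, rfl⟩)
      · exact Or.inl (Or.inr ⟨b, ⟨hb, h⟩, rfl⟩)
    · by_cases h : (a', b) ∈ Γ
      · exact Or.inl (Or.inl ⟨a', b, h, rfl⟩)
      · exact Or.inr ⟨b, ⟨hb, h⟩, rfl⟩
  have hI : (X ∩ Y).card ≤ (B.filter fun b => b + (a - a') ∈ B).card := by
    have : X ∩ Y ⊆ (B.filter fun b => b + (a - a') ∈ B).image fun b => a + b := by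
      intro x hx
      simp only [X, Y, mem_inter, mem_image, mem_filter] at hx ⊢
      obtain ⟨⟨b, hb, rfl⟩, b', hb', h⟩ := hx
      refine ⟨b, ⟨hb, ?_⟩, rfl⟩
      have : b + (a - a') = b' := by
        have h' : b' = a + b - a' := by rw [← h, add_sub_cancel_left]
        rw [h']; abel
      rwa [this]
    exact (card_le_card this).trans card_image_le
  have h1 := card_union_add_card_inter X Y
  have h2 := card_le_card hU
  have h3 := card_union_le (C ∪ P) Q
  have h4 := card_union_le C P
  omega

lemma rep_shift {G : Type*} [AddCommGroup G] [DecidableEq G] (A B : Finset G) (y g : G) :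
    (B.filter fun b => y - b ∈ A).card + (B.filter fun b => b + g ∈ B).card
      ≤ (B.filter fun b => y + g - b ∈ A).card + B.card := by
  set R := B.filter fun b => y - b ∈ A
  set S := B.filter fun b => b + g ∈ B
  have hU : (R ∪ S).card ≤ B.card :=
    card_le_card (union_subset (filter_subset _ _) (filter_subset _ _))
  have hI : (R ∩ S).card ≤ (B.filter fun b => y + g - b ∈ A).card := by
    apply Finset.card_le_card_of_injOn (fun b => b + g)
    · intro b hb
      simp only [R, S, coe_inter, Set.mem_inter_iff, mem_coe, mem_filter] at hb ⊢
      refine ⟨hb.2.2, ?_⟩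
      rw [add_sub_add_right_eq_sub]
      exact hb.1.2
    · exact fun _ _ _ _ h => add_right_cancel h
  have := card_union_add_card_inter R S
  omega

/-- Robust Kneser-type theorem in abelian groups (two sets). -/
theorem kneser_theta {G : Type*} [AddCommGroup G] [DecidableEq G]
    (A B : Finset G) (n : ℕ) (hn : A.card = n) (hAB : A.card ≤ B.card)
    (Γ : Finset (G × G)) (hΓsub : Γ ⊆ A ×ˢ B)
    (K s : ℝ) (hK : 0 ≤ K) (hs : 0 ≤ s)
    (hreg1 : ∀ a ∈ A, ((B.filter fun b => (a, b) ∉ Γ).card : ℝ) ≤ s)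
    (hreg1' : ∀ b ∈ B, ((A.filter fun a => (a, b) ∉ Γ).card : ℝ) ≤ s)
    (hreg2 : ∀ x : G, K ≤ (((A ×ˢ B).filter fun p => p.1 + p.2 = x).card : ℝ) →
      x ∈ Γ.image fun p => p.1 + p.2)
    (hne : (Γ.image fun p => p.1 + p.2) ≠ A + B) :
    (Real.sqrt 5 + 1) / 2 * n - K - 2 * s < ((Γ.image fun p => p.1 + p.2).card : ℝ) := by
  by_contra hcon
  push Not at hcon
  obtain ⟨θ, hθ⟩ : ∃ θ : ℝ, θ = (Real.sqrt 5 + 1) / 2 := ⟨_, rfl⟩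
  rw [← hθ] at hcon
  have h5 : Real.sqrt 5 * Real.sqrt 5 = 5 := Real.mul_self_sqrt (by norm_num)
  have h50 : 0 ≤ Real.sqrt 5 := Real.sqrt_nonneg 5
  have hθ2 : θ * θ = θ + 1 := by rw [hθ]; nlinarith
  have hθl : 3 / 2 < θ := by rw [hθ]; nlinarith
  have hθu : θ < 2 := by rw [hθ]; nlinarith
  -- the missing element
  have hCsub : (Γ.image fun p => p.1 + p.2) ⊆ A + B := by
    intro x hx
    simp only [mem_image] at hx
    obtain ⟨p, hp, rfl⟩ := hx
    have := mem_product.1 (hΓsub hp)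
    exact add_mem_add this.1 this.2
  obtain ⟨c0, hc0, hc0C⟩ : ∃ c0 ∈ A + B, c0 ∉ (Γ.image fun p => p.1 + p.2) := by
    by_contra h
    push Not at h
    exact hne (Subset.antisymm hCsub h)
  obtain ⟨a0, ha0, b0, hb0, rfl⟩ := mem_add.1 hc0
  have hnpos : (1 : ℝ) ≤ n := by
    have : 0 < A.card := card_pos.2 ⟨a0, ha0⟩
    rw [hn] at this
    exact_mod_cast this
  have hBn : (n : ℝ) ≤ B.card := by rw [← hn]; exact_mod_cast hAB
  -- size of Γ
  have hΓcard : (n : ℝ) * (B.card - s) ≤ Γ.card := by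
    have h1 : Γ.card = ∑ a ∈ A, (Γ.filter fun p => p.1 = a).card :=
      card_eq_sum_card_fiberwise (fun p hp => (mem_product.1 (hΓsub hp)).1)
    have h2 : ∀ a ∈ A, (B.card : ℝ) - s ≤ ((Γ.filter fun p => p.1 = a).card : ℝ) := by
      intro a ha
      have h3 : (B.filter fun b => (a, b) ∈ Γ).card ≤ (Γ.filter fun p => p.1 = a).card := by
        apply Finset.card_le_card_of_injOn (fun b => (a, b))
        · intro b hb
          simp only [mem_coe, mem_filter] at hb ⊢
          simpa using hb.2
        · intro _ _ _ _ h
          exact (Prod.mk.inj h).2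
      have h4 := card_filter_add_card_filter_not (s := B) (fun b => (a, b) ∈ Γ)
      have h5 := hreg1 a ha
      have h3' : ((B.filter fun b => (a, b) ∈ Γ).card : ℝ) ≤ (Γ.filter fun p => p.1 = a).card := by
        exact_mod_cast h3
      have h4' : ((B.filter fun b => (a, b) ∈ Γ).card : ℝ)
          + (B.filter fun b => (a, b) ∉ Γ).card = B.card := by exact_mod_cast h4
      linarith
    rw [h1, ← hn]
    push_cast
    have := Finset.card_nsmul_le_sum A _ _ h2
    rwa [nsmul_eq_mul] at this
  set C := Γ.image fun p => p.1 + p.2 with hC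
  -- a popular element
  obtain ⟨y, hyC, hy⟩ : ∃ y ∈ C, (C.card : ℝ) + 2 * s + K - B.card
      ≤ ((B.filter fun b => y - b ∈ A).card : ℝ) := by
    by_contra h
    push Not at h
    have h1 : Γ.card = ∑ y ∈ C, (Γ.filter fun p => p.1 + p.2 = y).card :=
      card_eq_sum_card_fiberwise (fun p hp => mem_image_of_mem _ hp)
    have h2 : ∀ y ∈ C, ((Γ.filter fun p => p.1 + p.2 = y).card : ℝ)
        < (C.card : ℝ) + 2 * s + K - B.card := by
      intro y hy
      refine lt_of_le_of_lt ?_ (h y hy)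
      rw [← rep_card]
      exact_mod_cast card_le_card (filter_subset_filter _ hΓsub)
    rcases C.eq_empty_or_nonempty with h0 | h0
    · rw [h0] at h1 hcon
      simp only [sum_empty] at h1
      rw [h1] at hΓcard
      simp only [card_empty, Nat.cast_zero] at hcon hΓcard
      have h3 : (B.card : ℝ) - s ≤ 0 := by
        by_contra h4
        push Not at h4
        have := mul_pos (by linarith : (0 : ℝ) < n) h4
        linarith
      nlinarith
    · have h3 : (Γ.card : ℝ) < C.card * ((C.card : ℝ) + 2 * s + K - B.card) := by
        rw [h1]
        push_cast
        refine (sum_lt_sum_of_nonempty h0 h2).trans_le ?_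
        rw [sum_const, nsmul_eq_mul]
      have h4 : (C.card : ℝ) * ((C.card : ℝ) + 2 * s + K - B.card)
          ≤ C.card * ((θ - 1) * n) := by
        apply mul_le_mul_of_nonneg_left _ (Nat.cast_nonneg _)
        linarith
      have h5 : (C.card : ℝ) * ((θ - 1) * n) ≤ (θ * n - 2 * s) * ((θ - 1) * n) := by
        apply mul_le_mul_of_nonneg_right (by linarith)
        apply mul_nonneg <;> linarith
      have h6 : (n : ℝ) * (B.card - s) < n * ((θ * n - 2 * s) * (θ - 1)) := by linarith
      have h7 := lt_of_mul_lt_mul_left h6 (by linarith)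
      have h8 : (θ * n - 2 * s) * (θ - 1) = n - 2 * (θ - 1) * s := by linear_combination (n : ℝ) * hθ2
      nlinarith
  have key : ∀ a ∈ A, ∀ a' ∈ A, y + (a - a') ∈ C := by
    intro a ha a' ha'
    apply hreg2
    rw [rep_card]
    have h1 := overlap A B Γ a a'
    have h2 := rep_shift A B y (a - a')
    have h3 := hreg1 a ha
    have h4 := hreg1 a' ha'
    rw [← hC] at h1
    have h1' : 2 * (B.card : ℝ) ≤ (B.filter fun b => b + (a - a') ∈ B).card
      + C.card + (B.filter fun b => (a, b) ∉ Γ).card + (B.filter fun b => (a', b) ∉ Γ).card := by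
      exact_mod_cast h1
    have h2' : ((B.filter fun b => y - b ∈ A).card : ℝ) + (B.filter fun b => b + (a - a') ∈ B).card
      ≤ (B.filter fun b => y + (a - a') - b ∈ A).card + B.card := by exact_mod_cast h2
    linarith
  -- two disjoint subsets of C
  set X := A.image fun a => y + (a - a0)
  set Y := (A.filter fun a => (a, b0) ∈ Γ).image fun a => a + b0
  have hX : X.card = n := by
    rw [← hn]
    apply card_image_of_injective
    intro u v h
    simpa using h
  have hY : Y.card = (A.filter fun a => (a, b0) ∈ Γ).card :=
    card_image_of_injective _ (add_left_injective b0)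
  have hd : Disjoint X Y := by
    rw [Finset.disjoint_left]
    intro x hx hx'
    simp only [X, Y, mem_image, mem_filter] at hx hx'
    obtain ⟨a, ha, rfl⟩ := hx
    obtain ⟨a', ⟨ha', _⟩, h⟩ := hx'
    apply hc0C
    have h1 := key a ha a' ha'
    have h2 : y + (a - a') = a0 + b0 := by
      have : y + (a - a') = (y + (a - a0)) - a' + a0 := by abel
      rw [this, ← h]; abel
    rwa [h2] at h1
  have hXY : X ∪ Y ⊆ C := by
    apply union_subset
    · intro x hx
      simp only [X, mem_image] at hx
      obtain ⟨a, ha, rfl⟩ := hx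
      exact key a ha a0 ha0
    · intro x hx
      simp only [Y, mem_image, mem_filter] at hx
      obtain ⟨a, ⟨ha, h⟩, rfl⟩ := hx
      exact mem_image_of_mem (fun p : G × G => p.1 + p.2) h
  have h1 := card_le_card hXY
  rw [card_union_of_disjoint hd, hX, hY] at h1
  have h2 := card_filter_add_card_filter_not (s := A) (fun a => (a, b0) ∈ Γ)
  have h3 := hreg1' b0 hb0
  have h1' : (n : ℝ) + (A.filter fun a => (a, b0) ∈ Γ).card ≤ C.card := by exact_mod_cast h1
  have h2' : ((A.filter fun a => (a, b0) ∈ Γ).card : ℝ)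
      + (A.filter fun a => (a, b0) ∉ Γ).card = n := by rw [← hn]; exact_mod_cast h2
  nlinarith
end

section
/- Let G be an abelian group and let A ⊆ G be a finite set with |A| = n. Let Γ ⊆ A × A be such that A −_Γ A is (K, s)-regular for some K, s ≥ 0. If A −_Γ A ≠ A − A, then |A −_Γ A| > 2n − K − 2s. -/
open Finset Pointwise

/-- Robust Kneser-type theorem in abelian groups for difference sets. -/
theorem kneser_three {G : Type*} [AddCommGroup G] [DecidableEq G]
    (A : Finset G) (n : ℕ) (hn : A.card = n)
    (Γ : Finset (G × G)) (hΓsub : Γ ⊆ A ×ˢ A)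
    (K s : ℝ) (hK : 0 ≤ K) (hs : 0 ≤ s)
    (hreg1 : ∀ a ∈ A, ((A.filter fun a' => (a, a') ∉ Γ).card : ℝ) ≤ s)
    (hreg1' : ∀ a' ∈ A, ((A.filter fun a => (a, a') ∉ Γ).card : ℝ) ≤ s)
    (hreg2 : ∀ x : G, K ≤ (((A ×ˢ A).filter fun p => p.1 - p.2 = x).card : ℝ) →
      x ∈ Γ.image fun p => p.1 - p.2)
    (hne : (Γ.image fun p => p.1 - p.2) ≠ A - A) :
    2 * (n : ℝ) - K - 2 * s < ((Γ.image fun p => p.1 - p.2).card : ℝ) := by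
  classical
  have hsub : (Γ.image fun p => p.1 - p.2) ⊆ A - A := by
    intro x hx
    obtain ⟨p, hp, rfl⟩ := Finset.mem_image.1 hx
    have := Finset.mem_product.1 (hΓsub hp)
    exact Finset.sub_mem_sub this.1 this.2
  obtain ⟨x, hx, hxD⟩ : ∃ x ∈ A - A, x ∉ (Γ.image fun p => p.1 - p.2) := by
    by_contra! h
    exact hne (Finset.Subset.antisymm hsub h)
  have hr : (((A ×ˢ A).filter fun p => p.1 - p.2 = x).card : ℝ) < K := by
    by_contra! h
    exact hxD (hreg2 x h)
  obtain ⟨a, ha, b, hb, rfl⟩ := Finset.mem_sub.1 hx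
  -- The translate of the neighbourhood of `c` lies in the restricted difference set.
  let S : G → Finset G := fun c => (A.filter fun d => (d, c) ∈ Γ).image fun d => d - c
  have hScard : ∀ c ∈ A, (n : ℝ) - s ≤ ((S c).card : ℝ) := by
    intro c hc
    have h1 : (S c).card = (A.filter fun d => (d, c) ∈ Γ).card :=
      Finset.card_image_of_injective _ (fun u v h => sub_left_injective h)
    have h2 := Finset.card_filter_add_card_filter_not (s := A) (fun d => (d, c) ∈ Γ)
    have h3 := hreg1' c hc
    rw [h1]
    rw [hn] at h2
    have h4 : ((A.filter fun d => (d, c) ∈ Γ).card : ℝ) +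
        ((A.filter fun d => (d, c) ∉ Γ).card : ℝ) = n := by exact_mod_cast h2
    linarith
  have hSD : ∀ c, S c ⊆ Γ.image fun p => p.1 - p.2 := by
    intro c y hy
    obtain ⟨d, hd, rfl⟩ := Finset.mem_image.1 hy
    exact Finset.mem_image.2 ⟨(d, c), (Finset.mem_filter.1 hd).2, rfl⟩
  have hinter : (S a ∩ S b).card ≤ ((A ×ˢ A).filter fun p => p.1 - p.2 = a - b).card := by
    refine Finset.card_le_card_of_injOn (fun y => (y + a, y + b)) ?_ ?_
    · intro y hy
      obtain ⟨h1, h2⟩ := Finset.mem_inter.1 (Finset.mem_coe.1 hy)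
      obtain ⟨d, hd, hdy⟩ := Finset.mem_image.1 h1
      obtain ⟨e, he, hey⟩ := Finset.mem_image.1 h2
      have h3 : y + a = d := by rw [← hdy]; abel
      have h4 : y + b = e := by rw [← hey]; abel
      refine Finset.mem_coe.2 (Finset.mem_filter.2 ⟨Finset.mem_product.2 ⟨?_, ?_⟩, ?_⟩)
      · simpa only [h3] using (Finset.mem_filter.1 hd).1
      · simpa only [h4] using (Finset.mem_filter.1 he).1
      · simp
    · intro u _ v _ h
      exact add_right_cancel (Prod.ext_iff.1 h).1
  have hu := Finset.card_le_card (Finset.union_subset (hSD a) (hSD b))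
  have hui := Finset.card_union_add_card_inter (S a) (S b)
  have h1 := hScard a ha
  have h2 := hScard b hb
  have hu' : ((S a ∪ S b).card : ℝ) ≤ ((Γ.image fun p => p.1 - p.2).card : ℝ) := by
    exact_mod_cast hu
  have hui' : ((S a ∪ S b).card : ℝ) + ((S a ∩ S b).card : ℝ) =
      ((S a).card : ℝ) + ((S b).card : ℝ) := by exact_mod_cast hui
  have hi' : ((S a ∩ S b).card : ℝ) ≤
      (((A ×ˢ A).filter fun p => p.1 - p.2 = a - b).card : ℝ) := by exact_mod_cast hinter
  linarith
end

section
/- Let A, B ⊆ ℤ be finite sets with |A| = |B| = n ≥ 3, let 0 < δ < (√5 − 1)/2, and let t be an integer with 1 ≤ t ≤ 2^{-10}((√5 − 1)/2 − δ)² n. Assume that ∑_x min(r_{A+B}(x), t) ≤ (2 + δ)nt. Then there exist arithmetic progressions P, Q with the same common difference and each of size at most (1 + δ)n + 10 t^{1/2} n^{1/2}, such that |A ∩ P| ≥ n − 2 t^{1/2} n^{1/2} and |B ∩ Q| ≥ n − 2 t^{1/2} n^{1/2}. -/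
open Finset Pointwise

theorem mann_atom {G : Type*} [AddCommGroup G] [Fintype G] [DecidableEq G]
    (A B : Finset G) (hB : B.Nonempty) (hAB : B + A ≠ univ) :
    ∃ (H : AddSubgroup G) (F : Finset G), (∀ x, x ∈ F ↔ x ∈ H) ∧ F + A ≠ univ ∧
      #(F + A) + #B ≤ #(B + A) + #F := by
  classical
  let fam : Finset (Finset G) := univ.filter fun X => X.Nonempty ∧ X + A ≠ univ
  have hfam : ∀ X, X ∈ fam ↔ X.Nonempty ∧ X + A ≠ univ := by intro X; simp [fam]
  let val : Finset G → ℤ := fun X => (#(X + A) : ℤ) - #X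
  obtain ⟨X₀, hX₀, hmin₀⟩ := exists_min_image fam val ⟨B, (hfam B).2 ⟨hB, hAB⟩⟩
  obtain ⟨X, hX', hmin'⟩ := exists_min_image (fam.filter fun X => val X = val X₀) (fun X => #X)
    ⟨X₀, by simp [hX₀]⟩
  rw [mem_filter] at hX'
  obtain ⟨hX, hXv⟩ := hX'
  have hm1 : ∀ Y ∈ fam, val X ≤ val Y := fun Y hY => hXv ▸ hmin₀ Y hY
  have hm2 : ∀ Y ∈ fam, val Y = val X → #X ≤ #Y := fun Y hY h =>
    hmin' Y (mem_filter.2 ⟨hY, h.trans hXv⟩)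
  obtain ⟨hXne, hXA⟩ := (hfam X).1 hX
  have hle : ∀ Y : Finset G, #Y ≤ Fintype.card G := fun Y => card_le_univ _
  have hdual : (#X : ℤ) ≤ Fintype.card G - #(X + A) := by
    let Y : Finset G := -((X + A)ᶜ)
    have hYc : (#Y : ℤ) = Fintype.card G - #(X + A) := by
      have : #Y = Fintype.card G - #(X + A) := by
        simp only [Y, card_neg]; exact card_compl _
      have := hle (X + A); omega
    have hYne : Y.Nonempty := by
      by_contra h
      rw [not_nonempty_iff_eq_empty] at h
      apply hXA
      have : (X + A)ᶜ = ∅ := by simpa [Y] using h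
      simpa using this
    have hsub : Y + A ⊆ -(Xᶜ) := by
      intro z hz
      obtain ⟨y, hy, a, ha, rfl⟩ := mem_add.1 hz
      simp only [Y, mem_neg', mem_compl] at hy ⊢
      intro h
      apply hy
      exact mem_add.2 ⟨_, h, a, ha, by abel⟩
    have hcard : (#(Y + A) : ℤ) ≤ Fintype.card G - #X := by
      have h1 := card_le_card hsub
      rw [card_neg, card_compl] at h1
      have := hle X; omega
    have hXpos := hXne.card_pos
    have hYf : Y ∈ fam := by
      refine (hfam Y).2 ⟨hYne, fun h => ?_⟩
      rw [h, card_univ] at hcard; omega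
    have hv : val Y ≤ val X := by simp only [val]; omega
    have := hm2 Y hYf (le_antisymm hv (hm1 Y hYf))
    omega
  have htr : ∀ (g : G) (Y : Finset G), (g +ᵥ Y) + A = g +ᵥ (Y + A) := fun g Y => by
    rw [vadd_add_assoc]
  have htrans : ∀ g : G, (X ∩ (g +ᵥ X)).Nonempty → g +ᵥ X = X := by
    intro g hne
    set Y := g +ᵥ X with hY
    have hYc : #Y = #X := by simp [hY]
    have hYAc : #(Y + A) = #(X + A) := by rw [hY, htr]; simp
    by_contra hcon
    have hlt : #(X ∩ Y) < #X := by
      apply card_lt_card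
      refine ⟨inter_subset_left, fun h => hcon ?_⟩
      have : X ⊆ Y := h.trans inter_subset_right
      exact (eq_of_subset_of_card_le this hYc.le).symm
    have hIsub : (X ∩ Y) + A ⊆ X + A := add_subset_add_right inter_subset_left
    have hIf : X ∩ Y ∈ fam := (hfam _).2 ⟨hne, fun h => hXA (univ_subset_iff.1 (h ▸ hIsub))⟩
    have hIv : val X < val (X ∩ Y) := by
      rcases (hm1 _ hIf).lt_or_eq with h | h
      · exact h
      · have := hm2 _ hIf h.symm; omega
    have hsubm : #((X ∩ Y) + A) + #((X ∪ Y) + A) ≤ #(X + A) + #(Y + A) := by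
      rw [union_add, ← card_union_add_card_inter (X + A), add_comm]
      gcongr
      exact inter_add_subset
    have hUI := card_union_add_card_inter X Y
    by_cases hU : (X ∪ Y) + A = univ
    · rw [hU, card_univ] at hsubm
      have : 0 < #(X ∩ Y) := hne.card_pos
      simp only [val] at hIv
      omega
    · have := hm1 (X ∪ Y) ((hfam _).2 ⟨hXne.mono subset_union_left, hU⟩)
      simp only [val] at *
      omega
  obtain ⟨x₀, hx₀⟩ := hXne
  let F : Finset G := (-x₀) +ᵥ X
  have hF0 : (0 : G) ∈ F := mem_vadd_finset.2 ⟨x₀, hx₀, by simp⟩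
  have hFt : ∀ x ∈ F, x +ᵥ F = F := by
    intro x hx
    obtain ⟨y, hy, rfl⟩ := mem_vadd_finset.1 hx
    have h1 : (y - x₀) +ᵥ X = X := by
      apply htrans
      refine ⟨y, mem_inter.2 ⟨hy, mem_vadd_finset.2 ⟨x₀, hx₀, by simp⟩⟩⟩
    calc ((-x₀) +ᵥ y) +ᵥ F = (-x₀) +ᵥ ((y - x₀) +ᵥ X) := by
          simp only [F, vadd_vadd]; congr 1; simp only [vadd_eq_add]; abel
      _ = F := by rw [h1]
  let H : AddSubgroup G :=
    { carrier := {x | x ∈ F}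
      zero_mem' := hF0
      add_mem' := by
        intro a b ha hb
        change a + b ∈ F
        rw [← hFt a ha]
        exact mem_vadd_finset.2 ⟨b, hb, rfl⟩
      neg_mem' := by
        intro a ha
        change -a ∈ F
        have h0 : (0 : G) ∈ a +ᵥ F := by rw [hFt a ha]; exact hF0
        obtain ⟨b, hb, hab⟩ := mem_vadd_finset.1 h0
        have : b = -a := (neg_eq_of_add_eq_zero_right hab).symm
        exact this ▸ hb }
  have hFA : #(F + A) = #(X + A) := by simp only [F]; rw [htr]; simp
  have hFc : #F = #X := by simp [F]
  refine ⟨H, F, fun x => Iff.rfl, ?_, ?_⟩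
  · intro h
    rw [h] at hFA
    exact hXA ((card_eq_iff_eq_univ _).1 (by rw [← hFA, card_univ]))
  · have := hm1 B ((hfam B).2 ⟨hB, hAB⟩)
    simp only [val] at this
    omega

/-- Restricted sumset lower bound in the integers. -/
theorem int_restricted (X Y S : Finset ℤ) (s : ℕ) (hX : X.Nonempty) (hY : Y.Nonempty)
    (h1 : ∀ x ∈ X, #(Y.filter fun y => x + y ∉ S) ≤ s)
    (h2 : ∀ y ∈ Y, #(X.filter fun x => x + y ∉ S) ≤ s) :
    #X + #Y ≤ #(S ∩ (X + Y)) + 2 * s + 1 := by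
  classical
  set x := X.min' hX
  set y := Y.max' hY
  have hx : x ∈ X := min'_mem _ _
  have hy : y ∈ Y := max'_mem _ _
  set U := (Y.filter fun b => x + b ∈ S).image (fun b => x + b)
  set V := (X.filter fun a => a + y ∈ S).image (fun a => a + y)
  have hU : #U + s ≥ #Y := by
    rw [card_image_of_injective _ (add_right_injective x)]
    have := card_filter_add_card_filter_not (s := Y) (fun b => x + b ∈ S)
    have := h1 x hx
    omega
  have hV : #V + s ≥ #X := by
    rw [card_image_of_injective _ (add_left_injective y)]
    have := card_filter_add_card_filter_not (s := X) (fun a => a + y ∈ S)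
    have := h2 y hy
    omega
  have hUV : U ∪ V ⊆ S ∩ (X + Y) := by
    intro z hz
    simp only [U, V, mem_union, mem_image, mem_filter] at hz
    rcases hz with ⟨b, ⟨hb, hs⟩, rfl⟩ | ⟨a, ⟨ha, hs⟩, rfl⟩
    · exact mem_inter.2 ⟨hs, add_mem_add hx hb⟩
    · exact mem_inter.2 ⟨hs, add_mem_add ha hy⟩
  have hI : U ∩ V ⊆ {x + y} := by
    intro z hz
    simp only [U, V, mem_inter, mem_image, mem_filter] at hz
    obtain ⟨⟨b, ⟨hb, -⟩, rfl⟩, ⟨a, ⟨ha, -⟩, hab⟩⟩ := hz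
    have h1 : x ≤ a := min'_le _ _ ha
    have h2 : b ≤ y := le_max' _ _ hb
    rw [mem_singleton]; omega
  have := card_le_card hUV
  have := card_le_card hI
  rw [card_singleton] at this
  have := card_union_add_card_inter U V
  omega

theorem group_struct {G : Type*} [AddCommGroup G] [Fintype G] [DecidableEq G]
    (A B : Finset G) (N M : ℝ) (hA0 : (0 : G) ∈ A) (hB0 : (0 : G) ∈ B)
    (hAAB : A - A = B - B)
    (hgen : ∀ H : AddSubgroup G, (∀ a ∈ A, a ∈ H) → (∀ b ∈ B, b ∈ H) → H = ⊤)
    (hne : A + B ≠ univ) (hAN : N ≤ #A) (hBN : N ≤ #B) (hM : (#(A + B) : ℝ) ≤ M)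
    (hnum : 3 * M < 5 * N) :
    ∃ (H : AddSubgroup G) (x b₀ : G), x ∉ H ∧ x + x ∉ H ∧ x ∈ A ∧ b₀ ∈ B ∧
      (∀ a ∈ A, a ∈ H ∨ a - x ∈ H) ∧ (∀ b ∈ B, b - b₀ ∈ H ∨ b - b₀ - x ∈ H) ∧
      (∃ b ∈ B, b - b₀ - x ∈ H) := by
  classical
  rw [add_comm] at hne hM
  obtain ⟨H, F, hF, hFA, hcard⟩ := mann_atom A B ⟨0, hB0⟩ hne
  have hcardR : (#(F + A) : ℝ) + #B ≤ #(B + A) + #F := by exact_mod_cast hcard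
  have hBsub : ∀ b ∈ B, ∃ a ∈ A, ∃ a' ∈ A, b = a - a' := by
    intro b hb
    have : b ∈ A - A := by
      rw [hAAB]; exact mem_sub.2 ⟨b, hb, 0, hB0, by simp⟩
    obtain ⟨a, ha, a', ha', h⟩ := mem_sub.1 this
    exact ⟨a, ha, a', ha', h.symm⟩
  have hnot : ∃ x ∈ A, x ∉ H := by
    by_contra hcon
    push Not at hcon
    have : H = ⊤ := hgen H hcon (by
      intro b hb
      obtain ⟨a, ha, a', ha', rfl⟩ := hBsub b hb
      exact H.sub_mem (hcon a ha) (hcon a' ha'))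
    apply hFA
    rw [eq_univ_iff_forall]
    intro z
    exact mem_add.2 ⟨z, (hF z).2 (by rw [this]; trivial), 0, hA0, by simp⟩
  obtain ⟨x, hxA, hxH⟩ := hnot
  have hAle : (#A : ℝ) ≤ #(F + A) := by
    have : A ⊆ F + A := by
      intro a ha
      exact mem_add.2 ⟨0, (hF 0).2 H.zero_mem, a, ha, by simp⟩
    exact_mod_cast card_le_card this
  have htrsub : ∀ a ∈ A, a +ᵥ F ⊆ F + A := by
    intro a ha z hz
    obtain ⟨f, hf, rfl⟩ := mem_vadd_finset.1 hz
    exact mem_add.2 ⟨f, hf, a, ha, by rw [vadd_eq_add, add_comm]⟩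
  have hdisj : ∀ a a' : G, a - a' ∉ H → Disjoint (a +ᵥ F) (a' +ᵥ F) := by
    intro a a' h
    rw [disjoint_left]
    intro z hz hz'
    obtain ⟨f, hf, rfl⟩ := mem_vadd_finset.1 hz
    obtain ⟨f', hf', h'⟩ := mem_vadd_finset.1 hz'
    apply h
    have : a - a' = f' - f := by
      simp only [vadd_eq_add] at h'
      rw [sub_eq_sub_iff_add_eq_add, ← h']; abel
    rw [this]
    exact H.sub_mem ((hF _).1 hf') ((hF _).1 hf)
  have hA2 : ∀ a ∈ A, a ∈ H ∨ a - x ∈ H := by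
    intro a ha
    by_contra hcon
    push Not at hcon
    have d1 : Disjoint ((0 : G) +ᵥ F) (x +ᵥ F) := (hdisj x 0 (by simpa using hxH)).symm
    have d2 : Disjoint ((0 : G) +ᵥ F) (a +ᵥ F) := (hdisj a 0 (by simpa using hcon.1)).symm
    have d3 : Disjoint (x +ᵥ F) (a +ᵥ F) := (hdisj a x hcon.2).symm
    have hsub : ((0 : G) +ᵥ F) ∪ (x +ᵥ F) ∪ (a +ᵥ F) ⊆ F + A :=
      union_subset (union_subset (htrsub 0 hA0) (htrsub x hxA)) (htrsub a ha)
    have := card_le_card hsub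
    rw [card_union_of_disjoint (disjoint_union_left.2 ⟨d2, d3⟩), card_union_of_disjoint d1] at this
    simp only [card_vadd_finset] at this
    have : (#F : ℝ) + #F + #F ≤ #(F + A) := by exact_mod_cast this
    linarith
  have hFsmall : 3 * (#F : ℝ) < 2 * N := by
    have d1 : Disjoint ((0 : G) +ᵥ F) (x +ᵥ F) := (hdisj x 0 (by simpa using hxH)).symm
    have := card_le_card (union_subset (htrsub 0 hA0) (htrsub x hxA))
    rw [card_union_of_disjoint d1] at this
    simp only [card_vadd_finset] at this
    have : (#F : ℝ) + #F ≤ #(F + A) := by exact_mod_cast this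
    linarith
  have hGbig : 2 * N ≤ Fintype.card G := by
    obtain ⟨z, hz⟩ : ∃ z, z ∉ B + A := by
      by_contra h; push Not at h; exact hne (eq_univ_iff_forall.2 h)
    have hd : Disjoint (A.image fun a => z - a) B := by
      rw [disjoint_left]
      intro y hy hyB
      obtain ⟨a, ha, rfl⟩ := mem_image.1 hy
      exact hz (mem_add.2 ⟨_, hyB, a, ha, by abel⟩)
    have h1 := card_le_univ ((A.image fun a => z - a) ∪ B)
    rw [card_union_of_disjoint hd, card_image_of_injective _ sub_right_injective] at h1
    have : (#A : ℝ) + #B ≤ Fintype.card G := by exact_mod_cast h1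
    linarith
  have hord : ∀ k : ℕ, 0 < k → k ≤ 3 → k • x ∉ H := by
    intro k hk0 hk3 hk
    have hx0 : k • (x : G ⧸ H) = 0 := by
      rw [← QuotientAddGroup.mk_nsmul, QuotientAddGroup.eq_zero_iff]; exact hk
    have htop : (AddSubgroup.zmultiples (x : G ⧸ H)).comap (QuotientAddGroup.mk' H) = ⊤ := by
      have hA' : ∀ a ∈ A, a ∈ (AddSubgroup.zmultiples (x : G ⧸ H)).comap
          (QuotientAddGroup.mk' H) := by
        intro a ha
        rw [AddSubgroup.mem_comap, QuotientAddGroup.mk'_apply]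
        rcases hA2 a ha with h | h
        · rw [(QuotientAddGroup.eq_zero_iff a).2 h]; exact AddSubgroup.zero_mem _
        · have : (a : G ⧸ H) = x := by
            rw [← sub_eq_zero, ← QuotientAddGroup.mk_sub]
            exact (QuotientAddGroup.eq_zero_iff _).2 h
          rw [this]; exact AddSubgroup.mem_zmultiples _
      apply hgen _ hA'
      intro b hb
      obtain ⟨a, ha, a', ha', rfl⟩ := hBsub b hb
      exact AddSubgroup.sub_mem _ (hA' a ha) (hA' a' ha')
    have hall : ∀ y : G ⧸ H, y ∈ AddSubgroup.zmultiples (x : G ⧸ H) := by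
      intro y
      obtain ⟨y, rfl⟩ := QuotientAddGroup.mk_surjective y
      have : y ∈ (AddSubgroup.zmultiples (x : G ⧸ H)).comap (QuotientAddGroup.mk' H) := by
        rw [htop]; trivial
      exact this
    have h1 := addOrderOf_eq_card_of_forall_mem_zmultiples hall
    have h2 := addOrderOf_le_of_nsmul_eq_zero hk0 hx0
    have h3 := AddSubgroup.card_eq_card_quotient_mul_card_addSubgroup H
    have h4 : Nat.card H = #F := by
      rw [← Nat.card_eq_finsetCard F]
      exact Nat.card_congr (Equiv.subtypeEquivRight fun z => (hF z).symm)
    rw [Nat.card_eq_fintype_card, h4, ← h1] at h3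
    have h5 : Fintype.card G ≤ 3 * #F := by
      rw [h3]; exact Nat.mul_le_mul_right _ (h2.trans hk3)
    have : (Fintype.card G : ℝ) ≤ 3 * #F := by exact_mod_cast h5
    linarith
  have hx2 : x + x ∉ H := by
    have := hord 2 (by norm_num) (by norm_num)
    rwa [two_nsmul] at this
  have hx3 : x + x + x ∉ H := by
    have := hord 3 (by norm_num) (by norm_num)
    rwa [succ_nsmul, two_nsmul] at this
  have hAdiff : ∀ z ∈ A - A, z ∈ H ∨ z - x ∈ H ∨ z + x ∈ H := by
    intro z hz
    obtain ⟨a, ha, a', ha', rfl⟩ := mem_sub.1 hz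
    rcases hA2 a ha with h | h <;> rcases hA2 a' ha' with h' | h'
    · left; exact H.sub_mem h h'
    · right; right
      have : a - a' + x = a - (a' - x) := by abel
      rw [this]; exact H.sub_mem h h'
    · right; left
      have : a - a' - x = (a - x) - a' := by abel
      rw [this]; exact H.sub_mem h h'
    · left
      have : a - a' = (a - x) - (a' - x) := by abel
      rw [this]; exact H.sub_mem h h'
  have hBdiff : ∀ b ∈ B, ∀ b' ∈ B, b - b' ∈ H ∨ b - b' - x ∈ H ∨ b - b' + x ∈ H := by
    intro b hb b' hb'
    apply hAdiff
    rw [hAAB]; exact sub_mem_sub hb hb'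
  obtain ⟨b₀, hb₀, b₁, hb₁, hb01⟩ : ∃ b₀ ∈ B, ∃ b₁ ∈ B, b₁ - b₀ - x ∈ H := by
    have : x ∈ B - B := by
      rw [← hAAB]; exact mem_sub.2 ⟨x, hxA, 0, hA0, by simp⟩
    obtain ⟨b, hb, b', hb', h⟩ := mem_sub.1 this
    exact ⟨b', hb', b, hb, by rw [h]; simp⟩
  refine ⟨H, x, b₀, hxH, hx2, hxA, hb₀, hA2, ?_, b₁, hb₁, hb01⟩
  intro b hb
  rcases hBdiff b hb b₀ hb₀ with h | h | h
  · exact Or.inl h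
  · exact Or.inr h
  · exfalso
    have h2 : b₁ - b - (x + x) ∈ H := by
      have : b₁ - b - (x + x) = (b₁ - b₀ - x) - (b - b₀ + x) := by abel
      rw [this]; exact H.sub_mem hb01 h
    rcases hBdiff b₁ hb₁ b hb with h' | h' | h'
    · apply hx2
      have : x + x = (b₁ - b) - (b₁ - b - (x + x)) := by abel
      rw [this]; exact H.sub_mem h' h2
    · apply hxH
      have : x = (b₁ - b - x) - (b₁ - b - (x + x)) := by abel
      rw [this]; exact H.sub_mem h' h2
    · apply hx3
      have : x + x + x = (b₁ - b + x) - (b₁ - b - (x + x)) := by abel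
      rw [this]; exact H.sub_mem h' h2

theorem rep_lower_s7 {G : Type*} [AddCommGroup G] [DecidableEq G] (B C : Finset G) (N M s : ℝ)
    (hBN : N ≤ #B) (hC : (#C : ℝ) ≤ M) (a a' : G)
    (h1 : (#(B.filter fun b => a + b ∉ C) : ℝ) ≤ s)
    (h2 : (#(B.filter fun b => a' + b ∉ C) : ℝ) ≤ s) :
    2 * N - 2 * s - M ≤ #((B ×ˢ B).filter fun p => p.2 - p.1 = a - a') := by
  classical
  set U := (B.filter fun b => a + b ∈ C).image (fun b => a + b) with hU
  set V := (B.filter fun b => a' + b ∈ C).image (fun b => a' + b) with hV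
  have hUc : (#B : ℝ) - s ≤ #U := by
    rw [hU, card_image_of_injective _ (add_right_injective a)]
    have := card_filter_add_card_filter_not (s := B) (fun b => a + b ∈ C)
    have : (#(B.filter fun b => a + b ∈ C) : ℝ) + #(B.filter fun b => a + b ∉ C) = #B := by
      exact_mod_cast this
    linarith
  have hVc : (#B : ℝ) - s ≤ #V := by
    rw [hV, card_image_of_injective _ (add_right_injective a')]
    have := card_filter_add_card_filter_not (s := B) (fun b => a' + b ∈ C)
    have : (#(B.filter fun b => a' + b ∈ C) : ℝ) + #(B.filter fun b => a' + b ∉ C) = #B := by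
      exact_mod_cast this
    linarith
  have hUV : U ∪ V ⊆ C := by
    intro z hz
    simp only [U, V, mem_union, mem_image, mem_filter] at hz
    rcases hz with ⟨b, ⟨hb, hs⟩, rfl⟩ | ⟨b, ⟨hb, hs⟩, rfl⟩ <;> exact hs
  have hcc : (#(U ∪ V) : ℝ) + #(U ∩ V) = #U + #V := by
    exact_mod_cast card_union_add_card_inter U V
  have hle : (#(U ∪ V) : ℝ) ≤ #C := by exact_mod_cast card_le_card hUV
  have hinj : #(U ∩ V) ≤ #((B ×ˢ B).filter fun p => p.2 - p.1 = a - a') := by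
    apply card_le_card_of_injOn (fun z => (z - a, z - a'))
    · intro z hz
      simp only [U, V, coe_inter, coe_image, coe_filter, Set.mem_inter_iff, Set.mem_image,
        Set.mem_ofPred_eq] at hz
      obtain ⟨⟨b, ⟨hb, -⟩, rfl⟩, ⟨b', ⟨hb', -⟩, h⟩⟩ := hz
      have e : a + b - a' = b' := by rw [← h]; abel
      simp only [coe_filter, Set.mem_ofPred_eq, mem_product, e]
      refine ⟨⟨by simpa using hb, hb'⟩, ?_⟩
      rw [← e]; abel
    · intro z _ z' _ h
      simpa using congrArg Prod.fst h
  have : (#(U ∩ V) : ℝ) ≤ #((B ×ˢ B).filter fun p => p.2 - p.1 = a - a') := by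
    exact_mod_cast hinj
  linarith

theorem golden_s7 {G : Type*} [AddCommGroup G] [DecidableEq G] (A B C : Finset G) (n N M s R : ℝ)
    (hAN : N ≤ #A) (hBN : N ≤ #B) (hAn : (#A : ℝ) ≤ n) (hBn : (#B : ℝ) ≤ n)
    (hC : (#C : ℝ) ≤ M)
    (h1 : ∀ a ∈ A, (#(B.filter fun b => a + b ∉ C) : ℝ) ≤ s)
    (h2 : ∀ b ∈ B, (#(A.filter fun a => a + b ∉ C) : ℝ) ≤ s)
    (hk : 0 < 2 * N - 2 * s - M) (hN : 0 < N) (hNs : 0 ≤ N - s)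
    (hnum : M * (n ^ 3 + (2 * N - 2 * s - M) * n ^ 2 - 2 * n * (2 * N - 2 * s - M) * N
        + n * (2 * N - 2 * s - M) * R) < (N * (N - s)) ^ 2) :
    A - A = B - B ∧ ∀ c ∈ A + B, R < #((A ×ˢ B).filter fun p => p.1 + p.2 = c) := by
  classical
  set k := 2 * N - 2 * s - M with hkdef
  let f : G → ℕ := fun x => #((A ×ˢ A).filter fun p => p.1 - p.2 = x)
  let g : G → ℕ := fun x => #((B ×ˢ B).filter fun p => p.2 - p.1 = x)
  have hg : ∀ x ∈ A - A, k ≤ g x := by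
    intro x hx
    obtain ⟨a, ha, a', ha', rfl⟩ := mem_sub.1 hx
    exact rep_lower_s7 B C N M s hBN hC a a' (h1 a ha) (h1 a' ha')
  have hf : ∀ x ∈ B - B, k ≤ f x := by
    intro x hx
    obtain ⟨b, hb, b', hb', rfl⟩ := mem_sub.1 hx
    have e1 := h2 b hb
    have e2 := h2 b' hb'
    simp only [add_comm _ b] at e1
    simp only [add_comm _ b'] at e2
    have := rep_lower_s7 A C N M s hAN hC b' b e2 e1
    refine this.trans (le_of_eq ?_)
    congr 2
    ext p
    rw [mem_filter, mem_filter]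
    refine and_congr_right fun _ => ?_
    rw [← neg_inj, neg_sub, neg_sub]
  have hH : A - A = B - B := by
    apply Subset.antisymm
    · intro x hx
      have : 0 < g x := by
        have := hg x hx
        exact_mod_cast hk.trans_le this
      obtain ⟨p, hp⟩ := card_pos.1 this
      rw [mem_filter, mem_product] at hp
      exact mem_sub.2 ⟨_, hp.1.2, _, hp.1.1, hp.2⟩
    · intro x hx
      have : 0 < f x := by
        have := hf x hx
        exact_mod_cast hk.trans_le this
      obtain ⟨p, hp⟩ := card_pos.1 this
      rw [mem_filter, mem_product] at hp
      exact mem_sub.2 ⟨_, hp.1.1, _, hp.1.2, hp.2⟩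
  refine ⟨hH, ?_⟩
  intro c hc
  obtain ⟨a₀, ha₀, b₀, hb₀, rfl⟩ := mem_add.1 hc
  by_contra hR
  push Not at hR
  set H := A - A with hHdef
  set r := #((A ×ˢ B).filter fun p => p.1 + p.2 = a₀ + b₀) with hr
  have hHcard : 2 * N - R ≤ (#H : ℝ) := by
    set X := A.image (fun a => a - a₀) with hX
    set Y := B.image (fun b => b₀ - b) with hY
    have hXc : #X = #A := card_image_of_injective _ (sub_left_injective)
    have hYc : #Y = #B := card_image_of_injective _ (sub_right_injective)
    have hsub : X ∪ Y ⊆ H := by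
      intro z hz
      simp only [X, Y, mem_union, mem_image] at hz
      rcases hz with ⟨b, hb, rfl⟩ | ⟨b, hb, rfl⟩
      · exact sub_mem_sub hb ha₀
      · rw [hH]; exact sub_mem_sub hb₀ hb
    have hinter : #(X ∩ Y) ≤ r := by
      apply card_le_card_of_injOn (fun z => (z + a₀, b₀ - z))
      · intro z hz
        simp only [X, Y, coe_inter, coe_image, Set.mem_inter_iff, Set.mem_image, mem_coe] at hz
        obtain ⟨⟨a, ha, rfl⟩, ⟨b, hb, h⟩⟩ := hz
        have e : b₀ - (a - a₀) = b := by rw [← h]; abel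
        simp only [coe_filter, Set.mem_ofPred_eq, mem_product, e]
        refine ⟨⟨by simpa using ha, hb⟩, ?_⟩
        rw [← e]; abel
      · intro z _ z' _ h
        simpa using congrArg Prod.fst h
    have e1 : (#(X ∪ Y) : ℝ) + #(X ∩ Y) = #A + #B := by
      rw [← hXc, ← hYc]; exact_mod_cast card_union_add_card_inter X Y
    have e2 : (#(X ∪ Y) : ℝ) ≤ #H := by exact_mod_cast card_le_card hsub
    have e3 : (#(X ∩ Y) : ℝ) ≤ r := by exact_mod_cast hinter
    linarith
  have hsumf : ∑ x ∈ H, (f x : ℝ) = (#A : ℝ) ^ 2 := by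
    have : ∑ x ∈ H, f x = #(A ×ˢ A) :=
      (card_eq_sum_card_fiberwise (f := fun p : G × G => p.1 - p.2)
        (fun p hp => by
          have := mem_product.1 hp
          exact sub_mem_sub this.1 this.2)).symm
    rw [card_product] at this
    rw [sq]; exact_mod_cast this
  have hsumg : ∑ x ∈ H, (g x : ℝ) = (#B : ℝ) ^ 2 := by
    have : ∑ x ∈ H, g x = #(B ×ˢ B) :=
      (card_eq_sum_card_fiberwise (f := fun p : G × G => p.2 - p.1)
        (fun p hp => by
          have := mem_product.1 hp
          rw [hH]
          exact sub_mem_sub this.2 this.1)).symm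
    rw [card_product] at this
    rw [sq]; exact_mod_cast this
  have hE : (addEnergy A B : ℝ) = ∑ x ∈ H, (f x : ℝ) * g x := by
    have : addEnergy A B = ∑ x ∈ H, f x * g x := by
      unfold addEnergy
      rw [card_eq_sum_card_fiberwise (f := fun q : (G × G) × G × G => q.1.1 - q.1.2) (t := H)]
      · apply sum_congr rfl
        intro x hx
        rw [← card_product]
        congr 1
        ext ⟨⟨a, a'⟩, b, b'⟩
        simp only [mem_filter, mem_product]
        constructor
        · rintro ⟨⟨⟨⟨h1, h2⟩, h3, h4⟩, h5⟩, h6⟩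
          refine ⟨⟨⟨h1, h2⟩, h6⟩, ⟨h3, h4⟩, ?_⟩
          rw [← h6, sub_eq_sub_iff_add_eq_add, h5.symm.symm]
          rw [add_comm, ← h5]
        · rintro ⟨⟨⟨h1, h2⟩, h6⟩, ⟨h3, h4⟩, h7⟩
          refine ⟨⟨⟨⟨h1, h2⟩, h3, h4⟩, ?_⟩, h6⟩
          rw [← h6, sub_eq_sub_iff_add_eq_add] at h7
          rw [← h7, add_comm]
      · intro p hp
        simp only [coe_filter, Set.mem_ofPred_eq, mem_product] at hp
        exact sub_mem_sub hp.1.1.1 hp.1.1.2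
    rw [this]; push_cast; rfl
  have hfn : ∀ x, (f x : ℝ) ≤ n := by
    intro x
    refine le_trans ?_ hAn
    have : f x ≤ #A := by
      apply card_le_card_of_injOn (fun p => p.1)
      · intro p hp
        simp only [coe_filter, Set.mem_ofPred_eq, mem_product] at hp
        exact hp.1.1
      · intro p hp q hq h
        simp only [coe_filter, Set.mem_ofPred_eq, mem_product] at hp hq
        have h' : p.1 = q.1 := h
        have := hp.2.trans hq.2.symm
        rw [h'] at this
        exact Prod.ext h' (by simpa using this)
    exact_mod_cast this
  have hn0 : 0 < n := hN.trans_le (hAN.trans hAn)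
  have hEub : (addEnergy A B : ℝ) ≤ n ^ 3 + k * n ^ 2 - 2 * n * k * N + n * k * R := by
    have e1 : ∑ x ∈ H, (f x : ℝ) * g x ≤ ∑ x ∈ H, (n * (g x : ℝ) + k * (f x : ℝ) - n * k) := by
      apply sum_le_sum
      intro x hx
      nlinarith [mul_nonneg (sub_nonneg.2 (hfn x)) (sub_nonneg.2 (hg x hx))]
    rw [sum_sub_distrib, sum_add_distrib, ← mul_sum, ← mul_sum, hsumf, hsumg, sum_const,
      nsmul_eq_mul] at e1
    have e2 : (#A : ℝ) ^ 2 ≤ n ^ 2 := by gcongr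
    have e3 : (#B : ℝ) ^ 2 ≤ n ^ 2 := by gcongr
    have e4 := mul_le_mul_of_nonneg_left e3 hn0.le
    have e5 := mul_le_mul_of_nonneg_left e2 hk.le
    have e6 := mul_le_mul_of_nonneg_left hHcard (mul_pos hn0 hk).le
    rw [hE]
    nlinarith
  have hElb : (N * (N - s)) ^ 2 ≤ M * addEnergy A B := by
    have e1 := card_sq_le_card_mul_addEnergy A B C
    have e2 : N * (N - s) ≤ #((A ×ˢ B).filter fun p => p.1 + p.2 ∈ C) := by
      have : #((A ×ˢ B).filter fun p => p.1 + p.2 ∈ C)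
          = ∑ a ∈ A, #(B.filter fun b => a + b ∈ C) := by
        simp only [card_filter]
        rw [sum_product]
      rw [this]
      push_cast
      have : ∀ a ∈ A, N - s ≤ (#(B.filter fun b => a + b ∈ C) : ℝ) := by
        intro a ha
        have := card_filter_add_card_filter_not (s := B) (fun b => a + b ∈ C)
        have : (#(B.filter fun b => a + b ∈ C) : ℝ) + #(B.filter fun b => a + b ∉ C) = #B := by
          exact_mod_cast this
        linarith [h1 a ha]
      have h3 := card_nsmul_le_sum A (fun a => (#(B.filter fun b => a + b ∈ C) : ℝ)) _ this
      rw [nsmul_eq_mul] at h3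
      exact (mul_le_mul_of_nonneg_right hAN hNs).trans h3
    have e3 : (#((A ×ˢ B).filter fun p => p.1 + p.2 ∈ C) : ℝ) ^ 2 ≤ #C * addEnergy A B := by
      exact_mod_cast e1
    calc (N * (N - s)) ^ 2 ≤ (#((A ×ˢ B).filter fun p => p.1 + p.2 ∈ C) : ℝ) ^ 2 := by
          gcongr
      _ ≤ _ := e3
      _ ≤ _ := by gcongr
  have hM : 0 ≤ M := le_trans (by positivity) hC
  have := mul_le_mul_of_nonneg_left hEub hM
  linarith

theorem zmod_inj (l : ℕ) (x y : ℤ) (hx : 0 ≤ x) (hxl : x < l) (hy : 0 ≤ y) (hyl : y < l)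
    (h : (x : ZMod l) = (y : ZMod l)) : x = y := by
  rw [ZMod.intCast_eq_intCast_iff'] at h
  rwa [Int.emod_eq_of_lt hx hxl, Int.emod_eq_of_lt hy hyl] at h

theorem zmod_image_card (l : ℕ) (A : Finset ℤ) (hA : ∀ a ∈ A, 0 ≤ a ∧ a ≤ l) :
    #A ≤ #(A.image fun a : ℤ => (a : ZMod l)) + 1 := by
  have h1 : #((A.erase l).image fun a : ℤ => (a : ZMod l)) = #(A.erase l) := by
    apply card_image_of_injOn
    intro x hx y hy h
    rw [mem_coe, mem_erase] at hx hy
    have hx' := hA x hx.2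
    have hy' := hA y hy.2
    exact zmod_inj l x y hx'.1 (lt_of_le_of_ne hx'.2 hx.1) hy'.1 (lt_of_le_of_ne hy'.2 hy.1) h
  have h2 : #((A.erase l).image fun a : ℤ => (a : ZMod l)) ≤ #(A.image fun a : ℤ => (a : ZMod l)) :=
    card_le_card (image_subset_image (erase_subset _ _))
  have h3 := pred_card_le_card_erase (s := A) (a := (l : ℤ))
  omega

theorem zmod_missing (l : ℕ) (B S : Finset ℤ) (a : ℤ) :
    #((B.image fun b : ℤ => (b : ZMod l)).filter fun b =>
      (a : ZMod l) + b ∉ S.image fun x : ℤ => (x : ZMod l)) ≤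
    #(B.filter fun b => a + b ∉ S) := by
  refine le_trans (card_le_card ?_) (card_image_le (f := fun b : ℤ => (b : ZMod l)))
  intro β hβ
  rw [mem_filter, mem_image] at hβ
  obtain ⟨⟨b, hb, rfl⟩, h⟩ := hβ
  refine mem_image.2 ⟨b, mem_filter.2 ⟨hb, fun hs => h ?_⟩, rfl⟩
  exact mem_image.2 ⟨a + b, hs, by push_cast; rfl⟩

theorem core (A B S : Finset ℤ) (l s t : ℕ) (n N M : ℝ) (hl : 0 < l)
    (hA : ∀ a ∈ A, 0 ≤ a ∧ a ≤ l) (hB : ∀ b ∈ B, 0 ≤ b ∧ b ≤ l)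
    (hA0 : (0 : ℤ) ∈ A) (hAl : (l : ℤ) ∈ A) (hB0 : (0 : ℤ) ∈ B)
    (hgen : ∀ H : AddSubgroup ℤ, (∀ a ∈ A, a ∈ H) → (∀ b ∈ B, b ∈ H) → H = ⊤)
    (h1 : ∀ a ∈ A, #(B.filter fun b => a + b ∉ S) ≤ s)
    (h2 : ∀ b ∈ B, #(A.filter fun a => a + b ∉ S) ≤ s)
    (hpop : ∀ x, t ≤ #((A ×ˢ B).filter fun p => p.1 + p.2 = x) → x ∈ S)
    (hAN : N + 1 ≤ #A) (hBN : N + 1 ≤ #B) (hAn : (#A : ℝ) ≤ n) (hBn : (#B : ℝ) ≤ n)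
    (hM : (#S : ℝ) + 2 * s ≤ M + N)
    (hk : 0 < 2 * N - 2 * s - M) (hN : 0 < N) (hNs : 0 ≤ N - s)
    (hnum : M * (n ^ 3 + (2 * N - 2 * s - M) * n ^ 2 - 2 * n * (2 * N - 2 * s - M) * N
        + n * (2 * N - 2 * s - M) * (3 * t)) < (N * (N - s)) ^ 2)
    (hnum2 : 3 * M < 5 * N) (hnum3 : (#S : ℝ) + 6 * s < 3 * N) :
    (l : ℝ) ≤ M := by
  classical
  have : NeZero l := ⟨hl.ne'⟩
  set A' := A.image fun a : ℤ => (a : ZMod l) with hA'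
  set B' := B.image fun a : ℤ => (a : ZMod l) with hB'
  set C := S.image fun a : ℤ => (a : ZMod l) with hC
  have hA'N : N ≤ #A' := by
    have : (#A : ℝ) ≤ #A' + 1 := by exact_mod_cast zmod_image_card l A hA
    linarith
  have hB'N : N ≤ #B' := by
    have : (#B : ℝ) ≤ #B' + 1 := by exact_mod_cast zmod_image_card l B hB
    linarith
  have hA'n : (#A' : ℝ) ≤ n := le_trans (by exact_mod_cast card_image_le) hAn
  have hB'n : (#B' : ℝ) ≤ n := le_trans (by exact_mod_cast card_image_le) hBn
  have hCM : (#C : ℝ) ≤ M := by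
    set gB := B.filter fun b : ℤ => b ≠ (l : ℤ) ∧ b ∈ S ∧ b + (l : ℤ) ∈ S with hgB
    have hgBc : #B ≤ #gB + 1 + s + s := by
      have hsub : B ⊆ gB ∪ {(l : ℤ)} ∪ (B.filter fun b => (0 : ℤ) + b ∉ S) ∪
          (B.filter fun b => (l : ℤ) + b ∉ S) := by
        intro b hb
        simp only [hgB, mem_union, mem_filter, mem_singleton, zero_add, add_comm (l : ℤ)]
        tauto
      have e := card_le_card hsub
      have e1 := card_union_le (gB ∪ {(l : ℤ)} ∪ (B.filter fun b => (0 : ℤ) + b ∉ S))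
          (B.filter fun b => (l : ℤ) + b ∉ S)
      have e2 := card_union_le (gB ∪ {(l : ℤ)}) (B.filter fun b => (0 : ℤ) + b ∉ S)
      have e3 := card_union_le gB {(l : ℤ)}
      rw [card_singleton] at e3
      have e4 := h1 0 hA0
      have e5 := h1 l hAl
      omega
    set Rm := gB.image fun b => b + (l : ℤ) with hRm
    have hRmc : #Rm = #gB := card_image_of_injective _ (add_left_injective _)
    have hRmS : Rm ⊆ S := by
      intro z hz
      obtain ⟨b, hb, rfl⟩ := mem_image.1 hz
      exact (mem_filter.1 hb).2.2.2
    have hCsub : C ⊆ (S \ Rm).image fun a : ℤ => (a : ZMod l) := by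
      intro c hc
      obtain ⟨z, hz, rfl⟩ := mem_image.1 hc
      by_cases hzR : z ∈ Rm
      · obtain ⟨b, hb, rfl⟩ := mem_image.1 hzR
        have hb' := mem_filter.1 hb
        refine mem_image.2 ⟨b, mem_sdiff.2 ⟨hb'.2.2.1, fun hbR => ?_⟩, by simp⟩
        obtain ⟨b'', hb'', h⟩ := mem_image.1 hbR
        have := hB b'' (mem_filter.1 hb'').1
        have := hB b hb'.1
        have := hb'.2.1
        omega
      · exact mem_image.2 ⟨z, mem_sdiff.2 ⟨hz, hzR⟩, rfl⟩
    have e1 := (card_le_card hCsub).trans card_image_le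
    have e2 := card_sdiff_add_card_eq_card hRmS
    have e3 : #C + #B ≤ #S + 1 + s + s := by omega
    have : (#C : ℝ) + #B ≤ #S + 1 + s + s := by exact_mod_cast e3
    linarith
  obtain ⟨hAAB, hrep⟩ := golden_s7 A' B' C n N M s (3 * t) hA'N hB'N hA'n hB'n hCM
    (by
      intro α hα
      obtain ⟨a, ha, rfl⟩ := mem_image.1 hα
      exact_mod_cast (zmod_missing l B S a).trans (h1 a ha))
    (by
      intro β hβ
      obtain ⟨b, hb, rfl⟩ := mem_image.1 hβ
      have e := zmod_missing l A S b
      have e' := h2 b hb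
      simp only [add_comm _ b] at e'
      simp only [add_comm _ (b : ZMod l)]
      exact_mod_cast e.trans e')
    hk hN hNs hnum
  have hsumC : A' + B' ⊆ C := by
    intro c hc
    by_contra hcC
    have hlt := hrep c hc
    have hle : #((A' ×ˢ B').filter fun p => p.1 + p.2 = c) ≤ 3 * t := by
      set W := (A ×ˢ B).filter fun p => ((p.1 + p.2 : ℤ) : ZMod l) = c with hW
      have e1 : #((A' ×ˢ B').filter fun p => p.1 + p.2 = c) ≤ #W := by
        refine le_trans (card_le_card ?_)
          (card_image_le (f := fun p : ℤ × ℤ => ((p.1 : ZMod l), (p.2 : ZMod l))))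
        rintro ⟨α, β⟩ hp
        rw [mem_filter, mem_product] at hp
        obtain ⟨⟨hα, hβ⟩, hαβ⟩ := hp
        obtain ⟨a, ha, rfl⟩ := mem_image.1 hα
        obtain ⟨b, hb, rfl⟩ := mem_image.1 hβ
        refine mem_image.2 ⟨(a, b), mem_filter.2 ⟨mem_product.2 ⟨ha, hb⟩, ?_⟩, rfl⟩
        push_cast; exact hαβ
      set T := (Icc (0 : ℤ) (2 * l)).filter fun x : ℤ => (x : ZMod l) = c with hT
      have hT3 : #T ≤ 3 := by
        have : #T ≤ #(Icc (0 : ℤ) 2) := by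
          apply card_le_card_of_injOn (fun x => x / (l : ℤ))
          · intro x hx
            rw [mem_coe, mem_filter, mem_Icc] at hx
            rw [mem_coe, mem_Icc]
            have hl' : (0 : ℤ) < l := by exact_mod_cast hl
            refine ⟨Int.ediv_nonneg hx.1.1 hl'.le, ?_⟩
            exact Int.ediv_le_of_le_mul hl' hx.1.2
          · intro x hx y hy h
            rw [mem_coe, mem_filter] at hx hy
            have h' : x / (l : ℤ) = y / (l : ℤ) := h
            have e := hx.2.trans hy.2.symm
            rw [ZMod.intCast_eq_intCast_iff'] at e
            rw [← Int.mul_ediv_add_emod x l, ← Int.mul_ediv_add_emod y l, h', e]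
        simpa using this
      have e2 : #W = ∑ x ∈ T, #(W.filter fun p => p.1 + p.2 = x) := by
        apply card_eq_sum_card_fiberwise (f := fun p : ℤ × ℤ => p.1 + p.2)
        intro p hp
        rw [mem_coe, mem_filter, mem_product] at hp
        rw [mem_coe, mem_filter, mem_Icc]
        have := hA _ hp.1.1
        have := hB _ hp.1.2
        refine ⟨?_, hp.2⟩
        change 0 ≤ p.1 + p.2 ∧ p.1 + p.2 ≤ 2 * (l : ℤ)
        omega
      have e3 : ∑ x ∈ T, #(W.filter fun p => p.1 + p.2 = x) ≤ #T • t := by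
        apply sum_le_card_nsmul
        intro x hx
        have hxS : x ∉ S := fun h => hcC (mem_image.2 ⟨x, h, (mem_filter.1 hx).2⟩)
        have : ¬ t ≤ #((A ×ˢ B).filter fun p => p.1 + p.2 = x) := fun h => hxS (hpop x h)
        push Not at this
        refine le_trans (card_le_card ?_) this.le
        exact filter_subset_filter _ (filter_subset _ _)
      rw [smul_eq_mul] at e3
      have : #T * t ≤ 3 * t := Nat.mul_le_mul_right _ hT3
      omega
    have : (#((A' ×ˢ B').filter fun p => p.1 + p.2 = c) : ℝ) ≤ 3 * t := by exact_mod_cast hle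
    linarith
  have hsumM : (#(A' + B') : ℝ) ≤ M := le_trans (by exact_mod_cast card_le_card hsumC) hCM
  by_cases hfull : A' + B' = univ
  · rw [hfull, card_univ, ZMod.card] at hsumM
    exact hsumM
  exfalso
  have hA'0 : (0 : ZMod l) ∈ A' := mem_image.2 ⟨0, hA0, by simp⟩
  have hB'0 : (0 : ZMod l) ∈ B' := mem_image.2 ⟨0, hB0, by simp⟩
  obtain ⟨H, x, b₀, hx, hx2, hxA, hb₀, hA2, hB2, b₁, hb₁, hb₁x⟩ :=
    group_struct A' B' N M hA'0 hB'0 hAAB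
    (by
      intro H hAH hBH
      have : H.comap (Int.castAddHom (ZMod l)) = ⊤ := by
        apply hgen
        · intro a ha
          exact hAH _ (mem_image.2 ⟨a, ha, rfl⟩)
        · intro a ha
          exact hBH _ (mem_image.2 ⟨a, ha, rfl⟩)
      rw [eq_top_iff]
      intro y _
      obtain ⟨z, rfl⟩ := ZMod.intCast_surjective y
      have : z ∈ H.comap (Int.castAddHom (ZMod l)) := by rw [this]; trivial
      exact this)
    hfull hA'N hB'N hsumM hnum2
  set A0 := A.filter fun a : ℤ => (a : ZMod l) ∈ H with hA0d
  set A1 := A.filter fun a : ℤ => (a : ZMod l) - x ∈ H with hA1d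
  set B0 := B.filter fun b : ℤ => (b : ZMod l) - b₀ ∈ H with hB0d
  set B1 := B.filter fun b : ℤ => (b : ZMod l) - b₀ - x ∈ H with hB1d
  have cA : #A ≤ #A0 + #A1 := by
    refine le_trans (card_le_card ?_) (card_union_le A0 A1)
    intro a ha
    rw [mem_union, mem_filter, mem_filter]
    rcases hA2 _ (mem_image.2 ⟨a, ha, rfl⟩) with h | h
    · exact Or.inl ⟨ha, h⟩
    · exact Or.inr ⟨ha, h⟩
  have cB : #B ≤ #B0 + #B1 := by
    refine le_trans (card_le_card ?_) (card_union_le B0 B1)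
    intro a ha
    rw [mem_union, mem_filter, mem_filter]
    rcases hB2 _ (mem_image.2 ⟨a, ha, rfl⟩) with h | h
    · exact Or.inl ⟨ha, h⟩
    · exact Or.inr ⟨ha, h⟩
  have nA0 : A0.Nonempty := ⟨0, mem_filter.2 ⟨hA0, by simp [H.zero_mem]⟩⟩
  have nA1 : A1.Nonempty := by
    obtain ⟨a, ha, rfl⟩ := mem_image.1 hxA
    exact ⟨a, mem_filter.2 ⟨ha, by simp [H.zero_mem]⟩⟩
  have nB0 : B0.Nonempty := by
    obtain ⟨a, ha, rfl⟩ := mem_image.1 hb₀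
    exact ⟨a, mem_filter.2 ⟨ha, by simp [H.zero_mem]⟩⟩
  have nB1 : B1.Nonempty := by
    obtain ⟨a, ha, rfl⟩ := mem_image.1 hb₁
    exact ⟨a, mem_filter.2 ⟨ha, hb₁x⟩⟩
  have hinter : ∀ X Y : Finset ℤ, X ⊆ A → Y ⊆ B → X.Nonempty → Y.Nonempty →
      #X + #Y ≤ #(S ∩ (X + Y)) + 2 * s + 1 := by
    intro X Y hX hY nX nY
    apply int_restricted X Y S s nX nY
    · intro a ha
      exact (card_le_card (filter_subset_filter _ hY)).trans (h1 a (hX ha))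
    · intro a ha
      exact (card_le_card (filter_subset_filter _ hX)).trans (h2 a (hY ha))
  set Z0 := S.filter fun z : ℤ => (z : ZMod l) - b₀ ∈ H with hZ0
  set Z1 := S.filter fun z : ℤ => (z : ZMod l) - b₀ - x ∈ H with hZ1
  set Z2 := S.filter fun z : ℤ => (z : ZMod l) - b₀ - (x + x) ∈ H with hZ2
  have hd01 : Disjoint Z0 Z1 := by
    rw [disjoint_left]
    intro z h0 h1
    apply hx
    have := H.sub_mem (mem_filter.1 h0).2 (mem_filter.1 h1).2
    convert this using 1; abel
  have hd02 : Disjoint Z0 Z2 := by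
    rw [disjoint_left]
    intro z h0 h1
    apply hx2
    have := H.sub_mem (mem_filter.1 h0).2 (mem_filter.1 h1).2
    convert this using 1; abel
  have hd12 : Disjoint Z1 Z2 := by
    rw [disjoint_left]
    intro z h0 h1
    apply hx
    have := H.sub_mem (mem_filter.1 h0).2 (mem_filter.1 h1).2
    convert this using 1; abel
  have hZS : #Z0 + #Z1 + #Z2 ≤ #S := by
    rw [← card_union_of_disjoint hd01, ← card_union_of_disjoint (disjoint_union_left.2 ⟨hd02, hd12⟩)]
    exact card_le_card (union_subset (union_subset (filter_subset _ _) (filter_subset _ _))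
      (filter_subset _ _))
  have i00 : #(S ∩ (A0 + B0)) ≤ #Z0 := by
    apply card_le_card
    intro z hz
    rw [mem_inter, mem_add] at hz
    obtain ⟨hzS, a, ha, b, hb, rfl⟩ := hz
    refine mem_filter.2 ⟨hzS, ?_⟩
    have := H.add_mem (mem_filter.1 ha).2 (mem_filter.1 hb).2
    convert this using 1; push_cast; abel
  have i01 : #(S ∩ (A0 + B1)) ≤ #Z1 := by
    apply card_le_card
    intro z hz
    rw [mem_inter, mem_add] at hz
    obtain ⟨hzS, a, ha, b, hb, rfl⟩ := hz
    refine mem_filter.2 ⟨hzS, ?_⟩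
    have := H.add_mem (mem_filter.1 ha).2 (mem_filter.1 hb).2
    convert this using 1; push_cast; abel
  have i10 : #(S ∩ (A1 + B0)) ≤ #Z1 := by
    apply card_le_card
    intro z hz
    rw [mem_inter, mem_add] at hz
    obtain ⟨hzS, a, ha, b, hb, rfl⟩ := hz
    refine mem_filter.2 ⟨hzS, ?_⟩
    have := H.add_mem (mem_filter.1 ha).2 (mem_filter.1 hb).2
    convert this using 1; push_cast; abel
  have i11 : #(S ∩ (A1 + B1)) ≤ #Z2 := by
    apply card_le_card
    intro z hz
    rw [mem_inter, mem_add] at hz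
    obtain ⟨hzS, a, ha, b, hb, rfl⟩ := hz
    refine mem_filter.2 ⟨hzS, ?_⟩
    have := H.add_mem (mem_filter.1 ha).2 (mem_filter.1 hb).2
    convert this using 1; push_cast; abel
  have j00 := hinter A0 B0 (filter_subset _ _) (filter_subset _ _) nA0 nB0
  have j01 := hinter A0 B1 (filter_subset _ _) (filter_subset _ _) nA0 nB1
  have j10 := hinter A1 B0 (filter_subset _ _) (filter_subset _ _) nA1 nB0
  have j11 := hinter A1 B1 (filter_subset _ _) (filter_subset _ _) nA1 nB1
  have hfin : 3 * (#A + #B) ≤ 2 * #S + 12 * s + 6 := by omega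
  have : 3 * ((#A : ℝ) + #B) ≤ 2 * #S + 12 * s + 6 := by exact_mod_cast hfin
  linarith

theorem normalized (A B S : Finset ℤ) (s t : ℕ) (n N M : ℝ)
    (hA : ∀ a ∈ A, 0 ≤ a) (hB : ∀ b ∈ B, 0 ≤ b)
    (hA0 : (0 : ℤ) ∈ A) (hB0 : (0 : ℤ) ∈ B)
    (hgen : ∀ H : AddSubgroup ℤ, (∀ a ∈ A, a ∈ H) → (∀ b ∈ B, b ∈ H) → H = ⊤)
    (h1 : ∀ a ∈ A, #(B.filter fun b => a + b ∉ S) ≤ s)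
    (h2 : ∀ b ∈ B, #(A.filter fun a => a + b ∉ S) ≤ s)
    (hpop : ∀ x, t ≤ #((A ×ˢ B).filter fun p => p.1 + p.2 = x) → x ∈ S)
    (hAN : N + 1 ≤ #A) (hBN : N + 1 ≤ #B) (hAn : (#A : ℝ) ≤ n) (hBn : (#B : ℝ) ≤ n)
    (hM : (#S : ℝ) + 2 * s ≤ M + N)
    (hk : 0 < 2 * N - 2 * s - M) (hN : 0 < N) (hNs : 0 ≤ N - s)
    (hnum : M * (n ^ 3 + (2 * N - 2 * s - M) * n ^ 2 - 2 * n * (2 * N - 2 * s - M) * N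
        + n * (2 * N - 2 * s - M) * (3 * t)) < (N * (N - s)) ^ 2)
    (hnum2 : 3 * M < 5 * N) (hnum3 : (#S : ℝ) + 6 * s < 3 * N) :
    ∃ l : ℕ, (∀ a ∈ A, a ≤ l) ∧ (∀ b ∈ B, b ≤ l) ∧ (l : ℝ) ≤ M := by
  classical
  have hne : (A ∪ B).Nonempty := ⟨0, mem_union_left _ hA0⟩
  set m := (A ∪ B).max' hne with hm
  have hmem : m ∈ A ∪ B := max'_mem _ _
  have hle : ∀ z ∈ A ∪ B, z ≤ m := fun z hz => le_max' _ _ hz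
  have hm0 : 0 < m := by
    have hc : 1 < #A := by
      have : (1 : ℝ) < #A := by linarith
      exact_mod_cast this
    obtain ⟨z, hz, hz0⟩ := exists_mem_ne hc 0
    have := hA z hz
    have := hle z (mem_union_left _ hz)
    omega
  obtain ⟨l, hl⟩ := Int.eq_ofNat_of_zero_le hm0.le
  have hl0 : 0 < l := by omega
  have hAl : ∀ a ∈ A, a ≤ l := fun a ha => hl ▸ hle a (mem_union_left _ ha)
  have hBl : ∀ a ∈ B, a ≤ l := fun a ha => hl ▸ hle a (mem_union_right _ ha)
  refine ⟨l, hAl, hBl, ?_⟩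
  rw [hl] at hmem
  rcases mem_union.1 hmem with h | h
  · exact core A B S l s t n N M hl0 (fun a ha => ⟨hA a ha, hAl a ha⟩)
      (fun a ha => ⟨hB a ha, hBl a ha⟩) hA0 h hB0 hgen h1 h2 hpop hAN hBN hAn hBn hM hk hN hNs
      hnum hnum2 hnum3
  · refine core B A S l s t n N M hl0 (fun a ha => ⟨hB a ha, hBl a ha⟩)
      (fun a ha => ⟨hA a ha, hAl a ha⟩) hB0 h hA0 (fun H e1 e2 => hgen H e2 e1) ?_ ?_ ?_
      hBN hAN hBn hAn hM hk hN hNs hnum hnum2 hnum3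
    · intro b hb
      have := h2 b hb
      simpa only [add_comm b] using this
    · intro a ha
      have := h1 a ha
      simpa only [add_comm a] using this
    · intro x hx
      apply hpop x
      refine hx.trans ?_
      apply card_le_card_of_injOn Prod.swap
      · intro p hp
        rw [mem_coe, mem_filter, mem_product] at hp
        rw [mem_coe, mem_filter, mem_product]
        exact ⟨⟨hp.1.2, hp.1.1⟩, by rw [← hp.2, add_comm]; rfl⟩
      · exact Prod.swap_injective.injOn

theorem wrapped (A B S : Finset ℤ) (s t : ℕ) (n N M : ℝ)
    (h1 : ∀ a ∈ A, #(B.filter fun b => a + b ∉ S) ≤ s)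
    (h2 : ∀ b ∈ B, #(A.filter fun a => a + b ∉ S) ≤ s)
    (hpop : ∀ x, t ≤ #((A ×ˢ B).filter fun p => p.1 + p.2 = x) → x ∈ S)
    (hAN : N + 1 ≤ #A) (hBN : N + 1 ≤ #B) (hAn : (#A : ℝ) ≤ n) (hBn : (#B : ℝ) ≤ n)
    (hM : (#S : ℝ) + 2 * s ≤ M + N)
    (hk : 0 < 2 * N - 2 * s - M) (hN : 0 < N) (hNs : 0 ≤ N - s)
    (hnum : M * (n ^ 3 + (2 * N - 2 * s - M) * n ^ 2 - 2 * n * (2 * N - 2 * s - M) * N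
        + n * (2 * N - 2 * s - M) * (3 * t)) < (N * (N - s)) ^ 2)
    (hnum2 : 3 * M < 5 * N) (hnum3 : (#S : ℝ) + 6 * s < 3 * N) :
    ∃ (l : ℕ) (x y d : ℤ), d ≠ 0 ∧ (l : ℝ) ≤ M ∧
      (∀ a ∈ A, ∃ i : ℕ, i ≤ l ∧ a = x + d * i) ∧ (∀ b ∈ B, ∃ i : ℕ, i ≤ l ∧ b = y + d * i) := by
  classical
  have hcA : 1 < #A := by
    have : (1 : ℝ) < #A := by linarith
    exact_mod_cast this
  have hcB : 1 < #B := by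
    have : (1 : ℝ) < #B := by linarith
    exact_mod_cast this
  have nA : A.Nonempty := card_pos.1 (by omega)
  have nB : B.Nonempty := card_pos.1 (by omega)
  set a₀ := A.min' nA with ha₀
  set b₀ := B.min' nB with hb₀
  have ha₀A : a₀ ∈ A := min'_mem _ _
  have hb₀B : b₀ ∈ B := min'_mem _ _
  have hAmin : ∀ a ∈ A, a₀ ≤ a := fun a ha => min'_le _ _ ha
  have hBmin : ∀ a ∈ B, b₀ ≤ a := fun a ha => min'_le _ _ ha
  set D : AddSubgroup ℤ := AddSubgroup.closure ({z | ∃ a ∈ A, z = a - a₀} ∪ {z | ∃ b ∈ B, z = b - b₀})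
    with hD
  have hDA : ∀ a ∈ A, a - a₀ ∈ D := fun a ha => AddSubgroup.subset_closure (Or.inl ⟨a, ha, rfl⟩)
  have hDB : ∀ a ∈ B, a - b₀ ∈ D := fun a ha => AddSubgroup.subset_closure (Or.inr ⟨a, ha, rfl⟩)
  obtain ⟨d, hd0, hdD⟩ : ∃ d : ℤ, 0 ≤ d ∧ D = AddSubgroup.zmultiples d := by
    obtain ⟨d, hd⟩ := Int.subgroup_cyclic D
    rw [← AddSubgroup.zmultiples_eq_closure] at hd
    refine ⟨|d|, abs_nonneg d, ?_⟩
    rw [hd]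
    rcases abs_choice d with h | h <;> rw [h]
    rw [AddSubgroup.zmultiples_neg]
  have hdvd : ∀ z ∈ D, d ∣ z := by
    intro z hz
    rw [hdD] at hz
    exact Int.mem_zmultiples_iff.1 hz
  obtain ⟨a₁, ha₁, hne⟩ := exists_mem_ne hcA a₀
  have hdpos : 0 < d := by
    rcases hd0.lt_or_eq with h | h
    · exact h
    · exfalso
      have := hdvd _ (hDA a₁ ha₁)
      rw [← h, zero_dvd_iff] at this
      omega
  have hinj : ∀ c : ℤ, Function.Injective (fun z : ℤ => c + d * z) := by
    intro c z z' h
    have h' : c + d * z = c + d * z' := h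
    exact mul_left_cancel₀ hdpos.ne' (by linarith)
  set A₁ := A.preimage (fun z : ℤ => a₀ + d * z) (hinj a₀).injOn with hA₁
  set B₁ := B.preimage (fun z : ℤ => b₀ + d * z) (hinj b₀).injOn with hB₁
  set S₁ := S.preimage (fun z : ℤ => a₀ + b₀ + d * z) (hinj _).injOn with hS₁
  have mA : ∀ z, z ∈ A₁ ↔ a₀ + d * z ∈ A := fun z => mem_preimage
  have mB : ∀ z, z ∈ B₁ ↔ b₀ + d * z ∈ B := fun z => mem_preimage
  have mS : ∀ z, z ∈ S₁ ↔ a₀ + b₀ + d * z ∈ S := fun z => mem_preimage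
  have exA : ∀ a ∈ A, ∃ z ∈ A₁, a = a₀ + d * z := by
    intro a ha
    obtain ⟨z, hz⟩ := hdvd _ (hDA a ha)
    have : a = a₀ + d * z := by linarith
    exact ⟨z, (mA z).2 (this ▸ ha), this⟩
  have exB : ∀ a ∈ B, ∃ z ∈ B₁, a = b₀ + d * z := by
    intro a ha
    obtain ⟨z, hz⟩ := hdvd _ (hDB a ha)
    have : a = b₀ + d * z := by linarith
    exact ⟨z, (mB z).2 (this ▸ ha), this⟩
  have cA : #A₁ = #A := by
    rw [← card_image_of_injective A₁ (hinj a₀)]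
    congr 1
    ext a
    rw [mem_image]
    constructor
    · rintro ⟨z, hz, rfl⟩; exact (mA z).1 hz
    · intro ha
      obtain ⟨z, hz, e⟩ := exA a ha
      exact ⟨z, hz, e.symm⟩
  have cB : #B₁ = #B := by
    rw [← card_image_of_injective B₁ (hinj b₀)]
    congr 1
    ext a
    rw [mem_image]
    constructor
    · rintro ⟨z, hz, rfl⟩; exact (mB z).1 hz
    · intro ha
      obtain ⟨z, hz, e⟩ := exB a ha
      exact ⟨z, hz, e.symm⟩
  have cS : (#S₁ : ℝ) ≤ #S := by
    have : #S₁ ≤ #S := by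
      apply card_le_card_of_injOn (fun z : ℤ => a₀ + b₀ + d * z)
      · intro z hz; exact (mS z).1 hz
      · exact (hinj _).injOn
    exact_mod_cast this
  obtain ⟨l, hAl, hBl, hlM⟩ := normalized A₁ B₁ S₁ s t n N M
    (by
      intro z hz
      have := hAmin _ ((mA z).1 hz)
      by_contra hneg
      push Not at hneg
      nlinarith)
    (by
      intro z hz
      have := hBmin _ ((mB z).1 hz)
      by_contra hneg
      push Not at hneg
      nlinarith)
    ((mA 0).2 (by simpa using ha₀A)) ((mB 0).2 (by simpa using hb₀B))
    (by
      intro H hAH hBH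
      have hle : D ≤ H.map (AddMonoidHom.mulLeft d) := by
        rw [hD, AddSubgroup.closure_le]
        rintro z (⟨a, ha, rfl⟩ | ⟨a, ha, rfl⟩)
        · obtain ⟨y, hy, e⟩ := exA a ha
          exact ⟨y, hAH y hy, by rw [e]; simp⟩
        · obtain ⟨y, hy, e⟩ := exB a ha
          exact ⟨y, hBH y hy, by rw [e]; simp⟩
      have hdmem : d ∈ D := by rw [hdD]; exact AddSubgroup.mem_zmultiples d
      obtain ⟨y, hy, e⟩ := hle hdmem
      have hy1 : y = 1 := by
        have e' : d * y = d := e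
        exact mul_left_cancel₀ hdpos.ne' (by rw [e', mul_one])
      rw [eq_top_iff]
      intro z _
      have : z = z • (1 : ℤ) := by simp
      rw [this]
      exact H.zsmul_mem (hy1 ▸ hy) z)
    (by
      intro z hz
      refine le_trans ?_ (h1 _ ((mA z).1 hz))
      apply card_le_card_of_injOn (fun z : ℤ => b₀ + d * z)
      · intro y hy
        rw [mem_coe, mem_filter] at hy
        rw [mem_coe, mem_filter]
        refine ⟨(mB y).1 hy.1, fun h => hy.2 ((mS _).2 ?_)⟩
        convert h using 1; ring
      · exact (hinj _).injOn)
    (by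
      intro z hz
      refine le_trans ?_ (h2 _ ((mB z).1 hz))
      apply card_le_card_of_injOn (fun z : ℤ => a₀ + d * z)
      · intro y hy
        rw [mem_coe, mem_filter] at hy
        rw [mem_coe, mem_filter]
        refine ⟨(mA y).1 hy.1, fun h => hy.2 ((mS _).2 ?_)⟩
        convert h using 1; ring
      · exact (hinj _).injOn)
    (by
      intro x hx
      rw [mS]
      apply hpop
      refine hx.trans ?_
      apply card_le_card_of_injOn (fun p : ℤ × ℤ => (a₀ + d * p.1, b₀ + d * p.2))
      · intro p hp
        rw [mem_coe, mem_filter, mem_product] at hp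
        rw [mem_coe, mem_filter, mem_product]
        refine ⟨⟨(mA _).1 hp.1.1, (mB _).1 hp.1.2⟩, ?_⟩
        rw [← hp.2]; ring
      · intro p _ q _ h
        rw [Prod.mk.injEq] at h
        exact Prod.ext (hinj a₀ h.1) (hinj b₀ h.2))
    (by rw [cA]; exact hAN) (by rw [cB]; exact hBN) (by rw [cA]; exact hAn) (by rw [cB]; exact hBn)
    (by linarith) hk hN hNs hnum hnum2 (by linarith)
  refine ⟨l, a₀, b₀, d, hdpos.ne', hlM, ?_, ?_⟩
  · intro a ha
    obtain ⟨z, hz, e⟩ := exA a ha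
    have h0 : 0 ≤ z := by
      have := hAmin _ ha
      by_contra hneg
      push Not at hneg
      nlinarith
    obtain ⟨i, rfl⟩ := Int.eq_ofNat_of_zero_le h0
    exact ⟨i, by exact_mod_cast hAl _ hz, e⟩
  · intro a ha
    obtain ⟨z, hz, e⟩ := exB a ha
    have h0 : 0 ≤ z := by
      have := hBmin _ ha
      by_contra hneg
      push Not at hneg
      nlinarith
    obtain ⟨i, rfl⟩ := Int.eq_ofNat_of_zero_le h0
    exact ⟨i, by exact_mod_cast hBl _ hz, e⟩

set_option maxHeartbeats 1000000 in
/-- The numerical estimates needed to apply `wrapped`. -/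
theorem final_num (n q s t δ τ N M : ℝ) (hδ0 : 0 < δ) (hτ : τ = (Real.sqrt 5 - 1) / 2 - δ)
    (hτ0 : 0 < τ) (hq : 0 < q) (hn : 0 < n) (hqn : 32 * q ≤ τ * n) (htq : 32 * t ≤ q * τ)
    (ht1 : 1 ≤ t) (hs0 : 0 ≤ s) (hs : 3 * s ≤ 4 * q) (hN : N = n - 2 * q - 1)
    (hM : M = (2 + δ) * n + 2 * s - N) :
    0 < 2 * N - 2 * s - M ∧ 0 < N ∧ 0 ≤ N - s ∧
    M * (n ^ 3 + (2 * N - 2 * s - M) * n ^ 2 - 2 * n * (2 * N - 2 * s - M) * N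
        + n * (2 * N - 2 * s - M) * (3 * t)) < (N * (N - s)) ^ 2 ∧
    3 * M < 5 * N ∧ (2 + δ) * n + 6 * s < 3 * N ∧ M + 1 ≤ (1 + δ) * n + 10 * q := by
  have h5 : Real.sqrt 5 ^ 2 = 5 := Real.sq_sqrt (by norm_num)
  have h5a : 2.236 < Real.sqrt 5 := by
    rw [Real.lt_sqrt (by norm_num)]; norm_num
  have h5b : Real.sqrt 5 < 2.2361 := by
    rw [Real.sqrt_lt' (by norm_num)]; norm_num
  have hτ1 : τ ≤ 0.61805 := by linarith
  have hδ1 : δ ≤ 0.61805 := by linarith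
  have htq2 : t ≤ 0.02 * q := by nlinarith
  have hqn2 : q ≤ 0.02 * n := by nlinarith
  have hδn : δ * n ≤ 0.61805 * n - 32 * q := by
    have : δ + τ ≤ 0.61805 := by linarith
    nlinarith
  have hδn0 : 0 < δ * n := by positivity
  set k := 2 * N - 2 * s - M with hk
  have hk1 : (1 - δ) * n - 11.4 * q ≤ k := by rw [hk, hM, hN]; linarith
  have hk0 : 0 < (1 - δ) * n - 11.4 * q := by linarith
  have hM1 : M ≤ (1 + δ) * n + 4.7 * q := by rw [hM, hN]; linarith
  have hM0 : 0 < M := by rw [hM, hN]; linarith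
  refine ⟨by linarith, by linarith, by linarith, ?_, by linarith, by linarith, by linarith⟩
  have hb1 : ((1 - δ) * n - 11.4 * q) * (n - 4.1 * q) ≤ k * (2 * N - n - 3 * t) :=
    mul_le_mul hk1 (by linarith) (by linarith) (by linarith)
  have hb2 : n ^ 2 - k * (2 * N - n - 3 * t) ≤ n * (δ * n + 15.5 * q) := by
    have e : ((1 - δ) * n - 11.4 * q) * (n - 4.1 * q)
      = n ^ 2 - n * (δ * n + 15.5 * q) + 4.1 * (δ * n) * q + 46.74 * q ^ 2 := by ring
    have : 0 < 4.1 * (δ * n) * q + 46.74 * q ^ 2 := by positivity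
    linarith
  have hX : M * (n ^ 3 + k * n ^ 2 - 2 * n * k * N + n * k * (3 * t))
      = M * n * (n ^ 2 - k * (2 * N - n - 3 * t)) := by ring
  rw [hX]
  have hL : M * n * (n ^ 2 - k * (2 * N - n - 3 * t))
      ≤ ((1 + δ) * n + 4.7 * q) * n * (n * (δ * n + 15.5 * q)) := by
    calc _ ≤ M * n * (n * (δ * n + 15.5 * q)) :=
          mul_le_mul_of_nonneg_left hb2 (by positivity)
      _ ≤ _ := by
          apply mul_le_mul_of_nonneg_right _ (by positivity)
          exact mul_le_mul_of_nonneg_right hM1 hn.le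
  have hR1 : n ^ 2 - 5.38 * q * n ≤ N * (N - s) := by
    have := mul_le_mul (show n - 2.02 * q ≤ N by linarith)
      (show n - 3.36 * q ≤ N - s by linarith) (by linarith) (by linarith)
    nlinarith
  have hR2 : (n ^ 2 - 5.38 * q * n) ^ 2 ≤ (N * (N - s)) ^ 2 := by
    apply pow_le_pow_left₀ _ hR1
    nlinarith
  have hkey : ((1 + δ) * n + 4.7 * q) * (δ * n + 15.5 * q) < (n - 5.38 * q) ^ 2 := by
    have e1 : 1 - δ * (1 + δ) = Real.sqrt 5 * τ - τ ^ 2 := by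
      have : δ = (Real.sqrt 5 - 1) / 2 - τ := by linarith
      rw [this]; linear_combination (-1 / 4) * h5
    have e2 : 1.617 * τ ≤ 1 - δ * (1 + δ) := by rw [e1]; nlinarith [mul_nonneg hτ0.le (show 0 ≤ Real.sqrt 5 - τ - 1.617 by linarith)]
    have e3 : 1.617 * 32 * q * n ≤ (1 - δ * (1 + δ)) * n ^ 2 := by
      have : 1.617 * τ * n ^ 2 ≤ (1 - δ * (1 + δ)) * n ^ 2 :=
        mul_le_mul_of_nonneg_right e2 (by positivity)
      have h := mul_le_mul_of_nonneg_right hqn hn.le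
      linarith
    have e4 : q ^ 2 ≤ 0.02 * (q * n) := by nlinarith
    have e5 : δ * (q * n) ≤ 0.61805 * (q * n) :=
      mul_le_mul_of_nonneg_right hδ1 (by positivity)
    have e6 : 0 < q * n := by positivity
    have e7 : 0 ≤ q ^ 2 := by positivity
    linarith
  calc _ ≤ _ := hL
    _ = n ^ 2 * (((1 + δ) * n + 4.7 * q) * (δ * n + 15.5 * q)) := by ring
    _ < n ^ 2 * (n - 5.38 * q) ^ 2 := mul_lt_mul_of_pos_left hkey (by positivity)
    _ = (n ^ 2 - 5.38 * q * n) ^ 2 := by ring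
    _ ≤ _ := hR2

/-- Counting of unpopular pairs. -/
theorem pop_count (A B : Finset ℤ) (t : ℕ) (S : Finset ℤ)
    (hS : S = (A + B).filter fun x => t ≤ #((A ×ˢ B).filter fun p => p.1 + p.2 = x)) :
    #S * t + ∑ a ∈ A, #(B.filter fun b => a + b ∉ S)
      ≤ ∑ x ∈ A + B, min (#((A ×ˢ B).filter fun p => p.1 + p.2 = x)) t := by
  have h1 : ∑ a ∈ A, #(B.filter fun b => a + b ∉ S)
      = #((A ×ˢ B).filter fun p => p.1 + p.2 ∉ S) := by
    simp only [card_filter, sum_product]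
  have h2 : #((A ×ˢ B).filter fun p => p.1 + p.2 ∉ S)
      = ∑ x ∈ (A + B).filter (fun x => ¬ t ≤ #((A ×ˢ B).filter fun p => p.1 + p.2 = x)),
        #((A ×ˢ B).filter fun p => p.1 + p.2 = x) := by
    rw [card_eq_sum_card_fiberwise (f := fun p : ℤ × ℤ => p.1 + p.2)
      (t := (A + B).filter (fun x => ¬ t ≤ #((A ×ˢ B).filter fun p => p.1 + p.2 = x)))]
    · apply sum_congr rfl
      intro x hx
      congr 1
      ext p
      simp only [mem_filter] at hx ⊢
      constructor
      · rintro ⟨⟨a, b⟩, c⟩; exact ⟨a, c⟩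
      · rintro ⟨a, c⟩
        refine ⟨⟨a, ?_⟩, c⟩
        rw [hS, c, mem_filter]
        exact fun h => hx.2 h.2
    · intro p hp
      simp only [coe_filter, Set.mem_ofPred_eq, mem_product, hS, mem_filter, not_and] at hp ⊢
      have := add_mem_add hp.1.1 hp.1.2
      exact ⟨this, hp.2 this⟩
  rw [h1, h2, ← sum_filter_add_sum_filter_not (A + B)
    (fun x => t ≤ #((A ×ˢ B).filter fun p => p.1 + p.2 = x))]
  apply Nat.add_le_add
  · rw [← hS, ← smul_eq_mul, ← sum_const]
    apply sum_le_sum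
    intro x hx
    rw [hS, mem_filter] at hx
    exact le_min hx.2 le_rfl
  · apply sum_le_sum
    intro x hx
    rw [mem_filter] at hx
    exact le_min le_rfl (not_le.mp hx.2).le

/-- Markov: few elements have large defect. -/
theorem markov_defect (A : Finset ℤ) (f : ℤ → ℕ) (s : ℕ) :
    #A * (s + 1) ≤ #(A.filter fun a => f a ≤ s) * (s + 1) + ∑ a ∈ A, f a := by
  have h := card_filter_add_card_filter_not (s := A) (fun a => f a ≤ s)
  have h2 : #(A.filter fun a => ¬ f a ≤ s) * (s + 1) ≤ ∑ a ∈ A, f a := by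
    rw [← smul_eq_mul, ← sum_const]
    calc _ ≤ ∑ a ∈ A.filter fun a => ¬ f a ≤ s, f a := by
          apply sum_le_sum
          intro a ha
          rw [mem_filter] at ha
          omega
      _ ≤ _ := sum_le_sum_of_subset (filter_subset _ _)
  nlinarith

theorem ap_card (d x : ℤ) (hd : d ≠ 0) (l : ℕ) :
    #((range l).image fun i : ℕ => x + d * (i : ℤ)) = l := by
  rw [card_image_of_injective, card_range]
  intro i j hij
  have : d * (i : ℤ) = d * j := by simpa using hij
  exact_mod_cast mul_left_cancel₀ hd this

/-- A Pollard-type robust version of Freiman's 3k-4 theorem. -/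
theorem pollard_robust (A B : Finset ℤ) (n : ℕ) (hA : A.card = n) (hB : B.card = n)
    (hn : 3 ≤ n) (δ : ℝ) (hδ0 : 0 < δ) (hδ1 : δ < (Real.sqrt 5 - 1) / 2)
    (t : ℕ) (ht1 : 1 ≤ t)
    (ht2 : (t : ℝ) ≤ 2 ^ (-10 : ℤ) * ((Real.sqrt 5 - 1) / 2 - δ) ^ 2 * n)
    (hsum : ((∑ x ∈ A + B,
      min (((A ×ˢ B).filter fun p => p.1 + p.2 = x).card) t : ℕ) : ℝ) ≤ (2 + δ) * n * t) :
    ∃ (P Q : Finset ℤ) (d : ℤ),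
      (∃ x, P = (Finset.range P.card).image fun i : ℕ => x + d * (i : ℤ)) ∧
      (∃ y, Q = (Finset.range Q.card).image fun i : ℕ => y + d * (i : ℤ)) ∧
      (P.card : ℝ) ≤ (1 + δ) * n + 10 * Real.sqrt t * Real.sqrt n ∧
      (Q.card : ℝ) ≤ (1 + δ) * n + 10 * Real.sqrt t * Real.sqrt n ∧
      (n : ℝ) - 2 * Real.sqrt t * Real.sqrt n ≤ ((A ∩ P).card : ℝ) ∧
      (n : ℝ) - 2 * Real.sqrt t * Real.sqrt n ≤ ((B ∩ Q).card : ℝ) := by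
  obtain ⟨q, hqdef⟩ : ∃ q, q = Real.sqrt t * Real.sqrt n := ⟨_, rfl⟩
  rw [mul_assoc 10, mul_assoc 2, ← hqdef]
  obtain ⟨τ, hτ⟩ : ∃ τ, τ = (Real.sqrt 5 - 1) / 2 - δ := ⟨_, rfl⟩
  rw [← hτ] at ht2
  have hτ0 : 0 < τ := by linarith
  have hn0 : (0 : ℝ) < n := by exact_mod_cast (by omega : 0 < n)
  have ht0 : (1 : ℝ) ≤ t := by exact_mod_cast ht1
  have hq0 : 0 < q := by
    rw [hqdef]
    exact mul_pos (Real.sqrt_pos.2 (by linarith)) (Real.sqrt_pos.2 hn0)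
  have hq2 : q ^ 2 = t * n := by
    rw [hqdef, mul_pow, Real.sq_sqrt (by linarith), Real.sq_sqrt hn0.le]
  have ht3 : 1024 * (t : ℝ) ≤ τ ^ 2 * n := by
    norm_num at ht2
    linarith
  have hqn : 32 * q ≤ τ * n := by
    apply le_of_sq_le_sq _ (by positivity)
    nlinarith
  have htq : 32 * (t : ℝ) ≤ q * τ := by
    have : 32 * (t : ℝ) * n ≤ q * τ * n := by nlinarith
    exact le_of_mul_le_mul_right this hn0
  obtain ⟨S, hS⟩ : ∃ S, S = (A + B).filter
    fun x => t ≤ #((A ×ˢ B).filter fun p => p.1 + p.2 = x) := ⟨_, rfl⟩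
  have hcnt := pop_count A B t S hS
  have hcntR : (#S : ℝ) * t + ((∑ a ∈ A, #(B.filter fun b => a + b ∉ S) : ℕ) : ℝ)
      ≤ (2 + δ) * n * t := by
    refine le_trans ?_ hsum
    exact_mod_cast hcnt
  have hswap : ∑ a ∈ A, #(B.filter fun b => a + b ∉ S)
      = ∑ b ∈ B, #(A.filter fun a => a + b ∉ S) := by
    simp only [card_filter]
    exact sum_comm
  have hScard : (#S : ℝ) ≤ (2 + δ) * n := by
    have h0 : (0 : ℝ) ≤ ((∑ a ∈ A, #(B.filter fun b => a + b ∉ S) : ℕ) : ℝ) := Nat.cast_nonneg _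
    exact le_of_mul_le_mul_right (by linarith) (show (0 : ℝ) < t by linarith)
  have hm : ((∑ a ∈ A, #(B.filter fun b => a + b ∉ S) : ℕ) : ℝ) ≤ (2 + δ) * q ^ 2 := by
    rw [hq2]
    have : (0 : ℝ) ≤ (#S : ℝ) * t := by positivity
    nlinarith
  have h5b : Real.sqrt 5 < 2.2361 := by
    rw [Real.sqrt_lt' (by norm_num)]; norm_num
  have hδ2 : δ ≤ 0.61806 := by linarith
  obtain ⟨s, hs⟩ : ∃ s, s = ⌊4 * q / 3⌋₊ := ⟨_, rfl⟩
  have hs1 : (s : ℝ) ≤ 4 * q / 3 := by rw [hs]; exact Nat.floor_le (by positivity)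
  have hs2 : 4 * q / 3 < (s : ℝ) + 1 := by rw [hs]; exact Nat.lt_floor_add_one _
  have hmark : ∀ (C : Finset ℤ) (f : ℤ → ℕ), #C = n →
      ((∑ a ∈ C, f a : ℕ) : ℝ) ≤ (2 + δ) * q ^ 2 →
      (n : ℝ) - 2 * q ≤ #(C.filter fun a => f a ≤ s) := by
    intro C f hC hf
    have h := markov_defect C f s
    have h' : (n : ℝ) * (s + 1) ≤ (#(C.filter fun a => f a ≤ s) : ℝ) * (s + 1)
        + ((∑ a ∈ C, f a : ℕ) : ℝ) := by
      rw [hC] at h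
      exact_mod_cast h
    have h3 : (2 + δ) * q ^ 2 ≤ 2 * q * (s + 1) := by nlinarith
    have h4 : ((n : ℝ) - 2 * q) * (s + 1) ≤ (#(C.filter fun a => f a ≤ s) : ℝ) * (s + 1) := by
      linarith
    exact le_of_mul_le_mul_right h4 (by linarith)
  have hA1 := hmark A (fun a => #(B.filter fun b => a + b ∉ S)) hA hm
  have hB1 := hmark B (fun b => #(A.filter fun a => a + b ∉ S)) hB (by rw [← hswap]; exact hm)
  obtain ⟨A', hA'⟩ : ∃ A', A' = A.filter fun a => #(B.filter fun b => a + b ∉ S) ≤ s := ⟨_, rfl⟩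
  obtain ⟨B', hB'⟩ : ∃ B', B' = B.filter fun b => #(A.filter fun a => a + b ∉ S) ≤ s := ⟨_, rfl⟩
  rw [← hA'] at hA1
  rw [← hB'] at hB1
  have hAs : A' ⊆ A := by rw [hA']; exact filter_subset _ _
  have hBs : B' ⊆ B := by rw [hB']; exact filter_subset _ _
  obtain ⟨N, hN⟩ : ∃ N : ℝ, N = n - 2 * q - 1 := ⟨_, rfl⟩
  obtain ⟨M, hM⟩ : ∃ M : ℝ, M = (2 + δ) * n + 2 * s - N := ⟨_, rfl⟩
  obtain ⟨n1, n2, n3, n4, n5, n6, n7⟩ := final_num n q s t δ τ N M hδ0 hτ hτ0 hq0 hn0 hqn htq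
    ht0 (Nat.cast_nonneg _) (by linarith) hN hM
  obtain ⟨l, x, y, d, hd, hl, hx, hy⟩ := wrapped A' B' S s t n N M
    (by
      intro a ha
      rw [hA', mem_filter] at ha
      exact (card_le_card (filter_subset_filter _ hBs)).trans ha.2)
    (by
      intro b hb
      rw [hB', mem_filter] at hb
      exact (card_le_card (filter_subset_filter _ hAs)).trans hb.2)
    (by
      intro z hz
      have hz2 : t ≤ #((A ×ˢ B).filter fun p => p.1 + p.2 = z) :=
        hz.trans (card_le_card (filter_subset_filter _ (product_subset_product hAs hBs)))
      obtain ⟨p, hp⟩ := card_pos.1 (lt_of_lt_of_le ht1 hz2)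
      rw [mem_filter, mem_product] at hp
      rw [hS, mem_filter]
      refine ⟨?_, hz2⟩
      rw [← hp.2]
      exact add_mem_add hp.1.1 hp.1.2)
    (by linarith) (by linarith)
    (by rw [← hA]; exact_mod_cast card_le_card hAs)
    (by rw [← hB]; exact_mod_cast card_le_card hBs)
    (by linarith) n1 n2 n3 n4 n5 (by linarith)
  have hl2 : ((l + 1 : ℕ) : ℝ) ≤ (1 + δ) * n + 10 * q := by push_cast; linarith
  refine ⟨(range (l + 1)).image fun i : ℕ => x + d * (i : ℤ),
    (range (l + 1)).image fun i : ℕ => y + d * (i : ℤ), d, ⟨x, ?_⟩, ⟨y, ?_⟩, ?_, ?_, ?_, ?_⟩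
  · rw [ap_card d x hd]
  · rw [ap_card d y hd]
  · rw [ap_card d x hd]; exact hl2
  · rw [ap_card d y hd]; exact hl2
  · refine hA1.trans ?_
    exact_mod_cast card_le_card (subset_inter hAs fun a ha => by
      obtain ⟨i, hi, rfl⟩ := hx a ha
      exact mem_image.2 ⟨i, mem_range.2 (by omega), rfl⟩)
  · refine hB1.trans ?_
    exact_mod_cast card_le_card (subset_inter hBs fun b hb => by
      obtain ⟨i, hi, rfl⟩ := hy b hb
      exact mem_image.2 ⟨i, mem_range.2 (by omega), rfl⟩)
end
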